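/- Let G and G' be finite abelian groups with Davenport constant D(G) = D(G') ∈ [4, 11]. If L(G) = L(G'), then G ≅ G'. -/

import Mathlib

/-- A sequence over `G₀` (a multiset with entries in `G₀`) with sum zero. -/
def IsZeroSumSeq {G : Type*} [AddCommGroup G] (G₀ : Set G) (S : Multiset G) : Prop :=
  (∀ g ∈ S, g ∈ G₀) ∧ S.sum = 0

/-- A minimal zero-sum sequence (atom) over `G₀`. -/
def IsAtomSeq {G : Type*} [AddCommGroup G] (G₀ : Set G) (A : Multiset G) : Prop :=
  IsZeroSumSeq G₀ A ∧ A ≠ 0 ∧ ∀ B ≤ A, B ≠ 0 → B.sum = 0 → B = A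

/-- The set of lengths of factorizations of `B` into atoms over `G₀`. -/
def LengthSet {G : Type*} [AddCommGroup G] (G₀ : Set G) (B : Multiset G) : Set ℕ :=
  {k | ∃ F : Multiset (Multiset G), F.card = k ∧ (∀ A ∈ F, IsAtomSeq G₀ A) ∧ F.sum = B}

/-- The set of successive distances of a set of naturals. -/
def DistSet (L : Set ℕ) : Set ℕ :=
  {d | ∃ a b, a ∈ L ∧ b ∈ L ∧ a < b ∧ b - a = d ∧ ∀ c ∈ L, ¬(a < c ∧ c < b)}

/-- The set of distances `Δ(G₀)`. -/
def DeltaSet {G : Type*} [AddCommGroup G] (G₀ : Set G) : Set ℕ :=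
  {d | ∃ B : Multiset G, IsZeroSumSeq G₀ B ∧ d ∈ DistSet (LengthSet G₀ B)}

/-- The cross number of a sequence. -/
noncomputable def crossNum {G : Type*} [AddCommGroup G] (S : Multiset G) : ℚ :=
  (S.map (fun g => (1 : ℚ) / addOrderOf g)).sum

/-- `G₀` is an LCN-set: every atom has cross number at least 1. -/
def IsLCNSet {G : Type*} [AddCommGroup G] (G₀ : Set G) : Prop :=
  ∀ A : Multiset G, IsAtomSeq G₀ A → 1 ≤ crossNum A

/-- The set of minimal distances `Δ*(G)`. -/
def DeltaStar (G : Type*) [AddCommGroup G] : Set ℕ :=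
  {d | ∃ G₀ : Set G, DeltaSet G₀ ≠ ∅ ∧ d = sInf (DeltaSet G₀)}

/-- `m(G)`: the maximum of `min Δ(G₀)` over non-half-factorial LCN-sets `G₀`. -/
noncomputable def mConst (G : Type*) [AddCommGroup G] : ℕ :=
  sSup {d | ∃ G₀ : Set G, IsLCNSet G₀ ∧ DeltaSet G₀ ≠ ∅ ∧ d = sInf (DeltaSet G₀)}

/-- The rank of a finite abelian group: the maximal `k` such that `(ZMod p)^k`
embeds into `G` for some prime `p`. -/
noncomputable def grank (G : Type*) [AddCommGroup G] : ℕ :=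
  sSup {k | ∃ p : ℕ, p.Prime ∧ ∃ f : (Fin k → ZMod p) →+ G, Function.Injective f}

/-- The system of sets of lengths `L(G)`. -/
def SystemSets (G : Type*) [AddCommGroup G] : Set (Set ℕ) :=
  {L | ∃ B : Multiset G, B.sum = 0 ∧ L = LengthSet Set.univ B}

/-- The Davenport constant: the maximal length of a minimal zero-sum sequence. -/
noncomputable def DavenportC (G : Type*) [AddCommGroup G] : ℕ :=
  sSup {k | ∃ A : Multiset G, IsAtomSeq (Set.univ : Set G) A ∧ A.card = k}

namespace SetsOfLengths
open Multiset

theorem map_eq_add {α β : Type*} {f : α → β} {A : Multiset α} {B C : Multiset β} (h : A.map f = B + C) :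
    ∃ B' C', A = B' + C' ∧ B'.map f = B ∧ C'.map f = C := by
  induction B using Multiset.induction generalizing A with
  | empty => exact ⟨0, A, by simp, by simp, by simpa using h⟩
  | cons b B ih =>
    have hb : b ∈ A.map f := by rw [h]; simp
    obtain ⟨a, ha, rfl⟩ := Multiset.mem_map.1 hb
    obtain ⟨A, rfl⟩ := Multiset.exists_cons_of_mem ha
    obtain ⟨B', C', rfl, rfl, rfl⟩ := ih (A := A) (by simpa using h)
    exact ⟨a ::ₘ B', C', by simp, by simp, rfl⟩

theorem le_map_iff {α β : Type*} {f : α → β} {A : Multiset α} {B : Multiset β} :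
    B ≤ A.map f ↔ ∃ B' ≤ A, B'.map f = B := by
  constructor
  · intro h
    obtain ⟨C, hC⟩ := Multiset.le_iff_exists_add.1 h
    obtain ⟨B', C', rfl, rfl, rfl⟩ := map_eq_add hC
    exact ⟨B', Multiset.le_add_right _ _, rfl⟩
  · rintro ⟨B', h, rfl⟩
    exact Multiset.map_le_map h

/-- Minimal zero-sum sequences over the whole group. -/
def Atom {G : Type*} [AddCommGroup G] (A : Multiset G) : Prop :=
  A ≠ 0 ∧ A.sum = 0 ∧ ∀ B ≤ A, B ≠ 0 → B.sum = 0 → B = A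

section Basic
variable {G H : Type*} [AddCommGroup G] [AddCommGroup H]

theorem isAtomSeq_univ_iff {A : Multiset G} : IsAtomSeq Set.univ A ↔ Atom A := by
  simp [IsAtomSeq, IsZeroSumSeq, Atom]; tauto

theorem mem_lengthSet {B : Multiset G} {k : ℕ} : k ∈ LengthSet Set.univ B ↔
    ∃ F : Multiset (Multiset G), F.card = k ∧ (∀ A ∈ F, Atom A) ∧ F.sum = B := by
  simp [LengthSet, isAtomSeq_univ_iff]

theorem davenportC_eq : DavenportC G = sSup {k | ∃ A : Multiset G, Atom A ∧ A.card = k} := by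
  simp [DavenportC, isAtomSeq_univ_iff]

theorem card_sum' {α : Type*} (F : Multiset (Multiset α)) : card F.sum = (F.map card).sum := by
  induction F using Multiset.induction with
  | empty => simp
  | cons a s ih => simp [ih]

theorem exists_atom_le (B : Multiset G) (h0 : B ≠ 0) (hs : B.sum = 0) : ∃ A ≤ B, Atom A := by
  induction B using Multiset.strongInductionOn with
  | ih B ih =>
    by_cases h : ∀ C ≤ B, C ≠ 0 → C.sum = 0 → C = B
    · exact ⟨B, le_rfl, h0, hs, h⟩
    · push Not at h
      obtain ⟨C, hC, hC0, hCs, hne⟩ := h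
      obtain ⟨A, hA, h'⟩ := ih C (lt_of_le_of_ne hC hne) hC0 hCs
      exact ⟨A, hA.trans hC, h'⟩

theorem exists_factorization (B : Multiset G) (hs : B.sum = 0) :
    ∃ F : Multiset (Multiset G), (∀ A ∈ F, Atom A) ∧ F.sum = B := by
  induction B using Multiset.strongInductionOn with
  | ih B ih =>
    by_cases h0 : B = 0
    · exact ⟨0, by simp, by simp [h0]⟩
    obtain ⟨A, hA, hat⟩ := exists_atom_le B h0 hs
    obtain ⟨C, rfl⟩ := Multiset.le_iff_exists_add.1 hA
    have hC : C.sum = 0 := by simpa [hat.2.1] using hs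
    have hlt : C < A + C := by
      refine lt_of_le_of_ne (Multiset.le_add_left _ _) fun h => hat.1 ?_
      simpa using h.symm
    obtain ⟨F, hF, hs'⟩ := ih C hlt hC
    exact ⟨A ::ₘ F, by simpa using ⟨hat, hF⟩, by simp [hs']⟩

theorem Atom.map {f : G →+ H} (hf : Function.Injective f) {A : Multiset G} (h : Atom A) :
    Atom (A.map f) := by
  refine ⟨by simpa using h.1, by rw [← map_multiset_sum f A, h.2.1, _root_.map_zero], fun B hB h0 hs => ?_⟩
  obtain ⟨C, hC, rfl⟩ := le_map_iff.1 hB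
  rw [← map_multiset_sum f C] at hs
  rw [h.2.2 C hC (by simpa using h0) (hf (by simpa using hs))]

theorem Atom.card_pos {A : Multiset G} (h : Atom A) : 0 < card A := Multiset.card_pos.2 h.1

theorem map_equiv_sum (e : G ≃+ H) (F : Multiset (Multiset G)) :
    (F.map (Multiset.map e)).sum = F.sum.map e := by
  induction F using Multiset.induction with
  | empty => simp
  | cons a s ih => simp [ih]

theorem lengthSet_map_subset (e : G ≃+ H) (B : Multiset G) :
    LengthSet Set.univ B ⊆ LengthSet Set.univ (B.map e) := by
  intro k hk
  rw [mem_lengthSet] at *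
  obtain ⟨F, hk, hF, rfl⟩ := hk
  refine ⟨F.map (Multiset.map e), by simpa using hk, fun A hA => ?_, map_equiv_sum e F⟩
  obtain ⟨C, hC, rfl⟩ := Multiset.mem_map.1 hA
  exact (hF C hC).map (f := e.toAddMonoidHom) e.injective

theorem lengthSet_map (e : G ≃+ H) (B : Multiset G) :
    LengthSet Set.univ (B.map e) = LengthSet Set.univ B := by
  apply Set.Subset.antisymm _ (lengthSet_map_subset e B)
  have := lengthSet_map_subset e.symm (B.map e)
  simpa using this

theorem systemSets_subset (e : G ≃+ H) : SystemSets G ⊆ SystemSets H := by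
  rintro L ⟨B, hB, rfl⟩
  refine ⟨B.map e, ?_, (lengthSet_map e B).symm⟩
  have := map_multiset_sum e B
  rw [hB, _root_.map_zero] at this
  exact this.symm

theorem systemSets_congr (e : G ≃+ H) : SystemSets G = SystemSets H :=
  (systemSets_subset e).antisymm (systemSets_subset e.symm)

theorem Atom.eq_singleton_zero {A : Multiset G} (h : Atom A) (h0 : (0 : G) ∈ A) : A = {0} :=
  (h.2.2 {0} (by simpa using h0) (by simp) (by simp)).symm

theorem Atom.zero_notMem {A : Multiset G} (h : Atom A) (h1 : 1 < card A) : (0 : G) ∉ A := by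
  intro h0
  rw [h.eq_singleton_zero h0] at h1
  simp at h1

theorem Atom.neg {A : Multiset G} (h : Atom A) : Atom (A.map Neg.neg) :=
  h.map (f := (AddEquiv.neg G).toAddMonoidHom) (AddEquiv.neg G).injective

theorem atom_pair {g : G} (hg : g ≠ 0) : Atom ({g, -g} : Multiset G) := by
  refine ⟨by simp, by simp, fun B hB h0 hs => ?_⟩
  apply Multiset.eq_of_le_of_card_le hB
  by_contra hc
  have h1 : card B = 1 := by
    have := Multiset.card_pos.2 h0
    simp at hc; omega
  obtain ⟨x, rfl⟩ := Multiset.card_eq_one.1 h1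
  simp at hs
  subst hs
  simp at hB
  rcases hB with h | h
  · exact hg h.symm
  · exact hg (by simpa using h)

theorem Atom.eq_pair {A : Multiset G} (h : Atom A) {g : G} (hle : ({g, -g} : Multiset G) ≤ A) :
    A = {g, -g} :=
  (h.2.2 _ hle (by simp) (by simp)).symm

theorem Atom.no_pair {A : Multiset G} (h : Atom A) (h2 : 2 < card A) (g : G) :
    ¬ ({g, -g} : Multiset G) ≤ A := by
  intro hle
  rw [h.eq_pair hle] at h2
  simp at h2

/-- An atom with two distinct elements merged remains an atom. -/
theorem Atom.merge {A : Multiset G} {x y : G} (h : Atom (x ::ₘ y ::ₘ A)) : Atom ((x + y) ::ₘ A) := by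
  classical
  refine ⟨by simp, by simpa [add_assoc] using h.2.1, fun B hB h0 hs => ?_⟩
  by_cases hx : x + y ∈ B
  · obtain ⟨C, rfl⟩ := Multiset.exists_cons_of_mem hx
    have hC : C ≤ A := by simpa using hB
    have := h.2.2 (x ::ₘ y ::ₘ C) (by simpa using hC) (by simp) (by simpa [add_assoc] using hs)
    simp at this
    rw [this]
  · have hB' : B ≤ A := (Multiset.le_cons_of_notMem hx).1 hB
    have := h.2.2 B (hB'.trans ((Multiset.le_cons_self _ _).trans (Multiset.le_cons_self _ _))) h0 hs
    have h1 := congrArg card this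
    have h2 := Multiset.card_le_card hB'
    simp at h1; omega

theorem Atom.card_le [Fintype G] {A : Multiset G} (h : Atom A) :
    card A ≤ Fintype.card G * Fintype.card G := by
  classical
  have hcount : ∀ g ∈ A.toFinset, A.count g ≤ Fintype.card G := by
    intro g _
    by_contra hc
    push Not at hc
    have h1 : Multiset.replicate (addOrderOf g) g ≤ A := by
      rw [← Multiset.le_count_iff_replicate_le]
      exact (addOrderOf_le_card_univ).trans hc.le
    have h2 := h.2.2 _ h1 (by
      rw [Ne, ← Multiset.card_eq_zero, Multiset.card_replicate]
      exact (addOrderOf_pos g).ne') (by simp [addOrderOf_nsmul_eq_zero])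
    have h3 := congrArg (Multiset.count g) h2
    have h4 : addOrderOf g ≤ Fintype.card G := addOrderOf_le_card_univ
    simp at h3; omega
  calc card A = ∑ g ∈ A.toFinset, A.count g := (Multiset.toFinset_sum_count_eq A).symm
    _ ≤ ∑ g ∈ A.toFinset, Fintype.card G := Finset.sum_le_sum hcount
    _ ≤ Fintype.card G * Fintype.card G := by
      rw [Finset.sum_const, smul_eq_mul]
      exact Nat.mul_le_mul_right _ (Finset.card_le_univ _)

theorem Atom.card_le_davenportC [Fintype G] {A : Multiset G} (h : Atom A) :
    card A ≤ DavenportC G := by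
  rw [davenportC_eq]
  exact le_csSup ⟨_, by rintro k ⟨A, hA, rfl⟩; exact hA.card_le⟩ ⟨A, h, rfl⟩

theorem atom_zero : Atom ({0} : Multiset G) := by
  refine ⟨by simp, by simp, fun B hB h0 _ => ?_⟩
  apply Multiset.eq_of_le_of_card_le hB
  have := Multiset.card_pos.2 h0
  simp; omega

theorem exists_atom_card_eq_davenportC [Fintype G] : ∃ A : Multiset G, Atom A ∧ card A = DavenportC G := by
  have : DavenportC G ∈ {k | ∃ A : Multiset G, Atom A ∧ A.card = k} := by
    rw [davenportC_eq]
    exact Nat.sSup_mem ⟨1, {0}, atom_zero, by simp⟩ ⟨_, by rintro k ⟨A, hA, rfl⟩; exact hA.card_le⟩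
  exact this

end Basic
end SetsOfLengths

namespace SetsOfLengths
section Relations
variable {G : Type*} [AddCommGroup G]

/-- An atom of maximal length. -/
def MaxAtom (U : Multiset G) : Prop := Atom U ∧ ∀ A : Multiset G, Atom A → A.card ≤ U.card

/-- The set of lengths of `U (-U)`. -/
def symLen (U : Multiset G) : Set ℕ := LengthSet Set.univ (U + U.map Neg.neg)

theorem count_neg [DecidableEq G] (V : Multiset G) (g : G) : (V.map Neg.neg).count g = V.count (-g) := by
  have := Multiset.count_map_eq_count' (Neg.neg : G → G) V neg_injective (-g)
  rwa [neg_neg] at this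

theorem pair_le [DecidableEq G] {V : Multiset G} {g : G} (hne : -g ≠ g) (h1 : 0 < V.count g)
    (h2 : 0 < V.count (-g)) : ({g, -g} : Multiset G) ≤ V := by
  rw [Multiset.le_iff_count]
  intro a
  rw [Multiset.insert_eq_cons, Multiset.count_cons, Multiset.count_singleton]
  split_ifs with h3 h4 h4
  · exact absurd (h4.symm.trans h3).symm hne
  · subst h3; omega
  · subst h4; omega
  · omega

theorem double_le [DecidableEq G] {V : Multiset G} {g : G} (hne : -g = g) (h1 : 2 ≤ V.count g) :
    ({g, -g} : Multiset G) ≤ V := by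
  rw [hne]
  exact Multiset.le_count_iff_replicate_le.1 h1

theorem eq_neg_of_pairs {V W : Multiset G} (hV : Atom V) (hW : Atom W) (hcV : 2 < V.card)
    (hcW : 2 < W.card) (C : Multiset G) (h : V + W = C + C.map Neg.neg) : W = V.map Neg.neg := by
  classical
  have hcount : ∀ g, V.count g + W.count g = C.count g + C.count (-g) := by
    intro g
    rw [← Multiset.count_add, h, Multiset.count_add, count_neg]
  have hVp : ∀ g, -g ≠ g → 0 < V.count g → V.count (-g) = 0 := by
    intro g hg h1
    by_contra h2
    exact hV.no_pair hcV g (pair_le hg h1 (Nat.pos_of_ne_zero h2))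
  have hWp : ∀ g, -g ≠ g → 0 < W.count g → W.count (-g) = 0 := by
    intro g hg h1
    by_contra h2
    exact hW.no_pair hcW g (pair_le hg h1 (Nat.pos_of_ne_zero h2))
  ext g
  rw [count_neg]
  have e1 := hcount g
  have e2 := hcount (-g)
  rw [neg_neg] at e2
  by_cases hg : -g = g
  · rw [hg] at e1 e2 ⊢
    have a1 : ¬ 2 ≤ V.count g := fun h => hV.no_pair hcV g (double_le hg h)
    have a2 : ¬ 2 ≤ W.count g := fun h => hW.no_pair hcW g (double_le hg h)
    omega
  · have b1 := hVp g hg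
    have b2 := hWp g hg
    have hg' : - -g ≠ -g := by rw [neg_neg]; exact fun h => hg h.symm
    have b3 := hVp (-g) hg'
    have b4 := hWp (-g) hg'
    rw [neg_neg] at b3 b4
    omega

theorem atom_card_two {A : Multiset G} (h : Atom A) (h2 : A.card = 2) : ∃ g, A = {g, -g} := by
  obtain ⟨x, y, rfl⟩ := Multiset.card_eq_two.1 h2
  have := h.2.1
  simp at this
  exact ⟨x, by rw [eq_neg_of_add_eq_zero_right this]⟩

theorem pairs_of_card_two {F : Multiset (Multiset G)} (hF : ∀ A ∈ F, Atom A)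
    (h2 : ∀ A ∈ F, A.card = 2) : ∃ C : Multiset G, F.sum = C + C.map Neg.neg := by
  induction F using Multiset.induction with
  | empty => exact ⟨0, by simp⟩
  | cons A F ih =>
    obtain ⟨C, hC⟩ := ih (fun A hA => hF A (Multiset.mem_cons_of_mem hA))
      (fun A hA => h2 A (Multiset.mem_cons_of_mem hA))
    obtain ⟨g, rfl⟩ := atom_card_two (hF A (by simp)) (h2 A (by simp))
    refine ⟨g ::ₘ C, ?_⟩
    rw [Multiset.sum_cons, hC, Multiset.map_cons]
    simp only [Multiset.insert_eq_cons, ← Multiset.singleton_add]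
    abel

theorem two_of_sum_le {α : Type*} {F : Multiset (Multiset α)} (h2 : ∀ A ∈ F, 2 ≤ A.card)
    (hs : F.sum.card ≤ 2 * F.card) : ∀ A ∈ F, A.card = 2 := by
  have key : 2 * F.card ≤ F.sum.card := by
    clear hs
    induction F using Multiset.induction with
    | empty => simp
    | cons A F ih =>
      have := ih (fun A hA => h2 A (Multiset.mem_cons_of_mem hA))
      have := h2 A (by simp)
      simp; omega
  intro A hA
  obtain ⟨F', rfl⟩ := Multiset.exists_cons_of_mem hA
  have key' : 2 * F'.card ≤ F'.sum.card := by
    have h2' : ∀ A ∈ F', 2 ≤ A.card := fun A hA => h2 A (Multiset.mem_cons_of_mem hA)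
    clear hs key h2 hA
    induction F' using Multiset.induction with
    | empty => simp
    | cons A F ih =>
      have := ih (fun A hA => h2' A (Multiset.mem_cons_of_mem hA))
      have := h2' A (by simp)
      simp; omega
  have := h2 A hA
  simp at hs; omega

theorem mem_sum_iff {α : Type*} {F : Multiset (Multiset α)} {a : α} : a ∈ F.sum ↔ ∃ A ∈ F, a ∈ A := by
  induction F using Multiset.induction with
  | empty => simp
  | cons A F ih => simp [ih]

theorem card_eq_one_of_sum_atom {F : Multiset (Multiset G)} (hF : ∀ A ∈ F, Atom A)
    (h : Atom F.sum) : F.card = 1 := by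
  have h0 : F ≠ 0 := by rintro rfl; exact h.1 (by simp)
  obtain ⟨A, hA⟩ := Multiset.exists_mem_of_ne_zero h0
  obtain ⟨F', rfl⟩ := Multiset.exists_cons_of_mem hA
  have := h.2.2 A (by simp) (hF A hA).1 (hF A hA).2.1
  simp at this
  by_contra hc
  have h0' : F' ≠ 0 := by rintro rfl; simp at hc
  obtain ⟨B, hB⟩ := Multiset.exists_mem_of_ne_zero h0'
  have hle : B ≤ F'.sum := by
    obtain ⟨E, rfl⟩ := Multiset.exists_cons_of_mem hB
    simp
  rw [this] at hle
  exact (hF B (by simp [hB])).1 (Multiset.le_zero.1 hle)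

theorem Atom.two_le_card {A : Multiset G} (h : Atom A) (h0 : (0 : G) ∉ A) : 2 ≤ A.card := by
  by_contra hc
  have h1 : A.card = 1 := by have := h.card_pos; omega
  obtain ⟨x, rfl⟩ := Multiset.card_eq_one.1 h1
  have := h.2.1
  simp at this
  simp [this] at h0

theorem exists_maxAtom_of_two_mem {n : ℕ} (hn : 3 ≤ n) (hmax : ∀ A : Multiset G, Atom A → A.card ≤ n)
    {L : Set ℕ} (hL : L ∈ SystemSets G) (h2 : 2 ∈ L) (hnL : n ∈ L) :
    ∃ U : Multiset G, MaxAtom U ∧ U.card = n ∧ L = symLen U := by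
  obtain ⟨B, hB, rfl⟩ := hL
  obtain ⟨F2, hF2, hat2, hs2⟩ := mem_lengthSet.1 h2
  obtain ⟨V, W, rfl⟩ := Multiset.card_eq_two.1 hF2
  have hV : Atom V := hat2 V (by simp)
  have hW : Atom W := hat2 W (by simp)
  simp at hs2
  obtain ⟨F, hF, hat, hs⟩ := mem_lengthSet.1 hnL
  have h0 : (0 : G) ∉ B := by
    intro h0
    have key : ∀ X : Multiset G, Atom X → B = {0} + X → False := by
      intro X hX hBX
      rw [← hs] at h0
      obtain ⟨A, hA, h0A⟩ := mem_sum_iff.1 h0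
      have := (hat A hA).eq_singleton_zero h0A
      subst this
      obtain ⟨F', rfl⟩ := Multiset.exists_cons_of_mem hA
      rw [Multiset.sum_cons, hBX] at hs
      have hs' : F'.sum = X := add_left_cancel hs
      have := card_eq_one_of_sum_atom (F := F') (fun A hA => hat A (Multiset.mem_cons_of_mem hA)) (hs' ▸ hX)
      simp at hF; omega
    rw [← hs2] at h0
    rcases Multiset.mem_add.1 h0 with h | h
    · exact key W hW (by rw [← hs2, hV.eq_singleton_zero h])
    · exact key V hV (by rw [← hs2, hW.eq_singleton_zero h, add_comm])
  have hge : ∀ A ∈ F, 2 ≤ A.card := fun A hA => (hat A hA).two_le_card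
    (fun h => h0 (hs ▸ mem_sum_iff.2 ⟨A, hA, h⟩))
  have hcB : B.card = V.card + W.card := by rw [← hs2]; simp
  have hcV := hmax V hV
  have hcW := hmax W hW
  have hall := two_of_sum_le hge (by rw [hs, hF]; omega)
  obtain ⟨C, hC⟩ := pairs_of_card_two hat hall
  have hBc : B.card = 2 * n := by
    rw [← hs, card_sum', Multiset.map_congr rfl hall]
    simp [hF, mul_comm]
  have hneg := eq_neg_of_pairs hV hW (by omega) (by omega) C (by rw [hs2, ← hC, hs])
  refine ⟨V, ⟨hV, fun A hA => (hmax A hA).trans (by omega)⟩, by omega, ?_⟩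
  rw [symLen, ← hneg, hs2]

theorem pairs_mem (R : Multiset G) (hR : (0 : G) ∉ R) :
    ∃ F : Multiset (Multiset G), F.card = R.card ∧ (∀ A ∈ F, Atom A) ∧ F.sum = R + R.map Neg.neg := by
  refine ⟨R.map fun g => {g, -g}, by simp, fun A hA => ?_, ?_⟩
  · obtain ⟨g, hg, rfl⟩ := Multiset.mem_map.1 hA
    exact atom_pair (fun h => hR (h ▸ hg))
  · clear hR
    induction R using Multiset.induction with
    | empty => simp
    | cons g R ih =>
      rw [Multiset.map_cons, Multiset.sum_cons, ih, Multiset.map_cons]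
      simp only [Multiset.insert_eq_cons, ← Multiset.singleton_add]
      abel

theorem two_mem_symLen {U : Multiset G} (h : Atom U) : 2 ∈ symLen U :=
  mem_lengthSet.2 ⟨{U, U.map Neg.neg}, by simp, by
    intro A hA
    simp at hA
    rcases hA with rfl | rfl
    · exact h
    · exact h.neg, by simp⟩

theorem card_mem_symLen {U : Multiset G} (h0 : (0 : G) ∉ U) : U.card ∈ symLen U :=
  mem_lengthSet.2 (pairs_mem U h0)

theorem sum_map_neg (A : Multiset G) : (A.map Neg.neg).sum = -A.sum := by
  rw [Multiset.sum_map_neg']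

theorem map_neg_sum (F : Multiset (Multiset G)) :
    (F.map (Multiset.map Neg.neg)).sum = F.sum.map Neg.neg :=
  map_equiv_sum (AddEquiv.neg G) F

theorem map_neg_neg (A : Multiset G) : (A.map Neg.neg).map Neg.neg = A := by
  rw [Multiset.map_map]; simp

theorem relation_mem_symLen {A B R : Multiset G} (h0 : (0 : G) ∉ R) {F : Multiset (Multiset G)}
    (hF : ∀ W ∈ F, Atom W) (hs : F.sum = A + B.map Neg.neg) :
    2 * F.card + R.card ∈ symLen (A + B + R) := by
  obtain ⟨P, hP, hPat, hPs⟩ := pairs_mem R h0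
  refine mem_lengthSet.2 ⟨F + F.map (Multiset.map Neg.neg) + P, by simp [hP]; ring, fun W hW => ?_, ?_⟩
  · rw [Multiset.mem_add, Multiset.mem_add] at hW
    rcases hW with (h | h) | h
    · exact hF W h
    · obtain ⟨X, hX, rfl⟩ := Multiset.mem_map.1 h
      exact (hF X hX).neg
    · exact hPat W h
  · rw [Multiset.sum_add, Multiset.sum_add, map_neg_sum, hs, hPs, Multiset.map_add, map_neg_neg,
      Multiset.map_add, Multiset.map_add]
    abel

theorem relation_atom_mem {U A B R : Multiset G} (hU : U = A + B + R) (h0 : (0 : G) ∉ U)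
    (hW : Atom (A + B.map Neg.neg)) : R.card + 2 ∈ symLen U := by
  subst hU
  have := relation_mem_symLen (A := A) (B := B) (R := R) (fun h => h0 (by simp [h]))
    (F := {A + B.map Neg.neg}) (by simpa using hW) (by simp)
  simpa [add_comm] using this

theorem Atom.eq_zero_of_lt {U A : Multiset G} (hU : Atom U) (h : A < U) (hs : A.sum = 0) : A = 0 := by
  by_contra h0
  exact h.ne (hU.2.2 A h.le h0 hs)

theorem lt_of_cons_le {α : Type*} {U A : Multiset α} {g : α} (h : g ::ₘ A ≤ U) : A < U :=
  lt_of_lt_of_le (Multiset.lt_cons_self A g) h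

theorem atom_single_relation {U B : Multiset G} {g : G} (hU : Atom U) (h : g ::ₘ B ≤ U)
    (hs : g = B.sum) : Atom (({g} : Multiset G) + B.map Neg.neg) := by
  have hfree : ∀ C ≤ B, C.sum = 0 → C = 0 := fun C hC hCs =>
    hU.eq_zero_of_lt (lt_of_le_of_lt hC (lt_of_cons_le h)) hCs
  refine ⟨by simp, by rw [Multiset.sum_add, sum_map_neg, ← hs]; simp, fun X hX h0 hXs => ?_⟩
  rw [Multiset.singleton_add] at hX ⊢
  by_cases hg : g ∈ X
  · obtain ⟨Y, rfl⟩ := Multiset.exists_cons_of_mem hg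
    have hY : Y ≤ B.map Neg.neg := by simpa using hX
    obtain ⟨C, hC, rfl⟩ := le_map_iff.1 hY
    obtain ⟨E, rfl⟩ := Multiset.le_iff_exists_add.1 hC
    rw [Multiset.sum_cons, sum_map_neg, hs, Multiset.sum_add] at hXs
    have : E = 0 := hfree E (by simp) (by simpa using hXs)
    subst this
    simp
  · have hX' : X ≤ B.map Neg.neg := (Multiset.le_cons_of_notMem hg).1 hX
    obtain ⟨C, hC, rfl⟩ := le_map_iff.1 hX'
    rw [sum_map_neg, neg_eq_zero] at hXs
    exact absurd (by rw [hfree C hC hXs]; simp) h0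

theorem MaxAtom.exists_subsum {S : Multiset G} {g : G} (hU : MaxAtom (g ::ₘ S)) (h : G) :
    ∃ T ≤ S, T.sum = h := by
  classical
  have hfree : ∀ C ≤ S, C.sum = 0 → C = 0 := fun C hC hCs =>
    hU.1.eq_zero_of_lt (lt_of_le_of_lt hC (Multiset.lt_cons_self S g)) hCs
  by_contra hc
  push Not at hc
  have hfree' : ∀ C ≤ (-h) ::ₘ S, C.sum = 0 → C = 0 := by
    intro C hC hCs
    by_cases hm : -h ∈ C
    · obtain ⟨E, rfl⟩ := Multiset.exists_cons_of_mem hm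
      exact absurd (by simp at hCs; exact (neg_add_eq_zero.1 hCs).symm) (hc E (by simpa using hC))
    · exact hfree C ((Multiset.le_cons_of_notMem hm).1 hC) hCs
  set T := (-h) ::ₘ S with hT
  have hat : Atom ((-T.sum) ::ₘ T) := by
    refine ⟨by simp, by simp, fun X hX h0 hXs => ?_⟩
    by_cases hm : -T.sum ∈ X
    · obtain ⟨Y, rfl⟩ := Multiset.exists_cons_of_mem hm
      have hY : Y ≤ T := by simpa using hX
      obtain ⟨E, hE⟩ := Multiset.le_iff_exists_add.1 hY
      have hEs : E.sum = 0 := by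
        have : T.sum = Y.sum + E.sum := by rw [hE, Multiset.sum_add]
        simp only [Multiset.sum_cons] at hXs
        rw [this] at hXs
        simpa using hXs
      have : E = 0 := hfree' E (by rw [hE]; exact Multiset.le_add_left _ _) hEs
      rw [this, add_zero] at hE
      rw [← hE]
    · exact absurd (hfree' X ((Multiset.le_cons_of_notMem hm).1 hX) hXs) h0
  have := hU.2 _ hat
  simp [hT] at this

theorem MaxAtom.closure_eq_top {U : Multiset G} (hU : MaxAtom U) :
    AddSubgroup.closure {g | g ∈ U} = ⊤ := by
  obtain ⟨g, hg⟩ := Multiset.exists_mem_of_ne_zero hU.1.1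
  obtain ⟨S, rfl⟩ := Multiset.exists_cons_of_mem hg
  rw [eq_top_iff]
  intro h _
  obtain ⟨T, hT, rfl⟩ := hU.exists_subsum h
  exact AddSubgroup.multiset_sum_mem _ _ fun a ha =>
    AddSubgroup.subset_closure (Multiset.mem_cons_of_mem (Multiset.mem_of_le hT ha))

/-- A relation `g = g₂ + σ(T)` inside a maximal atom. -/
theorem MaxAtom.exists_relation [DecidableEq G] {U : Multiset G} (hU : MaxAtom U) (h3 : 2 < U.card) {g g₂ : G}
    (hg : g ∈ U) (hg₂ : g₂ ∈ U) (hne : g₂ ≠ g) :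
    ∃ T R : Multiset G, U = Multiset.replicate (U.count g) g + (g₂ ::ₘ T) + R ∧ g ∉ R ∧ g ∉ T ∧ T ≠ 0 ∧
      g = g₂ + T.sum ∧ (U.count g + 1) • g + R.sum = 0 ∧ U.count g + 1 + R.card ∈ symLen U ∧
      U.count g + 1 + R.card < U.card := by
  obtain ⟨S, hS⟩ := Multiset.exists_cons_of_mem hg₂
  have hU' := hU
  rw [hS] at hU'
  obtain ⟨T, hT, hTs⟩ := hU'.exists_subsum (g - g₂)
  have hle : g₂ ::ₘ T ≤ U := by rw [hS]; simpa using hT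
  have hgT : g ∉ T := by
    intro hm
    obtain ⟨T', rfl⟩ := Multiset.exists_cons_of_mem hm
    have h1 : g ::ₘ (g₂ ::ₘ T') ≤ U := by rwa [Multiset.cons_swap]
    have := hU.1.eq_zero_of_lt (lt_of_cons_le h1) (by
      simp only [Multiset.sum_cons] at hTs ⊢
      have : g + (g₂ + T'.sum) = g := by rw [add_left_comm, hTs]; abel
      simpa using this)
    simp at this
  have hT0 : T ≠ 0 := by
    rintro rfl
    simp at hTs
    exact hne (sub_eq_zero.1 hTs.symm).symm
  have hnot : g ∉ g₂ ::ₘ T := by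
    simp [hgT, hne.symm]
  obtain ⟨E, hE⟩ := Multiset.le_iff_exists_add.1 hle
  have hcE : E.count g = U.count g := by
    rw [hE, Multiset.count_add, Multiset.count_eq_zero.2 hnot, zero_add]
  obtain ⟨R, hR⟩ := Multiset.le_iff_exists_add.1 (Multiset.le_count_iff_replicate_le.1 hcE.ge)
  have hgR : g ∉ R := by
    rw [← Multiset.count_eq_zero]
    have := congrArg (Multiset.count g) hR
    rw [Multiset.count_add, Multiset.count_replicate_self] at this
    omega
  have hsum : g = g₂ + T.sum := by rw [hTs]; abel
  have hdec : U = Multiset.replicate (U.count g) g + (g₂ ::ₘ T) + R := by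
    conv_lhs => rw [hE, hR]
    abel
  have hpos : 0 < U.count g := Multiset.count_pos.2 hg
  have hmem : U.count g + 1 + R.card ∈ symLen U := by
    have := relation_atom_mem (U := U) (A := {g}) (B := g₂ ::ₘ T)
      (R := Multiset.replicate (U.count g - 1) g + R) (by
        conv_lhs => rw [hdec]
        obtain ⟨m, hm⟩ := Nat.exists_eq_add_of_lt hpos
        rw [hm]
        simp only [zero_add, Nat.add_sub_cancel, Multiset.replicate_succ, ← Multiset.singleton_add]
        abel) (hU.1.zero_notMem (by omega))
      (atom_single_relation hU.1 (by
        have h1 : ({g} : Multiset G) ≤ E := by simpa using Multiset.count_pos.1 (by omega : 0 < E.count g)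
        rw [hE, ← Multiset.singleton_add, add_comm]
        gcongr) (by simpa using hsum))
    convert this using 1
    simp; omega
  refine ⟨T, R, hdec, hgR, hgT, hT0, hsum, ?_, hmem, ?_⟩
  · have h1 : U.sum = 0 := hU.1.2.1
    rw [hdec] at h1
    simp only [Multiset.sum_add, Multiset.sum_replicate, Multiset.sum_cons, ← hsum] at h1
    rw [succ_nsmul, ← h1]
  · have h1 := congrArg Multiset.card hdec
    have h2 := Multiset.card_pos.2 hT0
    simp at h1; omega

end Relations
end SetsOfLengths

namespace SetsOfLengths

/-- The group `⨁ ℤ/mᵢ` for a list of moduli. -/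
def GT : List ℕ → Type
  | [] => PUnit
  | m :: ms => ZMod m × GT ms

instance GT.instAddCommGroup : (l : List ℕ) → AddCommGroup (GT l)
  | [] => inferInstanceAs (AddCommGroup PUnit)
  | m :: ms =>
    letI := GT.instAddCommGroup ms
    inferInstanceAs (AddCommGroup (ZMod m × GT ms))

instance GT.instDecidableEq : (l : List ℕ) → DecidableEq (GT l)
  | [] => inferInstanceAs (DecidableEq PUnit)
  | m :: ms =>
    letI := GT.instDecidableEq ms
    inferInstanceAs (DecidableEq (ZMod m × GT ms))

/-- Mixed radix code of an element. -/
def enc : (l : List ℕ) → GT l → ℕ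
  | [], _ => 0
  | m :: ms, x => x.1.val + m * enc ms x.2

/-- Addition of codes. -/
def codeAdd : List ℕ → ℕ → ℕ → ℕ
  | [], x, _ => x
  | m :: ms, x, y => (x % m + y % m) % m + m * codeAdd ms (x / m) (y / m)

/-- Negation of codes. -/
def codeNeg : List ℕ → ℕ → ℕ
  | [], _ => 0
  | m :: ms, x => (m - x % m) % m + m * codeNeg ms (x / m)

/-- All moduli are positive. -/
def PosMod (l : List ℕ) : Prop := ∀ m ∈ l, 0 < m

instance (l : List ℕ) : Decidable (PosMod l) := inferInstanceAs (Decidable (∀ m ∈ l, 0 < m))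

theorem PosMod.tail {m : ℕ} {l : List ℕ} (h : PosMod (m :: l)) : PosMod l :=
  fun a ha => h a (List.mem_cons_of_mem _ ha)

theorem enc_div {m : ℕ} {l : List ℕ} (hm : 0 < m) (x : GT (m :: l)) : enc (m :: l) x / m = enc l x.2 := by
  have : NeZero m := ⟨hm.ne'⟩
  rw [enc, Nat.add_mul_div_left _ _ hm, Nat.div_eq_of_lt (ZMod.val_lt _), zero_add]

theorem enc_mod {m : ℕ} {l : List ℕ} (hm : 0 < m) (x : GT (m :: l)) : enc (m :: l) x % m = x.1.val := by
  have : NeZero m := ⟨hm.ne'⟩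
  rw [enc, Nat.add_mul_mod_self_left, Nat.mod_eq_of_lt (ZMod.val_lt _)]

theorem enc_injective : ∀ {l : List ℕ}, PosMod l → Function.Injective (enc l)
  | [], _ => fun _ _ _ => rfl
  | m :: ms, h => by
    have hm := h m (by simp)
    have : NeZero m := ⟨hm.ne'⟩
    intro x y hxy
    have h1 := enc_div hm x
    have h2 := enc_mod hm x
    rw [hxy, enc_div hm] at h1
    rw [hxy, enc_mod hm] at h2
    exact Prod.ext (ZMod.val_injective m h2.symm) (enc_injective h.tail h1.symm)

theorem enc_lt : ∀ {l : List ℕ}, PosMod l → ∀ x : GT l, enc l x < l.foldr (· * ·) 1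
  | [], _, _ => by simp [enc]
  | m :: ms, h, x => by
    have hm := h m (by simp)
    have : NeZero m := ⟨hm.ne'⟩
    have h1 := enc_lt h.tail x.2
    have h2 := ZMod.val_lt x.1
    simp only [enc, List.foldr_cons]
    nlinarith [Nat.mul_le_mul_left m (Nat.succ_le_of_lt h1)]

theorem enc_zero : ∀ l : List ℕ, enc l 0 = 0
  | [] => rfl
  | m :: ms => by
    have h := enc_zero ms
    have h1 : (0 : GT (m :: ms)).1 = 0 := rfl
    have h2 : (0 : GT (m :: ms)).2 = 0 := rfl
    rw [enc, h1, h2, h, ZMod.val_zero, mul_zero]; rfl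

theorem codeAdd_enc : ∀ {l : List ℕ}, PosMod l → ∀ x y : GT l, codeAdd l (enc l x) (enc l y) = enc l (x + y)
  | [], _, _, _ => rfl
  | m :: ms, h, x, y => by
    have hm := h m (by simp)
    have : NeZero m := ⟨hm.ne'⟩
    have h1 : (x + y).1 = x.1 + y.1 := rfl
    have h2 : (x + y).2 = x.2 + y.2 := rfl
    rw [codeAdd, enc_mod hm, enc_mod hm, enc_div hm, enc_div hm, codeAdd_enc h.tail, ← ZMod.val_add,
        ← h1, ← h2]
    rfl

theorem codeNeg_enc : ∀ {l : List ℕ}, PosMod l → ∀ x : GT l, codeNeg l (enc l x) = enc l (-x)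
  | [], _, _ => rfl
  | m :: ms, h, x => by
    have hm := h m (by simp)
    have : NeZero m := ⟨hm.ne'⟩
    have h1 : (-x).1 = -x.1 := rfl
    have h2 : (-x).2 = -x.2 := rfl
    rw [codeNeg, enc_mod hm, enc_div hm, codeNeg_enc h.tail, ← ZMod.neg_val', ← h1, ← h2]
    rfl

/-- Call-by-value application of a continuation to a number. -/
def force {α : Type} (x : ℕ) (k : ℕ → α) : α :=
  Nat.casesOn (motive := fun _ => α) (Nat.add x 1) (k 0) (fun n => k n)

theorem force_eq {α : Type} (x : ℕ) (k : ℕ → α) : force x k = k x := rfl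

/-- Bit mask with bits `i < p * K`, `i % p < t`. -/
def rep (t p K : ℕ) : ℕ := (2 ^ t - 1) * ((2 ^ (p * K) - 1) / (2 ^ p - 1))

theorem rep_succ {t p : ℕ} (hp : 0 < p) (K : ℕ) : rep t p (K + 1) = 2 ^ p * rep t p K + (2 ^ t - 1) := by
  have h1 : 0 < 2 ^ p - 1 := by have := Nat.one_lt_two_pow hp.ne'; omega
  have h2 : (2 ^ (p * (K + 1)) - 1) = (2 ^ p - 1) + 2 ^ p * (2 ^ (p * K) - 1) := by
    have a1 : 1 ≤ 2 ^ p := Nat.one_le_two_pow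
    have a2 : 1 ≤ 2 ^ (p * K) := Nat.one_le_two_pow
    have a3 : 2 ^ (p * (K + 1)) = 2 ^ p * 2 ^ (p * K) := by rw [← pow_add]; ring_nf
    rw [a3, Nat.mul_sub]
    have := Nat.mul_le_mul_left (2 ^ p) a2
    omega
  have h3 : (2 ^ p - 1) ∣ (2 ^ (p * K) - 1) := by
    have := Nat.sub_one_dvd_pow_sub_one (2 ^ p) K
    rwa [← pow_mul] at this
  obtain ⟨c, hc⟩ := h3
  rw [rep, rep, h2, hc, Nat.mul_div_cancel_left _ h1]
  have : (2 ^ p - 1 + 2 ^ p * ((2 ^ p - 1) * c)) = (2 ^ p - 1) * (1 + 2 ^ p * c) := by ring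
  rw [this, Nat.mul_div_cancel_left _ h1]
  ring

theorem testBit_rep {t p : ℕ} (hp : 0 < p) (htp : t ≤ p) :
    ∀ (K : ℕ) {i : ℕ}, (rep t p K).testBit i = true → i % p < t := by
  intro K
  induction K with
  | zero => intro i h; simp [rep] at h
  | succ K ih =>
    intro i h
    rw [rep_succ hp, Nat.testBit_two_pow_mul_add] at h
    · split_ifs at h with hi
      · rw [Nat.testBit_two_pow_sub_one] at h
        rw [Nat.mod_eq_of_lt hi]
        simpa using h
      · have := ih h
        rwa [← Nat.mod_eq_sub_mod (by omega)] at this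
    · have := Nat.pow_le_pow_right (n := 2) (by norm_num) htp
      have : 0 < 2 ^ t := by positivity
      omega

/-- Continuation passing construction of the translation of a bit set by a code. -/
def buildTr (α : Type) (W : ℕ) : List ℕ → ℕ → ℕ → ((ℕ → ℕ) → α) → α
  | [], _, _, k => k (fun P => P)
  | m :: ms, s, g, k => buildTr α W ms (s * m) (g / m) fun f =>
    cond (Nat.beq (g % m) 0) (k f) (
      force (rep (s * (m - g % m)) (s * m) (W / (s * m))) fun M1 =>
      force (rep (s * (g % m)) (s * m) (W / (s * m))) fun M2 =>
      force (s * (g % m)) fun a => force (s * (m - g % m)) fun b =>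
      k (fun P => force (Nat.lor (Nat.shiftLeft (Nat.land P M1) a) (Nat.land (Nat.shiftRight P b) M2)) f))

/-- `f` maps bit sets to bit sets, all of whose bits come from adding `g` to the digit part. -/
def IsTr (l : List ℕ) (s g : ℕ) (f : ℕ → ℕ) : Prop :=
  ∀ P j, (f P).testBit j = true → ∃ i, P.testBit i = true ∧ j % s = i % s ∧ j / s = codeAdd l (i / s) g

theorem buildTr_eq (α : Type) (W : ℕ) : ∀ (l : List ℕ) (_ : PosMod l) (s g : ℕ) (_ : 0 < s),
    ∃ f, IsTr l s g f ∧ ∀ k : (ℕ → ℕ) → α, buildTr α W l s g k = k f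
  | [], _, s, g, _ => ⟨fun P => P, fun P j h => ⟨j, h, rfl, rfl⟩, fun k => rfl⟩
  | m :: ms, h, s, g, hs => by
    have hm := h m (by simp)
    obtain ⟨f, hf, hk⟩ := buildTr_eq α W ms h.tail (s * m) (g / m) (by positivity)
    by_cases hg : g % m = 0
    · refine ⟨f, fun P j hj => ?_, fun k => by rw [buildTr, hk, hg]; rfl⟩
      obtain ⟨i, hi, h1, h2⟩ := hf P j hj
      refine ⟨i, hi, ?_, ?_⟩
      · rw [← Nat.mod_mul_right_mod j s m, h1, Nat.mod_mul_right_mod]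
      · rw [codeAdd, hg, Nat.div_div_eq_div_mul, ← h2, ← Nat.div_div_eq_div_mul, add_zero, Nat.mod_mod]
        rw [← Nat.mod_mul_right_div_self, ← h1, Nat.mod_mul_right_div_self, Nat.mod_add_div]
    · have hb : Nat.beq (g % m) 0 = false := by
        rw [Bool.eq_false_iff]; exact fun h => hg (Nat.eq_of_beq_eq_true h)
      refine ⟨_, ?_, fun k => by rw [buildTr, hk, hb, cond_false, force_eq, force_eq, force_eq, force_eq]⟩
      intro P j hj
      beta_reduce at hj
      rw [force_eq] at hj
      obtain ⟨i, hi, h1, h2⟩ := hf _ j hj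
      have hv : g % m < m := Nat.mod_lt _ hm
      set v := g % m with hvdef
      have hpos : 0 < s * m := by positivity
      have hsv : s * v + s * (m - v) = s * m := by rw [← Nat.mul_add]; congr 1; omega
      -- the source index
      suffices ∃ i', P.testBit i' = true ∧ i' / (s * m) = i / (s * m) ∧ i % s = i' % s ∧
          (i / s) % m = ((i' / s) % m + v) % m by
        obtain ⟨i', e1, e2, e3, e4⟩ := this
        refine ⟨i', e1, ?_, ?_⟩
        · rw [← e3, ← Nat.mod_mul_right_mod j s m, h1, Nat.mod_mul_right_mod]
        · rw [codeAdd, Nat.div_div_eq_div_mul, e2, ← h2, ← hvdef, ← e4, ← Nat.div_div_eq_div_mul]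
          rw [← Nat.mod_mul_right_div_self i, ← h1, Nat.mod_mul_right_div_self, Nat.mod_add_div]
      have key : ∀ a b q lo : ℕ, lo < s → a < m → (s * m * q + (s * a + lo)) % s = lo ∧
          (s * m * q + (s * a + lo)) / (s * m) = q ∧ (s * m * q + (s * a + lo)) / s % m = a := by
        intro a b q lo hlo ha
        have h0 : s * a + lo < s * m := by nlinarith
        refine ⟨?_, ?_, ?_⟩
        · rw [mul_assoc, Nat.mul_add_mod, Nat.mul_add_mod, Nat.mod_eq_of_lt hlo]
        · rw [Nat.mul_add_div hpos, Nat.div_eq_of_lt h0, add_zero]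
        · rw [← add_assoc, mul_assoc, ← Nat.mul_add, Nat.mul_add_div hs, Nat.div_eq_of_lt hlo, add_zero,
            Nat.mul_add_mod, Nat.mod_eq_of_lt ha]
      have dec : ∀ x : ℕ, x = s * m * (x / (s * m)) + (s * (x / s % m) + x % s) := by
        intro x
        have e1 := Nat.div_add_mod x (s * m)
        have e2 := Nat.mod_mul (a := s) (b := m) (x := x)
        omega
      have hlo : ∀ x, x % s < s := fun x => Nat.mod_lt _ hs
      change (((P &&& _) <<< (s * v)) ||| ((P >>> (s * (m - v))) &&& _)).testBit i = true at hi
      rw [Nat.testBit_or, Bool.or_eq_true, Nat.testBit_shiftLeft, Nat.testBit_and, Nat.testBit_and,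
        Nat.testBit_shiftRight, Bool.and_eq_true, Bool.and_eq_true, Bool.and_eq_true, decide_eq_true_eq] at hi
      rcases hi with ⟨g1, g2, g3⟩ | ⟨g2, g3⟩
      · refine ⟨i - s * v, g2, ?_⟩
        have g4 := testBit_rep hpos (by omega) _ g3
        set x := i - s * v with hx
        have hix : i = x + s * v := by omega
        have hd := dec x
        have hc : x / s % m + v < m := by
          rw [Nat.mod_mul] at g4
          by_contra hcon
          have : m - v ≤ x / s % m := by omega
          have := Nat.mul_le_mul_left s this
          omega
        have hi' : i = s * m * (x / (s * m)) + (s * (x / s % m + v) + x % s) := by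
          rw [hix]; conv_lhs => rw [hd]
          ring
        obtain ⟨k1, k2, k3⟩ := key _ 0 (x / (s * m)) _ (hlo x) hc
        rw [← hi'] at k1 k2 k3
        exact ⟨k2.symm, k1, by rw [k3, Nat.mod_eq_of_lt hc]⟩
      · rw [add_comm] at g2
        refine ⟨i + s * (m - v), g2, ?_⟩
        have g4 := testBit_rep hpos (by omega) _ g3
        have hd := dec i
        have hc : i / s % m < v := by
          rw [Nat.mod_mul] at g4
          by_contra hcon
          have := Nat.mul_le_mul_left s (not_lt.1 hcon)
          omega
        have hi' : i + s * (m - v) = s * m * (i / (s * m)) + (s * (i / s % m + (m - v)) + i % s) := by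
          conv_lhs => rw [hd]
          ring
        obtain ⟨k1, k2, k3⟩ := key (i / s % m + (m - v)) 0 (i / (s * m)) _ (hlo i) (by omega)
        rw [← hi'] at k1 k2 k3
        refine ⟨k2, k1.symm, ?_⟩
        rw [k3, show i / s % m + (m - v) + v = i / s % m + m by omega, Nat.add_mod_right, Nat.mod_mod]

end SetsOfLengths

namespace SetsOfLengths

/-- Preprocessed data of an element used by the search. -/
structure Elt where
  g : ℕ
  neg : ℕ
  bn : ℕ
  fp : ℕ → ℕ
  fm : ℕ → ℕ
  fs : ℕ → ℕ
  lo : Bool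
  mn : ℕ

/-- Preprocess a list of entries `(code, mandatory, minimal length so far)`. -/
def buildElts (α : Type) (l : List ℕ) (R W : ℕ) : List (ℕ × Bool × ℕ) → (List Elt → α) → α
  | [], k => k []
  | e :: es, k => buildElts α l R W es fun t => force (codeNeg l e.1) fun n =>
     buildTr α W l R e.1 fun fp => buildTr α W l R n fun fm => buildTr α (W / R) l 1 e.1 fun fs =>
     force (2 ^ n) fun b => k (⟨e.1, n, b, fp, fm, fs, e.2.1, e.2.2⟩ :: t)

/-- Add further copies of the element `g`. -/
def loop (l : List ℕ) (D F : ℕ) (c : Elt) (k : ℕ → ℕ → ℕ → ℕ → Bool) (fuel : ℕ) :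
    ℕ → ℕ → ℕ → ℕ → ℕ → ℕ → Bool :=
  Nat.rec (motive := fun _ => ℕ → ℕ → ℕ → ℕ → ℕ → ℕ → Bool) (fun _ _ _ _ _ _ => true)
   (fun _ ih len s S P Tp Tm =>
    cond (cond (Nat.beq s c.neg) (Nat.beq (Nat.succ len) D)
        (cond (Nat.blt (Nat.succ len) D) (Nat.beq (Nat.land S c.bn) 0) false))
    (force (Nat.shiftLeft (c.fp Tp) 1) fun Tp' => force (Nat.shiftLeft (c.fm Tm) 1) fun Tm' =>
     force (Nat.lor P (Nat.lor Tp' Tm')) fun P' =>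
     cond (Nat.beq (Nat.land P' F) 0) (cond (Nat.ble D (Nat.succ len)) false (
      force (Nat.lor S (c.fs S)) fun S' => force (codeAdd l s c.g) fun s' => force (Nat.succ len) fun len' =>
      cond (k len' s' S' P') (ih len' s' S' P' Tp' Tm') false)) true) true) fuel

/-- Exhaustive search for minimal zero-sum sequences of length `D` without forbidden relations. -/
noncomputable def search (l : List ℕ) (D F : ℕ) (es : List Elt) : ℕ → ℕ → ℕ → ℕ → Bool :=
  List.rec (motive := fun _ => ℕ → ℕ → ℕ → ℕ → Bool) (fun _ _ _ _ => true) (fun c _ ih len s S P =>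
     cond (Nat.ble c.mn len) (cond (cond c.lo true (ih len s S P))
      (loop l D F c ih (Nat.sub D len) len s S P P P) false) true) es

/-- Bit mask of the forbidden weights. -/
def maskOf (fb : List ℕ) : ℕ := fb.foldr (fun w a => Nat.lor (2 ^ w) a) 0

/-- The complete search. -/
noncomputable def run (l : List ℕ) (D p₀ : ℕ) (fb : List ℕ) (es : List (ℕ × Bool × ℕ)) : Bool :=
  force (maskOf fb) fun F => force (l.foldr (· * ·) 1 * (D + 1)) fun W =>
  buildElts Bool l (D + 1) W es fun cs => search l D F cs 0 0 1 p₀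

theorem testBit_maskOf {fb : List ℕ} {i : ℕ} (h : (maskOf fb).testBit i = true) : i ∈ fb := by
  induction fb with
  | nil => simp [maskOf] at h
  | cons w fb ih =>
    change (2 ^ w ||| maskOf fb).testBit i = true at h
    rw [Nat.testBit_or, Bool.or_eq_true, Nat.testBit_two_pow, decide_eq_true_eq] at h
    rcases h with h | h
    · simp [h]
    · exact List.mem_cons_of_mem _ (ih h)

/-- No relation of forbidden total length inside `U`. -/
def NoRel {G : Type*} [AddCommGroup G] (U : Multiset G) (fb : List ℕ) : Prop :=
  ∀ A B : Multiset G, A + B ≤ U → (∀ a ∈ A, a ∉ B) → A.sum = B.sum → A.card + B.card ∉ fb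

section Sound
variable {l : List ℕ}

/-- Correct preprocessing. -/
structure EltOK (l : List ℕ) (R : ℕ) (c : Elt) (x : GT l) : Prop where
  g : c.g = enc l x
  neg : c.neg = enc l (-x)
  bn : c.bn = 2 ^ c.neg
  fp : IsTr l R (enc l x) c.fp
  fm : IsTr l R (enc l (-x)) c.fm
  fs : IsTr l 1 (enc l x) c.fs

/-- All bits of `S` are subsums. -/
def SReal (T : Multiset (GT l)) (S : ℕ) : Prop :=
  ∀ i, S.testBit i = true → ∃ A ≤ T, enc l A.sum = i

/-- All bits of `P` are weighted differences of disjoint subsequences of `T`, shifted by `h`, `n`. -/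
def PReal (R : ℕ) (T : Multiset (GT l)) (h : GT l) (n P : ℕ) : Prop :=
  ∀ i, P.testBit i = true → ∃ A B, A + B ≤ T ∧ (∀ a ∈ A, a ∉ B) ∧ A.card + B.card + n = i % R ∧
    enc l (A.sum - B.sum + h) = i / R

theorem PReal.step (hpos : PosMod l) {R : ℕ} {T : Multiset (GT l)} {h x : GT l} {n P : ℕ} {f : ℕ → ℕ}
    (hP : PReal R T h n P) (hf : IsTr l R (enc l x) f) (hn : T.card + n + 1 < R) :
    PReal R T (h + x) (n + 1) (Nat.shiftLeft (f P) 1) := by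
  intro i hi
  change (f P <<< 1).testBit i = true at hi
  rw [Nat.testBit_shiftLeft, Bool.and_eq_true, decide_eq_true_eq] at hi
  obtain ⟨hi1, hi2⟩ := hi
  obtain ⟨j, hj, h1, h2⟩ := hf P (i - 1) hi2
  obtain ⟨A, B, hle, hd, hw, he⟩ := hP j hj
  refine ⟨A, B, hle, hd, ?_, ?_⟩
  · have hc := Multiset.card_le_card hle
    rw [Multiset.card_add] at hc
    have : i = (i - 1) + 1 := by omega
    rw [this, Nat.add_mod, h1, ← hw, Nat.mod_eq_of_lt (a := 1) (by omega), Nat.mod_eq_of_lt]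
    · omega
    · omega
  · have hc := Multiset.card_le_card hle
    rw [Multiset.card_add] at hc
    have hdiv : i / R = (i - 1) / R := by
      have e1 := Nat.div_add_mod (i - 1) R
      rw [h1, ← hw] at e1
      generalize (i - 1) / R = q at e1 ⊢
      have : i = R * q + (A.card + B.card + n + 1) := by omega
      rw [this, Nat.mul_add_div (by omega), Nat.div_eq_of_lt (a := A.card + B.card + n + 1)
          (by omega), add_zero]
    rw [hdiv, h2, ← he, codeAdd_enc hpos, add_assoc]

theorem SReal.step (hpos : PosMod l) {T : Multiset (GT l)} {x : GT l} {S : ℕ} {f : ℕ → ℕ}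
    (hS : SReal T S) (hf : IsTr l 1 (enc l x) f) : SReal (x ::ₘ T) (Nat.lor S (f S)) := by
  intro i hi
  change (S ||| f S).testBit i = true at hi
  rw [Nat.testBit_or, Bool.or_eq_true] at hi
  rcases hi with hi | hi
  · obtain ⟨A, hA, h⟩ := hS i hi
    exact ⟨A, hA.trans (Multiset.le_cons_self _ _), h⟩
  · obtain ⟨j, hj, h1, h2⟩ := hf S i hi
    obtain ⟨A, hA, h⟩ := hS j hj
    refine ⟨x ::ₘ A, by simpa using hA, ?_⟩
    rw [Nat.div_one, Nat.div_one] at h2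
    rw [h2, ← h, codeAdd_enc hpos, Multiset.sum_cons, add_comm]

theorem PReal.mono {R : ℕ} {T T' : Multiset (GT l)} {P : ℕ} (h : PReal R T 0 0 P) (hT : T ≤ T') :
    PReal R T' 0 0 P := by
  intro i hi
  obtain ⟨A, B, h1, h2⟩ := h i hi
  exact ⟨A, B, h1.trans hT, h2⟩

theorem loop_sound (hpos : PosMod l) {D F : ℕ} {c : Elt} {x : GT l} (hc : EltOK l (D + 1) c x)
    {k : ℕ → ℕ → ℕ → ℕ → Bool} {U T₀ : Multiset (GT l)} (hU : Atom U) (hD : U.card = D)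
    (hF : ∀ P, PReal (D + 1) U 0 0 P → Nat.land P F = 0) {v : ℕ}
    (hx : x ∉ T₀) (hle : T₀ + Multiset.replicate v x ≤ U)
    (hk : ∀ len s S P, len = (T₀ + Multiset.replicate v x).card → len < D →
      s = enc l (T₀ + Multiset.replicate v x).sum → SReal (T₀ + Multiset.replicate v x) S →
      PReal (D + 1) (T₀ + Multiset.replicate v x) 0 0 P → k len s S P = false) :
    ∀ (fuel j : ℕ) (_ : j < v) (_ : D ≤ fuel + T₀.card + j) (len s S P Tp Tm : ℕ),
      len = (T₀ + Multiset.replicate j x).card → s = enc l (T₀ + Multiset.replicate j x).sum →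
      SReal (T₀ + Multiset.replicate j x) S → PReal (D + 1) (T₀ + Multiset.replicate j x) 0 0 P →
      PReal (D + 1) T₀ (j • x) j Tp → PReal (D + 1) T₀ (j • (-x)) j Tm →
      loop l D F c k fuel len s S P Tp Tm = false := by
  have hcard := Multiset.card_le_card hle
  rw [Multiset.card_add, Multiset.card_replicate, hD] at hcard
  intro fuel
  induction fuel with
  | zero => intro j hj hf; omega
  | succ fuel ih =>
    intro j hj hf len s S P Tp Tm hlen hs hS hP hTp hTm
    set T := T₀ + Multiset.replicate j x with hT
    have hT' : T₀ + Multiset.replicate (j + 1) x = x ::ₘ T := by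
      rw [hT, Multiset.replicate_succ, Multiset.add_cons]
    have hTU : x ::ₘ T ≤ U := by
      rw [← hT']
      refine le_trans ?_ hle
      have : Multiset.replicate (j + 1) x ≤ Multiset.replicate v x := Multiset.replicate_le_replicate x |>.2 hj
      gcongr
    have hlen' : len = T₀.card + j := by rw [hlen, hT]; simp
    change cond (cond (Nat.beq s c.neg) (Nat.beq (Nat.succ len) D)
        (cond (Nat.blt (Nat.succ len) D) (Nat.beq (Nat.land S c.bn) 0) false)) _ true = false
    have hcond : cond (Nat.beq s c.neg) (Nat.beq (Nat.succ len) D)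
        (cond (Nat.blt (Nat.succ len) D) (Nat.beq (Nat.land S c.bn) 0) false) = true := by
      by_cases h1 : s = c.neg
      · rw [h1, Nat.beq_refl, cond_true]
        have hsum : (x ::ₘ T).sum = 0 := by
          rw [hs, hc.neg] at h1
          rw [Multiset.sum_cons, enc_injective hpos h1, add_neg_cancel]
        have := congrArg Multiset.card (hU.2.2 _ hTU (by simp) hsum)
        rw [Multiset.card_cons, hD, ← hlen] at this
        rw [← this]
        exact Nat.beq_refl _
      · have h1' : Nat.beq s c.neg = false := by
          rw [Bool.eq_false_iff]; exact fun h => h1 (Nat.eq_of_beq_eq_true h)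
        rw [h1', cond_false]
        have hlt : Nat.succ len < D := by
          by_contra hcon
          have hce := Multiset.card_le_card hTU
          rw [Multiset.card_cons, ← hlen] at hce
          have heq := Multiset.eq_of_le_of_card_le hTU (by rw [Multiset.card_cons, ← hlen]; omega)
          apply h1
          have h0 := hU.2.1
          rw [← heq, Multiset.sum_cons] at h0
          rw [hs, hc.neg, eq_neg_of_add_eq_zero_right h0]
        have hb : Nat.blt (Nat.succ len) D = true := by
          rw [Nat.blt]; exact Nat.ble_eq_true_of_le hlt
        rw [hb, cond_true]
        have hz : Nat.land S c.bn = 0 := by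
          rw [hc.bn]
          change S &&& 2 ^ c.neg = 0
          rw [Nat.and_two_pow]
          suffices S.testBit c.neg = false by simp [this]
          rw [Bool.eq_false_iff]
          intro hbit
          obtain ⟨A, hA, hAe⟩ := hS _ hbit
          rw [hc.neg] at hAe
          have hAs := enc_injective hpos hAe
          have := hU.2.2 (x ::ₘ A) (le_trans (by simpa using hA) hTU) (by simp)
            (by rw [Multiset.sum_cons, hAs, add_neg_cancel])
          have h2 := congrArg Multiset.card this
          have h3 := Multiset.card_le_card hA
          rw [Multiset.card_cons] at h2
          omega
        rw [hz]
        rfl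
    rw [hcond, cond_true, force_eq, force_eq, force_eq]
    have hTp' : PReal (D + 1) T₀ ((j + 1) • x) (j + 1) (Nat.shiftLeft (c.fp Tp) 1) := by
      rw [succ_nsmul]
      exact hTp.step hpos hc.fp (by omega)
    have hTm' : PReal (D + 1) T₀ ((j + 1) • (-x)) (j + 1) (Nat.shiftLeft (c.fm Tm) 1) := by
      rw [succ_nsmul]
      exact hTm.step hpos hc.fm (by omega)
    set Tp' := Nat.shiftLeft (c.fp Tp) 1
    set Tm' := Nat.shiftLeft (c.fm Tm) 1
    have hP' : PReal (D + 1) (x ::ₘ T) 0 0 (Nat.lor P (Nat.lor Tp' Tm')) := by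
      intro i hi
      change (P ||| (Tp' ||| Tm')).testBit i = true at hi
      rw [Nat.testBit_or, Nat.testBit_or, Bool.or_eq_true, Bool.or_eq_true] at hi
      rw [← hT']
      rcases hi with hi | hi | hi
      · exact hP.mono (by rw [hT']; exact Multiset.le_cons_self _ _) i hi
      · obtain ⟨A, B, h1, h2, h3, h4⟩ := hTp' i hi
        refine ⟨A + Multiset.replicate (j + 1) x, B, ?_, ?_, ?_, ?_⟩
        · rw [add_right_comm]; gcongr
        · intro a ha
          rcases Multiset.mem_add.1 ha with ha | ha
          · exact h2 a ha
          · rw [Multiset.eq_of_mem_replicate ha]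
            exact fun hb => hx (Multiset.mem_of_le h1 (Multiset.mem_add.2 (Or.inr hb)))
        · rw [← h3]; simp; omega
        · rw [← h4, Multiset.sum_add, Multiset.sum_replicate]
          congr 1; abel
      · obtain ⟨A, B, h1, h2, h3, h4⟩ := hTm' i hi
        refine ⟨A, B + Multiset.replicate (j + 1) x, ?_, ?_, ?_, ?_⟩
        · rw [← add_assoc]; gcongr
        · intro a ha hb
          rcases Multiset.mem_add.1 hb with hb | hb
          · exact h2 a ha hb
          · rw [Multiset.eq_of_mem_replicate hb] at ha
            exact hx (Multiset.mem_of_le h1 (Multiset.mem_add.2 (Or.inl ha)))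
        · rw [← h3]; simp; omega
        · rw [← h4, Multiset.sum_add, Multiset.sum_replicate, smul_neg]
          congr 1; abel
    have hz := hF (Nat.lor P (Nat.lor Tp' Tm')) (hP'.mono hTU)
    rw [hz]
    change cond (Nat.ble D (Nat.succ len)) false _ = false
    by_cases hDl : D ≤ Nat.succ len
    · rw [Nat.ble_eq_true_of_le hDl, cond_true]
    · have : Nat.ble D (Nat.succ len) = false := by
        rw [Bool.eq_false_iff]; exact fun h => hDl (Nat.le_of_ble_eq_true h)
      rw [this, cond_false, force_eq, force_eq, force_eq]
      have hS' := hS.step hpos hc.fs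
      have hs' : codeAdd l s c.g = enc l (x ::ₘ T).sum := by
        rw [hs, hc.g, codeAdd_enc hpos, Multiset.sum_cons, add_comm]
      have hl' : Nat.succ len = (x ::ₘ T).card := by rw [Multiset.card_cons, ← hlen]
      by_cases hjv : j + 1 = v
      · rw [hk _ _ _ _ (by rw [← hjv, hT', hl']) (by omega) (by rw [← hjv, hT', hs'])
          (by rw [← hjv, hT']; exact hS') (by rw [← hjv, hT']; exact hP'), cond_false]
      · have := ih (j + 1) (by omega) (by omega) (Nat.succ len) (codeAdd l s c.g) _ _ _ _
          (by rw [hT', hl']) (by rw [hT', hs']) (by rw [hT']; exact hS') (by rw [hT']; exact hP') hTp' hTm'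
        have e : Nat.rec (motive := fun _ => ℕ → ℕ → ℕ → ℕ → ℕ → ℕ → Bool) _ _ fuel = loop l D F c k fuel := rfl
        rw [e, this]
        cases k _ _ _ _ <;> rfl

theorem buildElts_eq (hpos : PosMod l) (R W : ℕ) (hR : 0 < R) (α : Type) : ∀ (es : List (ℕ × Bool × ℕ))
    (_ : ∀ e ∈ es, ∃ x : GT l, enc l x = e.1), ∃ cs : List Elt, (∀ k, buildElts α l R W es k = k cs) ∧
      List.Forall₂ (fun (e : ℕ × Bool × ℕ) c => c.g = e.1 ∧ c.lo = e.2.1 ∧ c.mn = e.2.2 ∧ ∃ x,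
    EltOK l R c x) es cs
  | [], _ => ⟨[], fun _ => rfl, List.Forall₂.nil⟩
  | e :: es, h => by
    obtain ⟨cs, hcs, hall⟩ := buildElts_eq hpos R W hR α es (fun e he => h e (List.mem_cons_of_mem _ he))
    obtain ⟨x, hx⟩ := h e (by simp)
    obtain ⟨fp, hfp, kp⟩ := buildTr_eq α W l hpos R e.1 hR
    obtain ⟨fm, hfm, km⟩ := buildTr_eq α W l hpos R (codeNeg l e.1) hR
    obtain ⟨fs, hfs, ks⟩ := buildTr_eq α (W / R) l hpos 1 e.1 one_pos
    refine ⟨⟨e.1, codeNeg l e.1, 2 ^ codeNeg l e.1, fp, fm, fs, e.2.1, e.2.2⟩ :: cs, fun k => ?_, ?_⟩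
    · rw [buildElts, hcs, force_eq, kp, km, ks, force_eq]
    · refine List.Forall₂.cons ⟨rfl, rfl, rfl, x, ⟨hx.symm, ?_, rfl, ?_, ?_, ?_⟩⟩ hall
      · rw [← hx, codeNeg_enc hpos]
      · rwa [hx]
      · rw [← hx, codeNeg_enc hpos] at hfm; exact hfm
      · rwa [hx]

theorem search_sound (hpos : PosMod l) {D F : ℕ} {U : Multiset (GT l)} (hU : Atom U) (hD : U.card = D)
    (hF : ∀ P, PReal (D + 1) U 0 0 P → Nat.land P F = 0) : ∀ (cs : List Elt)
    (_ : ∀ c ∈ cs, ∃ x, EltOK l (D + 1) c x) (_ : cs.Pairwise fun c c' => c'.lo = true → c.g ≠ c'.g)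
    (T V : Multiset (GT l)) (_ : T + V = U) (_ : ∀ x ∈ T, x ∉ V) (_ : V ≠ 0)
    (_ : ∀ x ∈ V, ∃ c ∈ cs, c.g = enc l x) (_ : ∀ c ∈ cs, c.lo = true → ∃ x ∈ V, c.g = enc l x)
    (_ : ∀ c cs', c :: cs' <:+ cs → ∀ W ≤ U, (∀ x ∈ W, ∃ c' ∈ c :: cs', c'.g = enc l x) → c.mn + W.card ≤ D)
    (s S P : ℕ) (_ : s = enc l T.sum) (_ : SReal T S) (_ : PReal (D + 1) T 0 0 P),
    search l D F cs T.card s S P = false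
  | [], _, _, T, V, hTV, hdis, hV0, hVc, hlo, hmn, s, S, P, hs, hS, hP => by
    obtain ⟨x, hx⟩ := Multiset.exists_mem_of_ne_zero hV0
    obtain ⟨c, hc, _⟩ := hVc x hx
    simp at hc
  | c :: cs, hok, hpw, T, V, hTV, hdis, hV0, hVc, hlo, hmn, s, S, P, hs, hS, hP => by
    classical
    obtain ⟨x, hx⟩ := hok c (by simp)
    rw [List.pairwise_cons] at hpw
    have ih := search_sound hpos hU hD hF cs (fun c hc => hok c (List.mem_cons_of_mem _ hc)) hpw.2
    have hmn' : ∀ c₁ cs', c₁ :: cs' <:+ cs → ∀ W ≤ U, (∀ x ∈ W, ∃ c' ∈ c₁ :: cs', c'.g = enc l x) →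
        c₁.mn + W.card ≤ D := fun c₁ cs' h => hmn c₁ cs' (h.trans (List.suffix_cons _ _))
    have hcard : T.card + V.card = D := by rw [← hD, ← hTV, Multiset.card_add]
    have hm := hmn c cs List.suffix_rfl V (by rw [← hTV]; exact Multiset.le_add_left _ _) hVc
    change cond (Nat.ble c.mn T.card) (cond (cond c.lo true (search l D F cs T.card s S P))
      (loop l D F c (search l D F cs) (Nat.sub D T.card) T.card s S P P P) false) true = false
    rw [Nat.ble_eq_true_of_le (by omega), cond_true]
    by_cases hxV : x ∈ V
    · suffices loop l D F c (search l D F cs) (Nat.sub D T.card) T.card s S P P P = false by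
        rw [this]; cases (cond c.lo true (search l D F cs T.card s S P)) <;> rfl
      obtain ⟨V', hV'⟩ := Multiset.le_iff_exists_add.1 (Multiset.le_count_iff_replicate_le.1
          (le_refl (V.count x)))
      have hxV' : x ∉ V' := by
        rw [← Multiset.count_eq_zero]
        have := congrArg (Multiset.count x) hV'
        rw [Multiset.count_add, Multiset.count_replicate_self] at this
        omega
      have hxT : x ∉ T := fun h => hdis x h hxV
      set v := V.count x with hv
      have hUe : (T + Multiset.replicate v x) + V' = U := by rw [← hTV, add_assoc, ← hV']
      refine loop_sound hpos hx hU hD hF hxT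
        (by rw [← hUe]; exact Multiset.le_add_right _ _) ?_ (Nat.sub D T.card) 0 (Multiset.count_pos.2 hxV)
        (by change D ≤ (D - T.card) + T.card + 0; omega) T.card s S P P P (by simp) (by simpa using hs)
        (by simpa using hS) (by simpa using hP) (by simpa using hP) (by simpa using hP)
      intro len s' S' P' hlen hlt hs' hS' hP'
      rw [hlen]
      refine ih (T + Multiset.replicate v x) V' hUe ?_ ?_ ?_ ?_ hmn' s' S' P' hs' hS' hP'
      · intro y hy
        rcases Multiset.mem_add.1 hy with hy | hy
        · exact fun h => hdis y hy (by rw [hV']; exact Multiset.mem_add.2 (Or.inr h))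
        · rw [Multiset.eq_of_mem_replicate hy]; exact hxV'
      · rintro rfl
        rw [add_zero] at hUe
        have h1 := congrArg Multiset.card hUe
        rw [hD, ← hlen] at h1
        omega
      · intro y hy
        obtain ⟨c', hc', he⟩ := hVc y (by rw [hV']; exact Multiset.mem_add.2 (Or.inr hy))
        rcases List.mem_cons.1 hc' with rfl | hc'
        · rw [hx.g] at he
          exact absurd hy (enc_injective hpos he ▸ hxV')
        · exact ⟨c', hc', he⟩
      · intro c' hc' hl
        obtain ⟨y, hy, he⟩ := hlo c' (List.mem_cons_of_mem _ hc') hl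
        rw [hV'] at hy
        rcases Multiset.mem_add.1 hy with hy | hy
        · rw [Multiset.eq_of_mem_replicate hy, ← hx.g] at he
          exact absurd he.symm (hpw.1 c' hc' hl)
        · exact ⟨y, hy, he⟩
    · have hlof : c.lo = false := by
        rw [Bool.eq_false_iff]
        intro hl
        obtain ⟨y, hy, he⟩ := hlo c (by simp) hl
        rw [hx.g] at he
        exact hxV (enc_injective hpos he ▸ hy)
      rw [hlof, cond_false, ih T V hTV hdis hV0 ?_ ?_ hmn' s S P hs hS hP, cond_false]
      · intro y hy
        obtain ⟨c', hc', he⟩ := hVc y hy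
        rcases List.mem_cons.1 hc' with rfl | hc'
        · rw [hx.g] at he
          exact absurd hy (enc_injective hpos he ▸ hxV)
        · exact ⟨c', hc', he⟩
      · exact fun c' hc' hl => hlo c' (List.mem_cons_of_mem _ hc') hl

theorem run_sound (hpos : PosMod l) {D p₀ : ℕ} {fb : List ℕ} {es : List (ℕ × Bool × ℕ)}
    (hrun : run l D p₀ fb es = true) (hfb : ∀ w ∈ fb, w ≤ D) (hes : ∀ e ∈ es, ∃ x : GT l, enc l x = e.1)
    (hpw : es.Pairwise fun e e' => e'.2.1 = true → e.1 ≠ e'.1)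
    {U : Multiset (GT l)} (hU : Atom U) (hD : U.card = D) (hrel : NoRel U fb) (hp₀ : p₀ ≤ 1)
    (hcov : ∀ x ∈ U, ∃ e ∈ es, e.1 = enc l x) (hlo : ∀ e ∈ es, e.2.1 = true → ∃ x ∈ U, e.1 = enc l x)
    (hmn : ∀ e es', e :: es' <:+ es → ∀ W ≤ U, (∀ x ∈ W, ∃ e' ∈ e :: es', e'.1 = enc l x) →
    e.2.2 + W.card ≤ D) :
    False := by
  obtain ⟨cs, hcs, hall⟩ := buildElts_eq hpos (D + 1) (l.foldr (· * ·) 1 * (D + 1))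
      (Nat.succ_pos D) Bool es hes
  rw [run, force_eq, force_eq, hcs] at hrun
  have hF : ∀ P, PReal (D + 1) U 0 0 P → Nat.land P (maskOf fb) = 0 := by
    intro P hP
    change P &&& maskOf fb = 0
    apply Nat.eq_of_testBit_eq
    intro i
    rw [Nat.zero_testBit, Nat.testBit_and, Bool.eq_false_iff]
    intro h
    rw [Bool.and_eq_true] at h
    have hi := testBit_maskOf h.2
    have hiD := hfb i hi
    obtain ⟨A, B, h1, h2, h3, h4⟩ := hP i h.1
    rw [Nat.mod_eq_of_lt (by omega), add_zero] at h3
    rw [Nat.div_eq_of_lt (by omega), ← enc_zero l, add_zero] at h4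
    exact hrel A B h1 h2 (sub_eq_zero.1 (enc_injective hpos h4)) (h3 ▸ hi)
  have memcs : ∀ c ∈ cs, ∃ e ∈ es, c.g = e.1 ∧ c.lo = e.2.1 ∧ c.mn = e.2.2 ∧ ∃ x, EltOK l (D + 1) c x := by
    clear hpw hcov hlo hmn hes hcs hrun
    induction hall with
    | nil => intro c hc; simp at hc
    | @cons a b es cs h1 h2 ih =>
      intro c hc
      rcases List.mem_cons.1 hc with rfl | hc
      · exact ⟨_, by simp, h1⟩
      · obtain ⟨e, he, h⟩ := ih c hc
        exact ⟨e, List.mem_cons_of_mem _ he, h⟩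
  have memes : ∀ {es cs}, List.Forall₂ (fun (e : ℕ × Bool × ℕ) c => c.g = e.1 ∧ c.lo = e.2.1 ∧ c.mn = e.2.2 ∧
      ∃ x, EltOK l (D + 1) c x) es cs → ∀ e ∈ es, ∃ c ∈ cs, c.g = e.1 := by
    intro es cs hall
    induction hall with
    | nil => intro c hc; simp at hc
    | @cons a b es cs h1 h2 ih =>
      intro e he
      rcases List.mem_cons.1 he with rfl | he
      · exact ⟨_, by simp, h1.1⟩
      · obtain ⟨c, hc, h⟩ := ih e he
        exact ⟨c, List.mem_cons_of_mem _ hc, h⟩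
  have := search_sound hpos hU hD hF cs (fun c hc => (memcs c hc).choose_spec.2.2.2.2) ?_ 0 U
      (by simp) (by simp)
    hU.1 ?_ ?_ ?_ 0 1 p₀ ?_ ?_ ?_
  · rw [Multiset.card_zero, hrun] at this
    cases this
  · clear hcov hlo hmn hes hcs hrun memcs
    induction hall with
    | nil => exact List.Pairwise.nil
    | @cons a b es cs h1 h2 ih =>
      rw [List.pairwise_cons] at hpw ⊢
      refine ⟨fun c hc hl => ?_, ih hpw.2⟩
      have : ∀ c ∈ cs, ∃ e ∈ es, c.g = e.1 ∧ c.lo = e.2.1 := by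
        clear hpw ih hc
        induction h2 with
        | nil => intro c hc; simp at hc
        | @cons a' b' es cs h1 h2 ih =>
          intro c hc
          rcases List.mem_cons.1 hc with rfl | hc
          · exact ⟨_, by simp, h1.1, h1.2.1⟩
          · obtain ⟨e, he, h⟩ := ih c hc
            exact ⟨e, List.mem_cons_of_mem _ he, h⟩
      obtain ⟨e, he, h3, h4⟩ := this c hc
      rw [h1.1, h3]
      exact hpw.1 e he (h4 ▸ hl)
  · intro x hx
    obtain ⟨e, he, h⟩ := hcov x hx
    obtain ⟨c, hc, h'⟩ := memes hall e he
    exact ⟨c, hc, h'.trans h⟩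
  · intro c hc hl
    obtain ⟨e, he, h1, h2, -⟩ := memcs c hc
    obtain ⟨x, hx, h3⟩ := hlo e he (h2 ▸ hl)
    exact ⟨x, hx, h1.trans h3⟩
  · intro c cs' hsuf W hW hWc
    have : ∃ e es', e :: es' <:+ es ∧ List.Forall₂ (fun (e : ℕ × Bool × ℕ) c => c.g = e.1 ∧ c.lo = e.2.1 ∧
        c.mn = e.2.2 ∧ ∃ x, EltOK l (D + 1) c x) (e :: es') (c :: cs') := by
      clear hpw hcov hlo hmn hes hcs hrun memcs
      induction hall with
      | nil => simp at hsuf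
      | @cons a b es cs h1 h2 ih =>
        rcases List.suffix_cons_iff.1 hsuf with h | h
        · rw [h]
          exact ⟨a, es, List.suffix_rfl, List.Forall₂.cons h1 h2⟩
        · obtain ⟨e, es', h3, h4⟩ := ih h
          exact ⟨e, es', h3.trans (List.suffix_cons _ _), h4⟩
    obtain ⟨e, es', h1, h2⟩ := this
    have hmne : c.mn = e.2.2 := by
      cases h2 with
      | cons h _ => exact h.2.2.1
    rw [hmne]
    refine hmn e es' h1 W hW fun x hx => ?_
    obtain ⟨c', hc', hg⟩ := hWc x hx
    have : ∃ e' ∈ e :: es', c'.g = e'.1 := by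
      have key : ∀ {es cs}, List.Forall₂ (fun (e : ℕ × Bool × ℕ) c => c.g = e.1 ∧ c.lo = e.2.1 ∧ c.mn = e.2.2 ∧
          ∃ x, EltOK l (D + 1) c x) es cs → ∀ c ∈ cs, ∃ e ∈ es, c.g = e.1 := by
        intro es cs hall
        induction hall with
        | nil => intro c hc; simp at hc
        | @cons a b es cs h1 h2 ih =>
          intro e he
          rcases List.mem_cons.1 he with rfl | he
          · exact ⟨_, by simp, h1.1⟩
          · obtain ⟨c, hc, h⟩ := ih e he
            exact ⟨c, List.mem_cons_of_mem _ hc, h⟩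
      exact key h2 c' hc'
    obtain ⟨e', he', h⟩ := this
    exact ⟨e', he', h.symm.trans hg⟩
  · rw [Multiset.sum_zero, enc_zero]
  · intro i hi
    refine ⟨0, le_rfl, ?_⟩
    rw [Nat.testBit_one_eq_true_iff_self_eq_zero] at hi
    rw [hi, Multiset.sum_zero, enc_zero]
  · intro i hi
    interval_cases p₀
    · simp at hi
    · rw [Nat.testBit_one_eq_true_iff_self_eq_zero] at hi
      exact ⟨0, 0, by simp, by simp, by simp [hi], by simp [hi, enc_zero]⟩

end Sound
end SetsOfLengths

namespace SetsOfLengths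

/-- Decoding of a mixed radix code. -/
def dec : (l : List ℕ) → ℕ → GT l
  | [], _ => PUnit.unit
  | m :: ms, c => ((c : ZMod m), dec ms (c / m))

theorem enc_dec : ∀ {l : List ℕ}, PosMod l → ∀ {c : ℕ}, c < l.foldr (· * ·) 1 → enc l (dec l c) = c
  | [], _, c, hc => by simp at hc; simp [enc, hc]
  | m :: ms, h, c, hc => by
    have hm := h m (by simp)
    have : NeZero m := ⟨hm.ne'⟩
    rw [List.foldr_cons] at hc
    change ((c : ZMod m)).val + m * enc ms (dec ms (c / m)) = c
    rw [enc_dec h.tail (Nat.div_lt_of_lt_mul hc), ZMod.val_natCast, Nat.mod_add_div]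

theorem GT.card_eq : ∀ {l : List ℕ}, PosMod l → Nat.card (GT l) = l.foldr (· * ·) 1
  | [], _ => by
    change Nat.card PUnit = 1
    simp
  | m :: ms, h => by
    have hm := h m (by simp)
    change Nat.card (ZMod m × GT ms) = _
    rw [Nat.card_prod, GT.card_eq h.tail, Nat.card_zmod, List.foldr_cons]

theorem GT.finite {l : List ℕ} (h : PosMod l) : Finite (GT l) := by
  apply Nat.finite_of_card_ne_zero
  rw [GT.card_eq h]
  induction l with
  | nil => simp
  | cons m ms ih =>
    rw [List.foldr_cons]
    exact Nat.mul_ne_zero (h m (by simp)).ne' (ih h.tail)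

section Comb
variable {G : Type*} [AddCommGroup G]

/-- The linear combination of the elements of a list with coefficients in `GT l`. -/
def comb : (l : List ℕ) → List G → GT l → G
  | _ :: ms, g :: gs, x => x.1.val • g + comb ms gs x.2
  | _, _, _ => 0

theorem comb_add : ∀ {l : List ℕ} {gs : List G}, List.Forall₂ (fun m g => 0 < m ∧ m • g = 0) l gs →
    ∀ x y, comb l gs (x + y) = comb l gs x + comb l gs y
  | _, _, List.Forall₂.nil, x, y => by simp [comb]
  | m :: _, g :: _, List.Forall₂.cons h hs, x, y => by
    have : NeZero m := ⟨h.1.ne'⟩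
    have h1 : (x + y).1 = x.1 + y.1 := rfl
    have h2 : (x + y).2 = x.2 + y.2 := rfl
    rw [comb, comb, comb, h1, h2, comb_add hs, ZMod.val_add]
    have h3 : ((x.1.val + y.1.val) % m) • g = x.1.val • g + y.1.val • g := by
      rw [← add_nsmul]
      conv_rhs => rw [← Nat.div_add_mod (x.1.val + y.1.val) m, add_nsmul, mul_comm, mul_nsmul', h.2,
          smul_zero, zero_add]
    rw [h3]; abel

/-- The homomorphism given by linear combinations. -/
def combHom {l : List ℕ} {gs : List G} (h : List.Forall₂ (fun m g => 0 < m ∧ m • g = 0) l gs) :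
    GT l →+ G where
  toFun := comb l gs
  map_add' := comb_add h
  map_zero' := by
    have := comb_add h 0 0
    rw [add_zero] at this
    exact left_eq_add.1 this

theorem mem_range_combHom {l : List ℕ} {gs : List G} (h : List.Forall₂ (fun m g => 0 < m ∧ m • g = 0) l gs) :
    ∀ g ∈ gs, ∃ x, comb l gs x = g := by
  induction h with
  | nil => intro g hg; simp at hg
  | @cons m g ms gs h hs ih =>
    intro g' hg'
    rcases List.mem_cons.1 hg' with rfl | hg'
    · refine ⟨((1 : ZMod m), (0 : GT ms)), ?_⟩
      have h0 : comb ms gs (0 : GT ms) = 0 := (combHom hs).map_zero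
      change (1 : ZMod m).val • g' + comb ms gs (0 : GT ms) = g'
      rw [h0, add_zero]
      rcases Nat.eq_or_lt_of_le (Nat.succ_le_of_lt h.1) with h1 | h1
      · have : g' = 0 := by simpa [← h1] using h.2
        rw [this, smul_zero]
      · have : Fact (1 < m) := ⟨h1⟩
        rw [ZMod.val_one, one_smul]
    · obtain ⟨x, hx⟩ := ih g' hg'
      refine ⟨((0 : ZMod m), x), ?_⟩
      change (0 : ZMod m).val • g + comb ms gs x = g'
      rw [ZMod.val_zero, zero_smul, zero_add, hx]

theorem exists_equiv {l : List ℕ} {gs : List G} (h : List.Forall₂ (fun m g => 0 < m ∧ m • g = 0) l gs)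
    (htop : ∀ x : G, x ∈ AddSubgroup.closure {g | g ∈ gs}) (hcard : Nat.card G = l.foldr (· * ·) 1)  :
    ∃ e : GT l ≃+ G, ∀ x, e x = comb l gs x := by
  have hpos : PosMod l := by
    intro m hm
    clear htop hcard
    induction h with
    | nil => simp at hm
    | @cons m' g ms gs h hs ih =>
      rcases List.mem_cons.1 hm with rfl | hm
      · exact h.1
      · exact ih hm
  have hsurj : Function.Surjective (combHom h) := by
    intro x
    have : AddSubgroup.closure {g | g ∈ gs} ≤ (combHom h).range := by
      rw [AddSubgroup.closure_le]
      intro g hg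
      exact mem_range_combHom h g hg
    exact this (htop x)
  have := GT.finite hpos
  have hbij : Function.Bijective (combHom h) :=
    (Nat.bijective_iff_surjective_and_card _).2 ⟨hsurj, by rw [GT.card_eq hpos, hcard]⟩
  exact ⟨AddEquiv.ofBijective _ hbij, fun x => rfl⟩

theorem natCard_zmod_module {V : Type*} [AddCommGroup V] {p : ℕ} [Fact p.Prime] [Module (ZMod p) V]
    [Finite V] :
    Nat.card V = Nat.card (ZMod p) ^ Module.finrank (ZMod p) V := by
  have : Module.Finite (ZMod p) V := Module.Finite.of_finite
  exact Module.natCard_eq_pow_finrank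

theorem exists_basis_map {V : Type*} [AddCommGroup V] {p : ℕ} [Fact p.Prime] [Module (ZMod p) V]
    [Finite V] {r : ℕ}
    (hcard : Nat.card V = p ^ r) (π : G →+ V) (hπ : Function.Surjective π) {U : Set G}
    (hU : AddSubgroup.closure U = ⊤) :
    ∃ gs : List G, gs.length = r ∧ (∀ g ∈ gs, g ∈ U) ∧
      ∀ x : G, ∃ y ∈ AddSubgroup.closure {g | g ∈ gs}, π y = π x := by
  have hrank : Module.finrank (ZMod p) V = r := by
    have h1 := natCard_zmod_module (p := p) (V := V)
    rw [hcard, Nat.card_zmod] at h1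
    exact (Nat.pow_right_injective (Fact.out : p.Prime).two_le h1).symm
  have hspan : Submodule.span (ZMod p) (π '' U) = ⊤ := by
    refine Submodule.eq_top_iff'.2 fun v => ?_
    obtain ⟨x, rfl⟩ := hπ v
    have hx : x ∈ AddSubgroup.closure U := by rw [hU]; trivial
    induction hx using AddSubgroup.closure_induction with
    | mem x hx => exact Submodule.subset_span ⟨x, hx, rfl⟩
    | zero => rw [map_zero]; exact Submodule.zero_mem _
    | add x y _ _ hx hy => rw [map_add]; exact Submodule.add_mem _ hx hy
    | neg x _ hx => rw [map_neg]; exact Submodule.neg_mem _ hx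
  obtain ⟨b, hbU, hbs, hbi⟩ := exists_linearIndependent (ZMod p) (π '' U)
  have hbfin : b.Finite := Set.toFinite b
  choose! u hu using fun v (hv : v ∈ b) => hbU hv
  have hbc : b.ncard = r := by
    let : Fintype b := hbfin.fintype
    rw [← hrank, Module.finrank_eq_card_basis (Module.Basis.mk hbi (by rw [Subtype.range_coe, hbs, hspan])),
      ← Nat.card_coe_set_eq, Nat.card_eq_fintype_card]
  refine ⟨(hbfin.toFinset.toList).map u, ?_, ?_, ?_⟩
  · rw [List.length_map, Finset.length_toList, ← Set.ncard_eq_toFinset_card b hbfin, hbc]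
  · intro g hg
    obtain ⟨v, hv, rfl⟩ := List.mem_map.1 hg
    exact (hu v (by simpa using hv)).1
  · intro x
    set Q := AddSubgroup.closure {g | g ∈ (hbfin.toFinset.toList).map u}
    suffices ∀ v ∈ Submodule.span (ZMod p) b, ∃ y ∈ Q, π y = v from
      this (π x) (by rw [hbs, hspan]; exact Submodule.mem_top)
    intro v hv
    induction hv using Submodule.span_induction with
    | mem v hv =>
      exact ⟨u v, AddSubgroup.subset_closure (List.mem_map.2 ⟨v, by simpa using hv, rfl⟩), (hu v hv).2⟩
    | zero => exact ⟨0, zero_mem _, map_zero _⟩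
    | add v w _ _ hv hw =>
      obtain ⟨y, hy, rfl⟩ := hv
      obtain ⟨z, hz, rfl⟩ := hw
      exact ⟨y + z, add_mem hy hz, map_add _ _ _⟩
    | smul a v _ hv =>
      obtain ⟨y, hy, rfl⟩ := hv
      refine ⟨a.val • y, nsmul_mem hy _, ?_⟩
      conv_rhs => rw [← ZMod.natCast_zmod_val a]
      rw [map_nsmul]
      exact (Nat.cast_smul_eq_nsmul (ZMod p) a.val (π y)).symm

theorem exists_basis_mod [Finite G] {p : ℕ} (hp : p.Prime) {r : ℕ}
    (hr : Nat.card {x : G // p • x = 0} = p ^ r)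
    {U : Set G} (hU : AddSubgroup.closure U = ⊤) : ∃ gs : List G, gs.length = r ∧ (∀ g ∈ gs, g ∈ U) ∧
      ∀ x : G, ∃ y ∈ AddSubgroup.closure {g | g ∈ gs}, ∃ z : G, x = y + p • z := by
  have : Fact p.Prime := ⟨hp⟩
  set f : G →+ G := nsmulAddMonoidHom p with hf
  set K := f.range with hK
  have hV : ∀ v : G ⧸ K, p • v = 0 := by
    intro v
    obtain ⟨x, rfl⟩ := QuotientAddGroup.mk_surjective v
    rw [← QuotientAddGroup.mk_nsmul, QuotientAddGroup.eq_zero_iff]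
    exact ⟨x, rfl⟩
  have hcard : Nat.card (G ⧸ K) = p ^ r := by
    have h1 := AddSubgroup.card_eq_card_quotient_mul_card_addSubgroup K
    have h2 := AddSubgroup.card_eq_card_quotient_mul_card_addSubgroup f.ker
    have h3 : Nat.card (G ⧸ f.ker) = Nat.card K := Nat.card_congr
        (QuotientAddGroup.quotientKerEquivRange f).toEquiv
    have h4 : Nat.card f.ker = p ^ r := by
      rw [← hr]
      exact Nat.card_congr (Equiv.subtypeEquivRight fun x => by simp [hf, AddMonoidHom.mem_ker])
    rw [h3, h4, h1, mul_comm] at h2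
    have : 0 < Nat.card K := Nat.card_pos
    exact Nat.eq_of_mul_eq_mul_left this h2
  let := AddCommGroup.zmodModule hV
  obtain ⟨gs, h1, h2, h3⟩ := exists_basis_map hcard (QuotientAddGroup.mk' K)
      (QuotientAddGroup.mk'_surjective K) hU
  refine ⟨gs, h1, h2, fun x => ?_⟩
  obtain ⟨y, hy, hyx⟩ := h3 x
  obtain ⟨z, hz⟩ := QuotientAddGroup.eq.1 hyx
  refine ⟨y, hy, z, ?_⟩
  change p • z = -y + x at hz
  rw [hz]; abel

end Comb

theorem torsion_card {p : ℕ} : ∀ {l : List ℕ}, PosMod l →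
    Nat.card {x : GT l // p • x = 0} = (l.map (Nat.gcd p)).foldr (· * ·) 1
  | [], _ => by
    have : Unique {x : GT [] // p • x = 0} := ⟨⟨⟨0, smul_zero _⟩⟩, fun x => Subtype.ext rfl⟩
    simp
  | m :: ms, h => by
    have hm := h m (by simp)
    have : NeZero m := ⟨hm.ne'⟩
    have e : {x : GT (m :: ms) // p • x = 0} ≃ {x : ZMod m // p • x = 0} × {x : GT ms // p • x = 0} :=
      { toFun := fun x => (⟨x.1.1, congrArg Prod.fst x.2⟩, ⟨x.1.2, congrArg Prod.snd x.2⟩)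
        invFun := fun x => ⟨(x.1.1, x.2.1), Prod.ext x.1.2 x.2.2⟩
        left_inv := fun x => rfl
        right_inv := fun x => rfl }
    rw [Nat.card_congr e, Nat.card_prod, torsion_card h.tail, List.map_cons, List.foldr_cons]
    congr 1
    have h1 := IsAddCyclic.card_nsmulAddMonoidHom_ker (ZMod m) p
    rw [Nat.card_zmod] at h1
    rw [Nat.gcd_comm, ← h1]
    exact Nat.card_congr (Equiv.subtypeEquivRight fun x => by simp [AddMonoidHom.mem_ker])

end SetsOfLengths

namespace SetsOfLengths

theorem exists_le_le_add {α : Type*} {A B C : Multiset α} (h : C ≤ A + B) :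
    ∃ A' ≤ A, ∃ B' ≤ B, C = A' + B' := by
  classical
  refine ⟨C ∩ A, Multiset.inter_le_right, C - A, by rwa [Multiset.sub_le_iff_le_add, add_comm], ?_⟩
  rw [add_comm, Multiset.sub_add_inter]

theorem Atom.no_small_rel {G : Type*} [AddCommGroup G] {U A B : Multiset G} (hU : Atom U) (h2 : 2 < U.card)
    (hle : A + B ≤ U) (hd : ∀ a ∈ A, a ∉ B) (hs : A.sum = B.sum) (hc : A.card + B.card ≤ 2) :
    A.card + B.card = 0 := by
  have hA2 : A ≤ U := (Multiset.le_add_right _ _).trans hle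
  have hB2 : B ≤ U := (Multiset.le_add_left _ _).trans hle
  rcases Nat.eq_zero_or_pos B.card with hb | hb
  · rw [Multiset.card_eq_zero] at hb
    subst hb
    by_contra h
    have := hU.2.2 A hA2 (by rintro rfl; simp at h) hs
    subst this
    simp at hc
    omega
  rcases Nat.eq_zero_or_pos A.card with ha | ha
  · rw [Multiset.card_eq_zero] at ha
    subst ha
    by_contra h
    have := hU.2.2 B hB2 (by rintro rfl; simp at h) hs.symm
    subst this
    simp at hc
    omega
  · obtain ⟨x, rfl⟩ := Multiset.card_eq_one.1 (show A.card = 1 by omega)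
    obtain ⟨y, rfl⟩ := Multiset.card_eq_one.1 (show B.card = 1 by omega)
    rw [Multiset.sum_singleton, Multiset.sum_singleton] at hs
    subst hs
    exact absurd (hd x (by simp)) (by simp)

theorem noRel_of_symLen {G : Type*} [AddCommGroup G] {U : Multiset G} (hU : Atom U) {p fb : List ℕ}
    (hp : ∀ k ∈ symLen U, k ∈ p)
    (hfb : ∀ f ∈ fb, 2 < f ∧ f ≤ U.card ∧ ∀ a ∈ List.range (f + 1), 2 < a → U.card + 2 - a ∈ p →
      f - a ∈ fb ∨ f - a = 1 ∨ f - a = 2) : NoRel U fb := by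
  classical
  intro A B hle hd hs hf
  induction hn : A.card + B.card using Nat.strong_induction_on generalizing A B with
  | _ n ih =>
  obtain ⟨h2, h3, h4⟩ := hfb _ hf
  have h0 : (0 : G) ∉ U := hU.zero_notMem (by omega)
  obtain ⟨W, hW, hWat⟩ := exists_atom_le (A + B.map Neg.neg)
    (by rw [← Multiset.card_pos, Multiset.card_add, Multiset.card_map]; omega)
    (by rw [Multiset.sum_add, sum_map_neg, hs, add_neg_cancel])
  obtain ⟨A', hA, B₁, hB₁, rfl⟩ := exists_le_le_add hW
  obtain ⟨B', hB, rfl⟩ := le_map_iff.1 hB₁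
  obtain ⟨R, hR⟩ := Multiset.le_iff_exists_add.1 ((add_le_add hA hB).trans hle)
  obtain ⟨A'', rfl⟩ := Multiset.le_iff_exists_add.1 hA
  obtain ⟨B'', rfl⟩ := Multiset.le_iff_exists_add.1 hB
  have hmem := hp _ (relation_atom_mem hR h0 hWat)
  have hcU := congrArg Multiset.card hR
  rw [Multiset.card_add, Multiset.card_add] at hcU
  rw [Multiset.card_add, Multiset.card_add] at h2 h3 h4 hf hn
  have hsW := hWat.2.1
  rw [Multiset.sum_add, sum_map_neg, ← sub_eq_add_neg, sub_eq_zero] at hsW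
  have hpos := hWat.card_pos
  rw [Multiset.card_add, Multiset.card_map] at hpos
  have hle1 : A'' + B'' ≤ U := le_trans (add_le_add (Multiset.le_add_left _ _) (Multiset.le_add_left _ _)) hle
  have hd1 : ∀ a ∈ A'', a ∉ B'' := fun a ha hb => hd a (by simp [ha]) (by simp [hb])
  have hs1 : A''.sum = B''.sum := by
    rw [Multiset.sum_add, Multiset.sum_add, hsW] at hs
    exact add_left_cancel hs
  rcases Nat.lt_or_ge 2 (A'.card + B'.card) with hc | hc
  · have h5 := h4 (A'.card + B'.card) (by rw [List.mem_range]; omega) hc (by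
        rwa [show U.card + 2 - (A'.card + B'.card) = R.card + 2 by omega])
    rw [show A'.card + A''.card + (B'.card + B''.card) - (A'.card + B'.card) = A''.card + B''.card by omega] at h5
    rcases h5 with h5 | h5
    · exact ih (A''.card + B''.card) (by omega) A'' B'' hle1 hd1 hs1 h5 rfl
    · have := hU.no_small_rel (by omega) hle1 hd1 hs1 (by omega)
      omega
  · have := hU.no_small_rel (by omega) ((add_le_add hA hB).trans hle)
      (fun a ha hb => hd a (by simp [ha]) (by simp [hb])) hsW hc
    omega

theorem NoRel.map {G H : Type*} [AddCommGroup G] [AddCommGroup H] (e : G ≃+ H) {U : Multiset G} {fb : List ℕ}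
    (h : NoRel U fb) : NoRel (U.map e) fb := by
  intro A B hle hd hs
  obtain ⟨A', B', hAB, rfl, rfl⟩ := map_eq_add (f := e) (A := (A + B).map e.symm) (B := A) (C := B) (by
    rw [Multiset.map_map]
    simp)
  rw [Multiset.card_map, Multiset.card_map]
  refine h A' B' ?_ (fun a ha hb => hd (e a) (Multiset.mem_map_of_mem _ ha) (Multiset.mem_map_of_mem _ hb)) ?_
  · have := Multiset.map_le_map (f := e.symm) hle
    rw [hAB, Multiset.map_map] at this
    simpa using this
  · rw [← map_multiset_sum, ← map_multiset_sum] at hs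
    exact e.injective hs

/-- Multiples of a code. -/
def codeMul (l : List ℕ) (x : ℕ) : ℕ → ℕ
  | 0 => 0
  | n + 1 => codeAdd l (codeMul l x n) x

/-- Codes whose order is `d`. -/
def hasOrder (l : List ℕ) (x d : ℕ) : Bool :=
  codeMul l x d == 0 && (List.range d).all fun k => k == 0 || codeMul l x k != 0

/-- Codes ordered by their orders, without the codes in `pre`. -/
def codesByOrder (l pre ds : List ℕ) : List ℕ :=
  ds.flatMap fun d => (List.range (l.foldr (· * ·) 1)).filter fun x => hasOrder l x d && !(pre.contains x)

/-- The entries with given mandatory codes, free codes and codes admitted only from length `m` on. -/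
def entries (pre r₁ r₂ : List ℕ) (m : ℕ) : List (ℕ × Bool × ℕ) :=
  pre.map (fun c => (c, true, 0)) ++ (r₁.map (fun c => (c, false, 0)) ++ r₂.map fun c => (c, false, m))

/-- Validity of the data for a search. -/
def entriesOK (l : List ℕ) (D : ℕ) (fb pre r₁ r₂ : List ℕ) : Bool :=
  decide (PosMod l) && fb.all (fun w => Nat.ble w D) && decide pre.Nodup &&
    (pre ++ (r₁ ++ r₂)).all fun c => Nat.blt c (l.foldr (· * ·) 1)

theorem run_entries {l : List ℕ} {D p₀ m : ℕ} {fb pre r₁ r₂ : List ℕ}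
    (hok : entriesOK l D fb pre r₁ r₂ = true)
    (hrun : run l D p₀ fb (entries pre r₁ r₂ m) = true) {U : Multiset (GT l)} (hU : Atom U) (hD : U.card = D)
    (hrel : NoRel U fb) (hp₀ : p₀ ≤ 1) (hpre : ∀ c ∈ pre, ∃ x ∈ U, c = enc l x)
    (hcov : ∀ x ∈ U, enc l x ∈ pre ++ (r₁ ++ r₂))
    (hm : ∀ W ≤ U, (∀ x ∈ W, enc l x ∈ r₂) → r₂ ≠ [] → m + W.card ≤ D) : False := by
  simp only [entriesOK, Bool.and_eq_true, decide_eq_true_eq, List.all_eq_true, Nat.ble_eq, Nat.blt_eq] at hok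
  obtain ⟨⟨⟨h1, h2⟩, h3⟩, h4⟩ := hok
  refine run_sound h1 hrun h2 ?_ ?_ hU hD hrel hp₀ ?_ ?_ ?_
  · intro e he
    refine ⟨dec l e.1, enc_dec h1 (h4 _ ?_)⟩
    simp only [entries, List.mem_append, List.mem_map] at he ⊢
    rcases he with ⟨c, hc, rfl⟩ | ⟨c, hc, rfl⟩ | ⟨c, hc, rfl⟩ <;> simp [hc]
  · rw [entries, List.pairwise_append]
    refine ⟨?_, ?_, ?_⟩
    · rw [List.pairwise_map]
      refine List.Pairwise.imp ?_ h3
      intro a b h _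
      exact h
    · rw [List.pairwise_append]
      refine ⟨List.pairwise_map.2 (List.pairwise_of_forall (by simp)), List.pairwise_map.2
          (List.pairwise_of_forall (by simp)), ?_⟩
      intro a _ b hb
      obtain ⟨c, hc, rfl⟩ := List.mem_map.1 hb
      simp
    · intro a _ b hb
      rw [List.mem_append] at hb
      rcases hb with hb | hb <;> obtain ⟨c, hc, rfl⟩ := List.mem_map.1 hb <;> simp
  · intro x hx
    have := hcov x hx
    simp only [List.mem_append] at this
    rcases this with h | h | h
    · exact ⟨(enc l x, true, 0), by simp [entries, h], rfl⟩
    · exact ⟨(enc l x, false, 0), by simp [entries, h], rfl⟩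
    · exact ⟨(enc l x, false, m), by simp [entries, h], rfl⟩
  · intro e he ht
    simp only [entries, List.mem_append, List.mem_map] at he
    rcases he with ⟨c, hc, rfl⟩ | ⟨c, hc, rfl⟩ | ⟨c, hc, rfl⟩
    · exact hpre c hc
    · cases ht
    · cases ht
  · intro e es' hsuf W hW hWc
    have hWD := Multiset.card_le_card hW
    rw [hD] at hWD
    by_cases he : e.2.2 = 0
    · omega
    have hsuf2 : e :: es' <:+ r₂.map fun c => (c, false, m) := by
      have key : ∀ {L R : List (ℕ × Bool × ℕ)}, (∀ e ∈ L,
          e.2.2 = 0) → e :: es' <:+ L ++ R → e :: es' <:+ R := by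
        intro L R hL h
        induction L with
        | nil => exact h
        | cons a L ih =>
          rw [List.cons_append, List.suffix_cons_iff] at h
          rcases h with h | h
          · rw [List.cons.injEq] at h
            exact absurd (hL a (by simp)) (h.1 ▸ he)
          · exact ih (fun e he => hL e (by simp [he])) h
      refine key ?_ (key ?_ hsuf)
      · intro e he
        obtain ⟨c, hc, rfl⟩ := List.mem_map.1 he
        rfl
      · intro e he
        obtain ⟨c, hc, rfl⟩ := List.mem_map.1 he
        rfl
    obtain ⟨c, hc, rfl⟩ := List.mem_map.1 (hsuf2.subset (List.mem_cons_self))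
    refine hm W hW (fun x hx => ?_) (List.ne_nil_of_mem hc)
    obtain ⟨e', he', h⟩ := hWc x hx
    obtain ⟨c', hc', rfl⟩ := List.mem_map.1 (hsuf2.subset he')
    rw [← h]
    exact hc'

/-- The complete check used to exclude long atoms without forbidden relations: all nonzero codes, with the exception of the
involutions if `inv` is true, occur. -/
noncomputable def exclude (l : List ℕ) (D p₀ : ℕ) (fb pre ds : List ℕ) (inv : Bool) : Bool :=
  entriesOK l D fb pre (codesByOrder l pre ds) [] &&
    ((List.range (l.foldr (· * ·) 1)).all fun c => Nat.beq c 0 ||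
        (inv && Nat.beq (codeAdd l c c) 0) || pre.contains c ||
      ds.any (hasOrder l c)) &&
    run l D p₀ fb (entries pre (codesByOrder l pre ds) [] 0)

theorem exclude_sound {l : List ℕ} {D p₀ : ℕ} {fb pre ds : List ℕ} {inv : Bool}
    (hex : exclude l D p₀ fb pre ds inv = true) {U : Multiset (GT l)} (hU : Atom U)
    (hD : U.card = D) (hD1 : 1 < D)
    (hrel : NoRel U fb) (hp₀ : p₀ ≤ 1) (hpre : ∀ c ∈ pre, ∃ x ∈ U, c = enc l x)
    (hinv : inv = true → ∀ x ∈ U, x + x ≠ 0) : False := by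
  rw [exclude, Bool.and_eq_true, Bool.and_eq_true] at hex
  obtain ⟨⟨h1, h2⟩, h3⟩ := hex
  have hpos : PosMod l := by
    simp only [entriesOK, Bool.and_eq_true, decide_eq_true_eq] at h1
    exact h1.1.1.1
  refine run_entries h1 h3 hU hD hrel hp₀ hpre ?_ (by simp)
  intro x hx
  rw [List.all_eq_true] at h2
  have hlt := enc_lt hpos x
  have := h2 (enc l x) (List.mem_range.2 hlt)
  have hx0 : enc l x ≠ 0 := fun h => hU.zero_notMem (by omega) (by
    have h' : x = 0 := enc_injective hpos (h.trans (enc_zero l).symm)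
    rwa [h'] at hx)
  simp only [Bool.or_eq_true, Bool.and_eq_true, Nat.beq_eq, List.contains_iff_mem, List.any_eq_true,
      hx0, false_or] at this
  rw [List.mem_append]
  by_cases hp : enc l x ∈ pre
  · exact Or.inl hp
  rcases this with (⟨h, h'⟩ | h) | ⟨d, hd, h⟩
  · rw [codeAdd_enc hpos] at h'
    exact absurd (enc_injective hpos (h'.trans (enc_zero l).symm)) (hinv h x hx)
  · exact absurd h hp
  · refine Or.inr (List.mem_append_left _ ?_)
    simp only [codesByOrder, List.mem_flatMap, List.mem_filter, List.mem_range, Bool.and_eq_true]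
    exact ⟨d, hd, hlt, h, by simpa using hp⟩

end SetsOfLengths

namespace SetsOfLengths
variable {G : Type*} [AddCommGroup G]

theorem prod_replicate_append (r p m : ℕ) : (List.replicate r p ++ [m]).foldr (· * ·) 1 = p ^ r * m := by
  induction r with
  | zero => simp
  | succ r ih => rw [List.replicate_succ, List.cons_append, List.foldr_cons, ih]; ring

theorem prod_replicate (r p : ℕ) : (List.replicate r p).foldr (· * ·) 1 = p ^ r := by
  induction r with
  | zero => simp
  | succ r ih => rw [List.replicate_succ, List.foldr_cons, ih]; ring

theorem comb_dec_cons {m : ℕ} (hm : 0 < m) (l : List ℕ) (g : G) (gs : List G) (c : ℕ) :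
    comb (m :: l) (g :: gs) (dec (m :: l) c) = (c % m) • g + comb l gs (dec l (c / m)) := by
  have : NeZero m := ⟨hm.ne'⟩
  change ((c : ZMod m)).val • g + _ = _
  rw [ZMod.val_natCast]
  rfl

theorem comb_dec_zero {l : List ℕ} (gs : List G) (h : PosMod l) : comb l gs (dec l 0) = 0 := by
  induction l generalizing gs with
  | nil => rfl
  | cons m l ih =>
    cases gs with
    | nil => rfl
    | cons g gs => rw [comb_dec_cons (h m (by simp)), Nat.zero_mod, zero_smul, Nat.zero_div,
        ih _ h.tail, zero_add]

theorem comb_dec_last {p m : ℕ} (hp : 1 < p) (f : G) {t : ℕ} (ht : t < m) : ∀ (gs : List G) (c : ℕ),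
    c = t * p ^ gs.length → comb (List.replicate gs.length p ++ [m]) (gs ++ [f]) (dec _ c) = t • f
  | [], c, hc => by
    refine (comb_dec_cons (by omega) [] f [] c).trans ?_
    rw [hc, List.length_nil, pow_zero, mul_one, Nat.mod_eq_of_lt ht]
    exact add_zero _
  | g :: gs, c, hc => by
    refine (comb_dec_cons (by omega) (List.replicate gs.length p ++ [m]) g (gs ++ [f]) c).trans ?_
    rw [List.length_cons, pow_succ, ← mul_assoc] at hc
    rw [comb_dec_last hp f ht gs (c / p) (by rw [hc, Nat.mul_div_cancel _ (by omega)]), hc, Nat.mul_mod_left,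
      zero_smul, zero_add]

theorem comb_dec_unit {p m : ℕ} (hp : 1 < p) (f : G) {t : ℕ} (ht : t < m) :
    ∀ (gs : List G) (i : ℕ) (hi : i < gs.length) (c : ℕ), c = p ^ i + t * p ^ gs.length →
      comb (List.replicate gs.length p ++ [m]) (gs ++ [f]) (dec _ c) = gs[i] + t • f
  | g :: gs, 0, _, c, hc => by
    refine (comb_dec_cons (by omega) (List.replicate gs.length p ++ [m]) g (gs ++ [f]) c).trans ?_
    rw [List.length_cons, pow_succ, ← mul_assoc, pow_zero] at hc
    rw [comb_dec_last hp f ht gs (c / p) (by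
        rw [hc, Nat.add_mul_div_right _ _ (by omega), Nat.div_eq_of_lt hp, zero_add]), hc,
      Nat.add_mul_mod_self_right, Nat.mod_eq_of_lt hp, one_smul]
    rfl
  | g :: gs, i + 1, hi, c, hc => by
    refine (comb_dec_cons (by omega) (List.replicate gs.length p ++ [m]) g (gs ++ [f]) c).trans ?_
    rw [List.length_cons, pow_succ, pow_succ, ← mul_assoc, ← add_mul] at hc
    rw [comb_dec_unit hp f ht gs i (by simpa using hi) (c / p) (by rw [hc,
        Nat.mul_div_cancel _ (by omega)]), hc,
      Nat.mul_mod_left, zero_smul, zero_add]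
    rfl

theorem comb_dec_unit' {p : ℕ} (hp : 1 < p) : ∀ (gs : List G) (i : ℕ) (hi : i < gs.length) (c : ℕ),
    c = p ^ i →
    comb (List.replicate gs.length p) gs (dec _ c) = gs[i]
  | g :: gs, 0, _, c, hc => by
    refine (comb_dec_cons (by omega) (List.replicate gs.length p) g gs c).trans ?_
    rw [hc, pow_zero, Nat.mod_eq_of_lt hp, Nat.div_eq_of_lt hp, one_smul, comb_dec_zero, add_zero]
    · rfl
    · intro x hx
      rw [List.eq_of_mem_replicate hx]
      omega
  | g :: gs, i + 1, hi, c, hc => by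
    refine (comb_dec_cons (by omega) (List.replicate gs.length p) g gs c).trans ?_
    rw [pow_succ] at hc
    rw [comb_dec_unit' hp gs i (by simpa using hi) (c / p) (by rw [hc, Nat.mul_div_cancel _ (by omega)]), hc,
      Nat.mul_mod_left, zero_smul, zero_add]
    rfl

theorem posMod_replicate {p : ℕ} (hp : 0 < p) (r : ℕ) : PosMod (List.replicate r p) := fun x hx => by
  rw [List.eq_of_mem_replicate hx]; exact hp

theorem forall₂_replicate {p : ℕ} {gs : List G} (hp : 0 < p) (h : ∀ g ∈ gs, p • g = 0) :
    List.Forall₂ (fun m g => 0 < m ∧ m • g = 0) (List.replicate gs.length p) gs := by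
  induction gs with
  | nil => exact List.Forall₂.nil
  | cons g gs ih =>
    exact List.Forall₂.cons ⟨hp, h g (by simp)⟩ (ih fun g hg => h g (by simp [hg]))

/-- A generating subset of a homocyclic `p`-group contains a basis. -/
theorem exists_prefix_homocyclic [Finite G] {p k r q : ℕ} (hp : p.Prime) (hq : q = p ^ (k + 1))
    (hexp : ∀ x : G, q • x = 0)
    (hcard : Nat.card G = q ^ r) (hr : Nat.card {x : G // p • x = 0} = p ^ r)
    {U : Set G} (hU : AddSubgroup.closure U = ⊤) :
    ∃ e : G ≃+ GT (List.replicate r q), ∀ i < r, ∃ x ∈ U, q ^ i = enc _ (e x) := by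
  obtain ⟨gs, rfl, hgs, hgen⟩ := exists_basis_mod hp hr hU
  have hq1 : 1 < q := hq ▸ Nat.one_lt_pow (by omega) hp.one_lt
  have key : ∀ (j : ℕ) (x : G), ∃ y ∈ AddSubgroup.closure {g | g ∈ gs}, ∃ z : G, x = y + p ^ j • z := by
    intro j
    induction j with
    | zero => exact fun x => ⟨0, zero_mem _, x, by simp⟩
    | succ j ih =>
      intro x
      obtain ⟨y, hy, z, rfl⟩ := ih x
      obtain ⟨y', hy', z', rfl⟩ := hgen z
      exact ⟨y + p ^ j • y', add_mem hy (nsmul_mem hy' _), z', by rw [smul_add, pow_succ,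
          mul_nsmul', add_assoc]⟩
  obtain ⟨e, he⟩ := exists_equiv (forall₂_replicate (gs := gs) (by omega) fun g _ => hexp g) (fun x => by
    obtain ⟨y, hy, z, rfl⟩ := key (k + 1) x
    rwa [← hq, hexp, add_zero]) (by rw [hcard, prod_replicate])
  refine ⟨e.symm, fun i hi => ⟨gs[i], hgs _ (List.getElem_mem hi), ?_⟩⟩
  have h1 := he (dec _ (q ^ i))
  rw [comb_dec_unit' hq1 gs i hi _ rfl] at h1
  rw [← h1, AddEquiv.symm_apply_apply, enc_dec (posMod_replicate (by omega) _)]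
  rw [prod_replicate]
  exact Nat.pow_lt_pow_right hq1 hi

/-- A generating subset of the direct sum of an elementary `p`-group and a cyclic group of coprime order `m` contains
elements whose first components are a basis. -/
theorem exists_prefix_coprime [Finite G] {p m c r : ℕ} (hp : p.Prime) (hm : 1 < m)
    (hc : (p * m) ∣ c * p)  (hexp : ∀ x : G, (p * m) • x = 0) {f : G} (hf : m • f = 0)
    (hfG : ∀ x : G, ∃ t < m, x = c • x + t • f)
    (hcard : Nat.card G = p ^ r * m) (hr : Nat.card {x : G // p • x = 0} = p ^ r)
    {U : Set G} (hU : AddSubgroup.closure U = ⊤) :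
    ∃ gs : List G, gs.length = r ∧ (∀ g ∈ gs, g ∈ U) ∧ ∀ gs' : List G, gs'.Perm gs → ∀ f',
    (f' = f ∨ f' = -f) →
      ∃ e : G ≃+ GT (List.replicate r p ++ [m]), ∀ (i : ℕ) (hi : i < gs'.length), ∀ t < m,
    gs'[i] = c • gs'[i] + t • f' →
        p ^ i + t * p ^ r = enc _ (e gs'[i]) := by
  obtain ⟨gs, rfl, hgs, hgen⟩ := exists_basis_mod hp hr hU
  refine ⟨gs, rfl, hgs, fun gs' hperm f' hf' => ?_⟩
  have hlen := hperm.length_eq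
  rw [← hlen] at hcard ⊢
  have hpos : PosMod (List.replicate gs'.length p ++ [m]) := by
    intro x hx
    rcases List.mem_append.1 hx with hx | hx
    · rw [List.eq_of_mem_replicate hx]; exact hp.pos
    · rw [List.mem_singleton.1 hx]; omega
  have hcp : ∀ x : G, p • c • x = 0 := by
    intro x
    obtain ⟨d, hd⟩ := hc
    rw [← mul_nsmul, hd, mul_comm, mul_nsmul', hexp, smul_zero]
  have hmf : m • f' = 0 := by rcases hf' with rfl | rfl <;> simp [hf]
  have hF : List.Forall₂ (fun m g => 0 < m ∧ m • g = 0) (List.replicate gs'.length p ++ [m])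
      (gs'.map (c • ·) ++ [f']) := by
    refine List.rel_append ?_ (List.Forall₂.cons ⟨by omega, hmf⟩ List.Forall₂.nil)
    have := forall₂_replicate (gs := gs'.map (c • ·)) hp.pos (by simp [hcp])
    rwa [List.length_map] at this
  obtain ⟨e, he⟩ := exists_equiv hF (fun x => by
    obtain ⟨y, hy, z, hx⟩ := hgen x
    obtain ⟨t, -, ht⟩ := hfG x
    set K := AddSubgroup.closure {g | g ∈ gs'.map (c • ·) ++ [f']} with hK
    have hfK : f ∈ K := by
      have : f' ∈ K := AddSubgroup.subset_closure (by simp)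
      rcases hf' with rfl | rfl
      · exact this
      · simpa using this
    have hcx : c • x = c • y := by
      rw [hx, smul_add, ← mul_nsmul, mul_nsmul', hcp, add_zero]
    rw [ht]
    refine add_mem ?_ (nsmul_mem hfK _)
    rw [hcx]
    clear hcx ht hx
    induction hy using AddSubgroup.closure_induction with
    | mem g hg =>
      exact AddSubgroup.subset_closure
        (List.mem_append_left _ (List.mem_map.2 ⟨g, hperm.mem_iff.2 hg, rfl⟩))
    | zero => rw [smul_zero]; exact zero_mem _
    | add x y _ _ hx hy => rw [smul_add]; exact add_mem hx hy
    | neg x _ hx => rw [smul_neg]; exact neg_mem hx) (by rw [hcard, prod_replicate_append])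
  refine ⟨e.symm, fun i hi t ht h => ?_⟩
  have h1 := he (dec _ (p ^ i + t * p ^ gs'.length))
  have h2 : ∀ r, r = (gs'.map (c • ·)).length → comb (List.replicate r p ++ [m]) (gs'.map (c • ·) ++ [f'])
      (dec (List.replicate r p ++ [m]) (p ^ i + t * p ^ r)) = c • gs'[i] + t • f' := by
    rintro _ rfl
    rw [comb_dec_unit hp.one_lt f' ht (gs'.map (c • ·)) i (by simpa using hi) _ rfl, List.getElem_map]
  replace h2 := h2 gs'.length (List.length_map _).symm
  rw [h2, ← h] at h1
  have h3 : e.symm gs'[i] = dec _ (p ^ i + t * p ^ gs'.length) := by rw [← h1, AddEquiv.symm_apply_apply]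
  rw [h3, enc_dec hpos]
  rw [prod_replicate_append]
  have : p ^ i < p ^ gs'.length := Nat.pow_lt_pow_right hp.one_lt hi
  nlinarith

end SetsOfLengths

namespace SetsOfLengths
variable {G : Type*} [AddCommGroup G]

theorem GT.smul_eq_zero {n : ℕ} : ∀ {l : List ℕ}, (∀ m ∈ l, m ∣ n) → ∀ x : GT l, n • x = 0
  | [], _, _ => rfl
  | m :: ms, h, x => by
    refine Prod.ext ?_ (GT.smul_eq_zero (fun m hm => h m (by simp [hm])) x.2)
    obtain ⟨k, rfl⟩ := h m (by simp)
    change (m * k) • x.1 = 0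
    have h1 : m • (x.1 : ZMod m) = 0 := ZModModule.char_nsmul_eq_zero m _
    rw [mul_comm, mul_nsmul', h1, smul_zero] 

/-- A sequence with restricted set of lengths is excluded by a successful search. -/
theorem false_of_exclude {l : List ℕ} {D p₀ : ℕ} {p fb pre ds : List ℕ} {inv : Bool}
    (hex : exclude l D p₀ fb pre ds inv = true) (hD1 : 1 < D) (hp₀ : p₀ ≤ 1)
    (hfb : ∀ f ∈ fb, 2 < f ∧ f ≤ D ∧ ∀ a ∈ List.range (f + 1), 2 < a → D + 2 - a ∈ p →
      f - a ∈ fb ∨ f - a = 1 ∨ f - a = 2)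
    {U : Multiset G} (hU : Atom U) (hD : U.card = D) (hp : ∀ k ∈ symLen U, k ∈ p) (e : G ≃+ GT l)
    (hpre : ∀ c ∈ pre, ∃ x ∈ U, c = enc l (e x)) (hinv : inv = true → ∀ x ∈ U, x + x ≠ 0) : False := by
  subst hD
  refine exclude_sound hex (U := U.map e) (hU.map (f := e.toAddMonoidHom) e.injective) (by simp) hD1
    ((noRel_of_symLen hU hp hfb).map e) hp₀ ?_ ?_
  · intro c hc
    obtain ⟨x, hx, h⟩ := hpre c hc
    exact ⟨e x, Multiset.mem_map_of_mem _ hx, h⟩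
  · intro h x hx
    obtain ⟨y, hy, rfl⟩ := Multiset.mem_map.1 hx
    rw [← map_add, ne_eq, EmbeddingLike.map_eq_zero_iff]
    exact hinv h y hy

theorem torsion_card_replicate {p q : ℕ} (hq : 0 < q) (h : p ∣ q) (r : ℕ) :
    Nat.card {x : GT (List.replicate r q) // p • x = 0} = p ^ r := by
  rw [torsion_card (posMod_replicate hq r), List.map_replicate, Nat.gcd_eq_left h, prod_replicate]

theorem false_of_exclude_homocyclic {q k r s : ℕ} (hs : s.Prime) (hq : q = s ^ (k + 1)) {D : ℕ}
    {p fb ds : List ℕ}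
    (hex : exclude (List.replicate r q) D 1 fb ((List.range r).map (q ^ ·)) ds false = true) (hD1 : 1 < D)
    (hfb : ∀ f ∈ fb, 2 < f ∧ f ≤ D ∧ ∀ a ∈ List.range (f + 1), 2 < a → D + 2 - a ∈ p →
      f - a ∈ fb ∨ f - a = 1 ∨ f - a = 2)
    {U : Multiset (GT (List.replicate r q))} (hU : MaxAtom U) (hD : U.card = D)
    (hp : ∀ k ∈ symLen U, k ∈ p) : False := by
  have hq0 : 0 < q := hq ▸ pow_pos hs.pos _
  have := GT.finite (posMod_replicate hq0 r)
  obtain ⟨e, he⟩ := exists_prefix_homocyclic hs hq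
    (GT.smul_eq_zero (l := List.replicate r q) fun m hm => by rw [List.eq_of_mem_replicate hm])
    (by rw [GT.card_eq (posMod_replicate hq0 r), prod_replicate])
    (torsion_card_replicate hq0 (hq ▸ dvd_pow_self s (by omega)) r) hU.closure_eq_top
  refine false_of_exclude hex hD1 le_rfl hfb hU.1 hD hp e ?_ (by simp)
  intro c hc
  obtain ⟨i, hi, rfl⟩ := List.mem_map.1 hc
  exact he i (List.mem_range.1 hi)

/-- The generator of the last component. -/
def lastGen (p m : ℕ) : (r : ℕ) → GT (List.replicate r p ++ [m])
  | 0 => ((1 : ZMod m), PUnit.unit)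
  | r + 1 => ((0 : ZMod p), lastGen p m r)

theorem smul_lastGen {p m : ℕ} : ∀ r, m • lastGen p m r = 0
  | 0 => Prod.ext (ZModModule.char_nsmul_eq_zero m (1 : ZMod m)) rfl
  | r + 1 => Prod.ext (smul_zero (M := ℕ) (A := ZMod p) m) (smul_lastGen r)

theorem eq_smul_lastGen {p m : ℕ} (hm : 0 < m) (hpm : p.Coprime m) :
    ∀ (r : ℕ) (x : GT (List.replicate r p ++ [m])), m • x = 0 → ∃ t < m, x = t • lastGen p m r
  | 0, x, _ => by
    have : NeZero m := ⟨hm.ne'⟩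
    refine ⟨x.1.val, ZMod.val_lt _, Prod.ext ?_ rfl⟩
    change x.1 = x.1.val • (1 : ZMod m)
    rw [nsmul_eq_mul, mul_one, ZMod.natCast_zmod_val]
  | r + 1, x, h => by
    obtain ⟨t, ht, h2⟩ := eq_smul_lastGen hm hpm r x.2 (congrArg Prod.snd h)
    refine ⟨t, ht, Prod.ext ?_ h2⟩
    change x.1 = t • (0 : ZMod p)
    have h1 : m • x.1 = 0 := congrArg Prod.fst h
    rw [smul_zero]
    have hu : IsUnit ((m : ℕ) : ZMod p) := (ZMod.isUnit_iff_coprime m p).2 hpm.symm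
    rw [nsmul_eq_mul] at h1
    exact (hu.mul_right_eq_zero).1 h1

theorem exists_split {α : Type*} (P : α → Prop) [DecidablePred P] (gs : List α) : ∃ gs' : List α,
    gs'.Perm gs ∧
    ∀ (i : ℕ) (hi : i < gs'.length), P gs'[i] ↔ i < gs.countP P := by
  refine ⟨gs.filter (fun x => decide (P x)) ++ gs.filter fun x => !decide (P x), List.filter_append_perm _ _,
    fun i hi => ?_⟩
  rw [List.countP_eq_length_filter, List.getElem_append]
  split_ifs with h
  · have := List.getElem_mem h
    simp only [List.mem_filter, decide_eq_true_eq] at this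
    exact iff_of_true this.2 h
  · have := List.getElem_mem (l := gs.filter fun x => !decide (P x))
      (n := i - (gs.filter fun x => decide (P x)).length) (by rw [List.length_append] at hi; omega)
    simp only [List.mem_filter, Bool.not_eq_true', decide_eq_false_iff_not] at this
    exact iff_of_false this.2 h

/-- Codes of the first elements when the last components are `t₁` (`n` times) and `t₂`. -/
def coprimePre (p r n t₁ t₂ : ℕ) : List ℕ := (List.range r).map fun i => p ^ i +
    (if i < n then t₁ else t₂) * p ^ r

theorem coprime_data {p m c r : ℕ} (hp : p.Prime) (hm : 1 < m) (hpm : p.Coprime m) (hc1 : c % p = 1)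
    (x : GT (List.replicate r p ++ [m])) :
    ∃ t < m, x = c • x + t • lastGen p m r := by
  have hc0 : 1 ≤ c := by
    by_contra h
    rw [show c = 0 by omega, Nat.zero_mod] at hc1
    omega
  obtain ⟨d, hd⟩ : p ∣ c - 1 := (Nat.modEq_iff_dvd' hc0).1
      (by rw [Nat.ModEq, hc1, Nat.mod_eq_of_lt hp.one_lt])
  obtain ⟨t, ht, h⟩ := eq_smul_lastGen (by omega) hpm r (x - c • x) (by
    have h2 : c • x = (c - 1) • x + x := by rw [← succ_nsmul, Nat.sub_add_cancel hc0]
    rw [h2, sub_add_cancel_right, smul_neg, neg_eq_zero, hd, ← mul_nsmul']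
    refine GT.smul_eq_zero (fun k hk => ?_) x
    rcases List.mem_append.1 hk with hk | hk
    · rw [List.eq_of_mem_replicate hk]; exact Dvd.intro_left (m * d) (by ring)
    · rw [List.mem_singleton.1 hk]; exact Dvd.intro _ rfl)
  exact ⟨t, ht, by rw [← h, add_sub_cancel]⟩

open Classical in
theorem exists_coprimePre {p m c r : ℕ} (hp : p.Prime) (hm : 1 < m) (hpm : p.Coprime m)
    (hc1 : c % p = 1) (hcm : m ∣ c)
    {U : Multiset (GT (List.replicate r p ++ [m]))} (hU : AddSubgroup.closure {g | g ∈ U} = ⊤) :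
    ∃ gs : List (GT (List.replicate r p ++ [m])), gs.length = r ∧ (∀ g ∈ gs, g ∈ U) ∧
      ∀ f', (f' = lastGen p m r ∨ f' = -lastGen p m r) → ∀ t₁ < m, ∀ t₂ < m,
      (∀ g ∈ gs, g = c • g + t₁ • f' ∨ g = c • g + t₂ • f') →
      ∃ e : GT (List.replicate r p ++ [m]) ≃+ GT (List.replicate r p ++ [m]),
        ∀ x ∈ coprimePre p r (gs.countP fun g => g = c • g + t₁ • f') t₁ t₂, ∃ g ∈ U, x = enc _ (e g) := by
  have hpos : PosMod (List.replicate r p ++ [m]) := by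
    intro x hx
    rcases List.mem_append.1 hx with hx | hx
    · rw [List.eq_of_mem_replicate hx]; exact hp.pos
    · rw [List.mem_singleton.1 hx]; omega
  have := GT.finite hpos
  obtain ⟨gs, hl, hgs, key⟩ := exists_prefix_coprime (G := GT (List.replicate r p ++ [m])) (c := c) hp hm
    (by rw [mul_comm]; exact mul_dvd_mul_right hcm p)
    (GT.smul_eq_zero fun k hk => by
      rcases List.mem_append.1 hk with hk | hk
      · rw [List.eq_of_mem_replicate hk]; exact Dvd.intro _ rfl
      · rw [List.mem_singleton.1 hk]; exact Dvd.intro_left _ rfl)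
    (smul_lastGen r) (coprime_data hp hm hpm hc1) (by rw [GT.card_eq hpos, prod_replicate_append])
    (by rw [torsion_card hpos, List.map_append, List.map_replicate, List.map_singleton, Nat.gcd_self, hpm,
        prod_replicate_append, mul_one]) hU
  refine ⟨gs, hl, hgs, fun f' hf' t₁ ht₁ t₂ ht₂ h => ?_⟩
  obtain ⟨gs', hperm, hgs'⟩ := exists_split (fun g => g = c • g + t₁ • f') gs
  obtain ⟨e, he⟩ := key gs' hperm f' hf'
  refine ⟨e, fun x hx => ?_⟩
  obtain ⟨i, hi, rfl⟩ := List.mem_map.1 hx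
  have hi' : i < gs'.length := by rw [hperm.length_eq, hl]; exact List.mem_range.1 hi
  refine ⟨gs'[i], hgs _ (hperm.mem_iff.1 (List.getElem_mem hi')), ?_⟩
  have h1 := hgs' i hi'
  have h2 := h _ (hperm.mem_iff.1 (List.getElem_mem hi'))
  split_ifs with h3
  · exact he i hi' t₁ ht₁ (h1.2 h3)
  · exact he i hi' t₂ ht₂ (h2.resolve_left fun h4 => h3 (h1.1 h4))

/-- Prefixes in `C_p^r ⊕ C_2`. -/
theorem exists_coprimePre_two {p r : ℕ} (hp : p.Prime) (hp2 : p % 2 = 1)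
    {U : Multiset (GT (List.replicate r p ++ [2]))} (hU : AddSubgroup.closure {g | g ∈ U} = ⊤) :
    ∃ n ≤ r, ∃ e : GT (List.replicate r p ++ [2]) ≃+ GT (List.replicate r p ++ [2]),
        ∀ x ∈ coprimePre p r n 1 0, ∃ g ∈ U, x = enc _ (e g) := by
  classical
  have hc1 : (p + 1) % p = 1 := by rw [Nat.add_mod_left, Nat.mod_eq_of_lt hp.one_lt]
  have hpm : p.Coprime 2 := Nat.coprime_two_right.2 (Nat.odd_iff.2 hp2)
  obtain ⟨gs, hl, hgs, key⟩ := exists_coprimePre hp one_lt_two hpm hc1 (by omega) hU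
  obtain ⟨e, he⟩ := key _ (Or.inl rfl) 1 (by omega) 0 (by omega) fun g _ => by
    obtain ⟨t, ht, h⟩ := coprime_data hp one_lt_two hpm hc1 g
    interval_cases t
    · exact Or.inr h
    · exact Or.inl h
  exact ⟨_, (List.countP_le_length).trans hl.le, e, by convert he⟩

/-- Prefixes in `C_2^r ⊕ C_3` for sequences without involutions. -/
theorem exists_coprimePre_three {r : ℕ}
    {U : Multiset (GT (List.replicate r 2 ++ [3]))} (hU : AddSubgroup.closure {g | g ∈ U} = ⊤)
    (hinv : ∀ g ∈ U, g + g ≠ 0) :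
    ∃ n ≤ r, r ≤ 2 * n ∧ ∃ e : GT (List.replicate r 2 ++ [3]) ≃+ GT (List.replicate r 2 ++ [3]),
        ∀ x ∈ coprimePre 2 r n 1 2, ∃ g ∈ U, x = enc _ (e g) := by
  classical
  have hpm : Nat.Coprime 2 3 := by decide
  have h6 : ∀ x : GT (List.replicate r 2 ++ [3]), 6 • x = 0 := GT.smul_eq_zero fun k hk => by
      rcases List.mem_append.1 hk with hk | hk
      · rw [List.eq_of_mem_replicate hk]; decide
      · rw [List.mem_singleton.1 hk]; decide
  obtain ⟨gs, hl, hgs, key⟩ := exists_coprimePre Nat.prime_two (by omega) hpm (c := 3) rfl (dvd_refl 3) hU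
  set f := lastGen 2 3 r with hf
  have hf3 : 3 • f = 0 := smul_lastGen r
  have h2 : ∀ g ∈ gs, g = 3 • g + 1 • f ∨ g = 3 • g + 2 • f := by
    intro g hg
    obtain ⟨t, ht, h⟩ := coprime_data Nat.prime_two (by omega : 1 < 3) hpm (c := 3) rfl g
    interval_cases t
    · refine absurd ?_ (hinv g (hgs g hg))
      rw [zero_smul, add_zero] at h
      rw [← two_nsmul, h, ← mul_nsmul']
      exact h6 g
    · exact Or.inl h
    · exact Or.inr h
  have hneg : ∀ g : GT (List.replicate r 2 ++ [3]), g = 3 • g + 1 • -f ↔ g = 3 • g + 2 • f := by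
    intro g
    have : (1 : ℕ) • -f = 2 • f := by
      rw [one_smul, neg_eq_iff_add_eq_zero, ← succ_nsmul', hf3]
    rw [this]
  have hneg' : ∀ g : GT (List.replicate r 2 ++ [3]), g = 3 • g + 2 • -f ↔ g = 3 • g + 1 • f := by
    intro g
    have : (2 : ℕ) • -f = 1 • f := by
      rw [smul_neg, neg_eq_iff_add_eq_zero, ← add_nsmul, hf3]
    rw [this]
  have hcount : r ≤ gs.countP (fun g => g = 3 • g + 1 • f) + gs.countP (fun g => g = 3 • g + 1 • -f) := by
    refine hl.ge.trans ?_
    rw [List.length_eq_countP_add_countP (fun g => decide (g = 3 • g + 1 • f))]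
    refine Nat.add_le_add_left (List.countP_mono_left fun g hg h => ?_) _
    simp only [decide_eq_true_eq] at h ⊢
    exact (hneg g).2 ((h2 g hg).resolve_left h)
  have hle : ∀ P : GT (List.replicate r 2 ++ [3]) → Bool, gs.countP P ≤ r := fun P => List.countP_le_length.trans hl.le
  by_cases h : r ≤ 2 * gs.countP (fun g => g = 3 • g + 1 • f)
  · obtain ⟨e, he⟩ := key f (Or.inl rfl) 1 (by omega) 2 (by omega) h2
    exact ⟨_, hle _, h, e, by convert he⟩
  · obtain ⟨e, he⟩ := key (-f) (Or.inr rfl) 1 (by omega) 2 (by omega) fun g hg => by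
      rw [hneg, hneg']; exact (h2 g hg).symm
    refine ⟨_, hle _, ?_, e, by convert he⟩
    omega

end SetsOfLengths

namespace SetsOfLengths

theorem exists_equiv_pair {a b : ℕ} (ha : 0 < a) (hb : 1 < b) (hab : a ∣ b) {h u : GT [a, b]} (hh : a • h = 0)
    (hspan : ∀ x : GT [a, b], ∃ s t : ℕ, x = s • h + t • u) : ∃ e : GT [a, b] ≃+ GT [a, b],
    a = enc _ (e u) := by
  have hpos : PosMod [a, b] := by
    intro x hx
    simp only [List.mem_cons, List.not_mem_nil, or_false] at hx
    omega
  have hu : b • u = 0 := GT.smul_eq_zero (fun m hm => by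
    simp only [List.mem_cons, List.not_mem_nil, or_false] at hm
    rcases hm with rfl | rfl
    · exact hab
    · exact dvd_rfl) u
  obtain ⟨e, he⟩ := exists_equiv (l := [a, b]) (gs := [h, u])
    (List.Forall₂.cons ⟨ha, hh⟩ (List.Forall₂.cons ⟨by omega, hu⟩ List.Forall₂.nil)) (fun x => by
      obtain ⟨s, t, rfl⟩ := hspan x
      exact add_mem (nsmul_mem (AddSubgroup.subset_closure (by simp)) _)
        (nsmul_mem (AddSubgroup.subset_closure (by simp)) _)) (GT.card_eq hpos)
  have h1 := he (dec [a, b] a)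
  rw [comb_dec_cons ha, Nat.mod_self, Nat.div_self ha, zero_smul, zero_add] at h1
  have h2 := comb_dec_cons (m := b) (by omega) [] u [] 1
  rw [h2, Nat.mod_eq_of_lt hb, one_smul] at h1
  refine ⟨e.symm, ?_⟩
  have h3 : e.symm u = dec [a, b] a := by
    rw [AddEquiv.symm_apply_eq, h1]
    exact (add_zero u).symm
  rw [h3, enc_dec hpos]
  simp only [List.foldr_cons, List.foldr_nil]
  nlinarith

theorem smul_eq_zero_of_closure {G : Type*} [AddCommGroup G] {U : Set G}
    (hU : AddSubgroup.closure U = ⊤) {n : ℕ}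
    (h : ∀ u ∈ U, n • u = 0) (x : G) : n • x = 0 := by
  have : x ∈ AddSubgroup.closure U := hU ▸ AddSubgroup.mem_top x
  induction this using AddSubgroup.closure_induction with
  | mem x hx => exact h x hx
  | zero => exact smul_zero _
  | add x y _ _ hx hy => rw [smul_add, hx, hy, add_zero]
  | neg x _ hx => rw [smul_neg, hx, neg_zero]

theorem exists_not_torsion {G : Type*} [AddCommGroup G] {U : Multiset G} (hU : Atom U)
    (hgen : AddSubgroup.closure {g | g ∈ U} = ⊤) {a b : ℕ} (hab : a.Coprime b) {x y : G}
    (hx : a • x ≠ 0) (hy : b • y ≠ 0) :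
    ∃ u ∈ U, a • u ≠ 0 ∧ b • u ≠ 0 := by
  classical
  by_contra! hcon
  have hs : ∀ (n : ℕ) (A : Multiset G), (∀ u ∈ A, n • u = 0) → n • A.sum = 0 := by
    intro n A hA
    induction A using Multiset.induction with
    | empty => exact smul_zero n
    | cons u A ih =>
      rw [Multiset.sum_cons, smul_add, hA u (by simp), ih fun u hu => hA u
          (Multiset.mem_cons_of_mem hu), add_zero]
  have hAB := Multiset.filter_add_not (fun u => a • u = 0) U
  set A := U.filter fun u => a • u = 0 with hA
  set B := U.filter fun u => ¬ a • u = 0 with hB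
  have h1 : a • A.sum = 0 := hs a A fun u hu => (Multiset.mem_filter.1 hu).2
  have h2 : b • B.sum = 0 := hs b B fun u hu => hcon u (Multiset.mem_filter.1 hu).1
      (Multiset.mem_filter.1 hu).2
  have h3 : A.sum + B.sum = 0 := by rw [← Multiset.sum_add, hAB, hU.2.1]
  have h4 : b • A.sum = 0 := by rw [eq_neg_of_add_eq_zero_left h3, smul_neg, h2, neg_zero]
  have h5 : A.sum = 0 := by
    rw [← AddMonoid.addOrderOf_eq_one_iff]
    exact Nat.eq_one_of_dvd_one (hab ▸ Nat.dvd_gcd (addOrderOf_dvd_of_nsmul_eq_zero h1)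
        (addOrderOf_dvd_of_nsmul_eq_zero h4))
  by_cases hA0 : A = 0
  · refine hy (smul_eq_zero_of_closure hgen (fun u hu => hcon u hu fun h => ?_) y)
    have : u ∈ A := Multiset.mem_filter.2 ⟨hu, h⟩
    rw [hA0] at this
    exact Multiset.notMem_zero _ this
  · have hAU := hU.2.2 A (Multiset.filter_le _ _) hA0 h5
    refine hx (smul_eq_zero_of_closure hgen (fun u (hu : u ∈ U) => ?_) x)
    rw [← hAU] at hu
    exact (Multiset.mem_filter.1 hu).2

theorem exists_prefix_unit {a b p : ℕ} (ha : 0 < a) (hb : b = p * a) (hp : 1 < p) {U : Multiset (GT [a, b])}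
    (hU : AddSubgroup.closure {g | g ∈ U} = ⊤) (hunit : ∀ y : ZMod b, a • y ≠ 0 → IsUnit y) :
    ∃ e : GT [a, b] ≃+ GT [a, b], ∀ c ∈ [a], ∃ u ∈ U, c = enc _ (e u) := by
  obtain ⟨u, hu, hau⟩ : ∃ u ∈ U, a • u ≠ 0 := by
    by_contra! h
    have h1 : a • ((1 : ZMod b)) = 0 :=
      congrArg (fun x => x.2.1) (smul_eq_zero_of_closure hU h ((0 : ZMod a), (1 : ZMod b), PUnit.unit))
    rw [nsmul_eq_mul, mul_one, ZMod.natCast_eq_zero_iff] at h1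
    have := Nat.le_of_dvd ha h1
    nlinarith
  have h1 : IsUnit (u.2.1 : ZMod b) := hunit _ fun h => hau
      (Prod.ext (ZModModule.char_nsmul_eq_zero a (u.1 : ZMod a)) (Prod.ext h rfl))
  have : NeZero a := ⟨ha.ne'⟩
  have : NeZero b := ⟨by rw [hb]; positivity⟩
  obtain ⟨w, hw⟩ := h1.exists_left_inv
  obtain ⟨e, he⟩ := exists_equiv_pair (a := a) (b := b) (u := u)
      (h := ((1 : ZMod a), (0 : ZMod b), PUnit.unit)) ha (by nlinarith)
    ⟨p, by rw [hb, mul_comm]⟩ (Prod.ext (ZModModule.char_nsmul_eq_zero a (1 : ZMod a)) (Prod.ext (smul_zero (A := ZMod b) a) rfl)) (by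
      intro x
      set t := ((x.2.1 : ZMod b) * w).val with ht
      refine ⟨((x.1 : ZMod a) - t • (u.1 : ZMod a)).val, t, Prod.ext ?_ (Prod.ext ?_ rfl)⟩
      · change (x.1 : ZMod a) = ((x.1 : ZMod a) - t • (u.1 : ZMod a)).val • (1 : ZMod a) + t • (u.1 : ZMod a)
        rw [nsmul_eq_mul, mul_one, ZMod.natCast_zmod_val, sub_add_cancel]
      · change (x.2.1 : ZMod b) = ((x.1 : ZMod a) - t • (u.1 : ZMod a)).val • (0 : ZMod b) + t • (u.2.1 : ZMod b)
        rw [smul_zero, zero_add, nsmul_eq_mul, ht, ZMod.natCast_zmod_val, mul_assoc, hw, mul_one])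
  exact ⟨e, fun c hc => ⟨u, hu, by rw [List.mem_singleton.1 hc]; exact he⟩⟩

theorem exists_complement_six : ∀ a b : ZMod 6, (2 • a ≠ 0 ∨ 2 • b ≠ 0) → (3 • a ≠ 0 ∨ 3 • b ≠ 0) →
    ∃ c d : ZMod 6, c * b - d * a = 1 := by
  decide

theorem exists_prefix_six {U : Multiset (GT [6, 6])} (hU : Atom U) (hgen : AddSubgroup.closure
    {g | g ∈ U} = ⊤) :
    ∃ e : GT [6, 6] ≃+ GT [6, 6], ∀ c ∈ [6], ∃ u ∈ U, c = enc _ (e u) := by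
  have h0 : ∀ n < 6, n ≠ 0 → n • (((1 : ZMod 6), (0 : ZMod 6),
      PUnit.unit) : ZMod 6 × ZMod 6 × PUnit) ≠ 0 := by
    intro n hn hn0 h
    have h1 : n • (1 : ZMod 6) = 0 := congrArg Prod.fst h
    rw [nsmul_eq_mul, mul_one, ZMod.natCast_eq_zero_iff] at h1
    exact absurd (Nat.le_of_dvd (by omega) h1) (by omega)
  obtain ⟨u, hu, h2, h3⟩ := exists_not_torsion hU hgen (a := 2) (b := 3) (by decide)
      (h0 2 (by omega) (by omega)) (h0 3 (by omega) (by omega))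
  have key : ∀ n : ℕ, n • u ≠ 0 → (n • (u.1 : ZMod 6) ≠ 0 ∨ n • (u.2.1 : ZMod 6) ≠ 0) := by
    intro n hn
    by_contra! h
    exact hn (Prod.ext h.1 (Prod.ext h.2 rfl))
  obtain ⟨c, d, hcd⟩ := exists_complement_six _ _ (key 2 h2) (key 3 h3)
  obtain ⟨e, he⟩ := exists_equiv_pair (a := 6) (b := 6) (u := u) (h := (c, d, PUnit.unit))
      (by omega) (by omega) dvd_rfl
    (GT.smul_eq_zero (n := 6) (l := [6, 6]) (by simp) _) (by
      intro x
      set a : ZMod 6 := u.1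
      set b : ZMod 6 := u.2.1
      set x₁ : ZMod 6 := x.1
      set x₂ : ZMod 6 := x.2.1
      refine ⟨(x₁ * b - x₂ * a).val, (c * x₂ - d * x₁).val, Prod.ext ?_ (Prod.ext ?_ rfl)⟩
      · change x₁ = (x₁ * b - x₂ * a).val • c + (c * x₂ - d * x₁).val • a
        rw [nsmul_eq_mul, nsmul_eq_mul, ZMod.natCast_zmod_val, ZMod.natCast_zmod_val]
        linear_combination -x₁ * hcd
      · change x₂ = (x₁ * b - x₂ * a).val • d + (c * x₂ - d * x₁).val • b
        rw [nsmul_eq_mul, nsmul_eq_mul, ZMod.natCast_zmod_val, ZMod.natCast_zmod_val]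
        linear_combination -x₂ * hcd)
  exact ⟨e, fun c hc => ⟨u, hu, by rw [List.mem_singleton.1 hc]; exact he⟩⟩

end SetsOfLengths

namespace SetsOfLengths
variable {G : Type*} [AddCommGroup G]

theorem exists_lift {α β : Type*} (f : α → β) (F : Multiset (Multiset β)) : ∀ V : Multiset α,
    F.sum = V.map f →
    ∃ F' : Multiset (Multiset α), F'.map (Multiset.map f) = F ∧ F'.sum = V := by
  induction F using Multiset.induction with
  | empty =>
    intro V h
    rw [Multiset.sum_zero, eq_comm, Multiset.map_eq_zero] at h
    exact ⟨0, rfl, h.symm⟩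
  | cons A F ih =>
    intro V h
    rw [Multiset.sum_cons] at h
    obtain ⟨A', B', rfl, rfl, hB⟩ := map_eq_add h.symm
    obtain ⟨F', rfl, rfl⟩ := ih B' hB.symm
    exact ⟨A' ::ₘ F', by simp, by simp⟩

section Std
variable {r : ℕ} (n : Fin r → ℕ) (e : Fin r → G)

/-- Values of the labels of the standard sequence: a basis and its sum. -/
def stdVal (x : Option (Fin r)) : G := x.elim (∑ i, e i) e

/-- Signed values. -/
def sgnVal (x : Option (Fin r) × Bool) : G := if x.2 then stdVal e x.1 else -stdVal e x.1

/-- Labels of the standard sequence. -/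
def stdLab : Multiset (Option (Fin r)) := none ::ₘ ∑ i, Multiset.replicate (n i - 1) (some i)

/-- The labels of `U (-U)`. -/
def symLab : Multiset (Option (Fin r) × Bool) := (stdLab n).map (·, true) + (stdLab n).map (·, false)

theorem count_stdLab_none : (stdLab n).count none = 1 := by
  rw [stdLab, Multiset.count_cons_self, Multiset.count_sum']
  simp [Multiset.count_replicate]

theorem count_stdLab_some (i : Fin r) : (stdLab n).count (some i) = n i - 1 := by
  rw [stdLab, Multiset.count_cons_of_ne (by simp), Multiset.count_sum']
  simp [Multiset.count_replicate]

theorem count_symLab (x : Option (Fin r)) (b : Bool) : (symLab n).count (x, b) = (stdLab n).count x := by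
  have h1 : ∀ c : Bool, ((stdLab n).map (·, c)).count (x, b) = if b = c then (stdLab n).count x else 0 := by
    intro c
    split_ifs with h
    · subst h
      exact Multiset.count_map_eq_count' _ _ (fun x y h => (Prod.ext_iff.1 h).1) x
    · refine Multiset.count_eq_zero_of_notMem fun hx => ?_
      obtain ⟨y, -, hy⟩ := Multiset.mem_map.1 hx
      exact h (Prod.ext_iff.1 hy).2.symm
  rw [symLab, Multiset.count_add, h1, h1]
  cases b <;> simp

theorem card_stdLab : (stdLab n).card = 1 + ∑ i, (n i - 1) := by
  rw [stdLab, Multiset.card_cons, add_comm, Multiset.card_sum]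
  simp

theorem sum_eq_sum_count {α : Type*} [Fintype α] [DecidableEq α] (W : Multiset α) (f : α → G) :
    (W.map f).sum = ∑ x, W.count x • f x := by
  induction W using Multiset.induction with
  | empty => simp
  | cons a W ih =>
    simp only [Multiset.map_cons, Multiset.sum_cons, ih, Multiset.count_cons, add_smul,
        Finset.sum_add_distrib]
    rw [add_comm]
    simp [ite_smul]

theorem sum_stdVal (W : Multiset (Option (Fin r))) :
    (W.map (stdVal e)).sum = ∑ i, (((W.count none + W.count (some i) : ℕ) : ℤ)) • e i := by
  rw [sum_eq_sum_count, Fintype.sum_option]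
  simp only [stdVal, Option.elim, Finset.smul_sum, ← Finset.sum_add_distrib]
  refine Finset.sum_congr rfl fun i _ => ?_
  rw [natCast_zsmul, add_smul]

theorem sum_sgnVal (W : Multiset (Option (Fin r) × Bool)) :
    (W.map (sgnVal e)).sum = ∑ i, (((W.count (none, true) + W.count (some i, true) : ℕ) : ℤ) -
      ((W.count (none, false) + W.count (some i, false) : ℕ) : ℤ)) • e i := by
  rw [sum_eq_sum_count, Fintype.sum_prod_type, Fintype.sum_option]
  simp only [Fintype.sum_bool, sgnVal, stdVal, Option.elim, if_true, Bool.false_eq_true, if_false,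
      Finset.smul_sum,
    ← Finset.sum_neg_distrib, ← Finset.sum_add_distrib]
  refine Finset.sum_congr rfl fun i _ => ?_
  simp only [sub_smul, natCast_zsmul, add_smul, smul_neg]
  abel

theorem card_eq_sum_count {α : Type*} [Fintype α] [DecidableEq α] (W : Multiset α) : W.card = ∑ x,
    W.count x :=
  (Multiset.sum_count_eq_card (s := Finset.univ) (by simp)).symm

/-- Independence of a family of elements. -/
def Indep : Prop := ∀ z : Fin r → ℤ, ∑ i, z i • e i = 0 → ∀ i, (n i : ℤ) ∣ z i

variable {n e}

theorem stdLab_sum (hn : ∀ i, 2 ≤ n i) (he : ∀ i, n i • e i = 0) : ((stdLab n).map (stdVal e)).sum = 0 := by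
  rw [sum_stdVal]
  refine Finset.sum_eq_zero fun i _ => ?_
  rw [count_stdLab_none, count_stdLab_some, natCast_zsmul,
      show 1 + (n i - 1) = n i by have := hn i; omega, he]

theorem atom_std (hn : ∀ i, 2 ≤ n i) (he : ∀ i, n i • e i = 0) (hI : Indep n e) : Atom
    ((stdLab n).map (stdVal e)) := by
  refine ⟨fun h => ?_, stdLab_sum hn he, fun B hB hB0 hs => ?_⟩
  · rw [Multiset.map_eq_zero] at h
    have := count_stdLab_none n
    rw [h] at this
    simp at this
  · obtain ⟨B, hle, rfl⟩ := le_map_iff.1 hB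
    rw [sum_stdVal] at hs
    have h1 := hI _ hs
    have h2 : ∀ x, B.count x ≤ (stdLab n).count x := fun x => Multiset.le_iff_count.1 hle x
    have h3 := h2 none
    rw [count_stdLab_none] at h3
    congr 1
    refine Multiset.ext.2 fun x => ?_
    have key : ∀ i, B.count none + B.count (some i) = 0 ∨ B.count none + B.count (some i) = n i := by
      intro i
      have h4 := h2 (some i)
      rw [count_stdLab_some] at h4
      have h5 := hn i
      obtain ⟨k, hk⟩ := Int.natCast_dvd_natCast.1 (h1 i)
      rcases Nat.lt_or_ge k 2 with h6 | h6
      · interval_cases k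
        · left; omega
        · right; omega
      · have := Nat.mul_le_mul_left (n i) h6
        omega
    rcases Nat.eq_zero_or_pos (B.count none) with h0 | h0
    · refine absurd ?_ hB0
      rw [Multiset.map_eq_zero]
      refine Multiset.ext.2 fun x => ?_
      rw [Multiset.count_zero]
      cases x with
      | none => exact h0
      | some i =>
        have h4 := h2 (some i)
        rw [count_stdLab_some] at h4
        have := key i
        have := hn i
        omega
    · cases x with
      | none => rw [count_stdLab_none]; omega
      | some i =>
        rw [count_stdLab_some]
        have := key i
        omega

theorem symLab_map : (symLab n).map (sgnVal e) = (stdLab n).map (stdVal e) +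
    ((stdLab n).map (stdVal e)).map Neg.neg := by
  rw [symLab, Multiset.map_add, Multiset.map_map, Multiset.map_map, Multiset.map_map]
  rfl

theorem pair_case {W : Multiset (Option (Fin r) × Bool)} (hW : Atom (W.map (sgnVal e))) {x : Option (Fin r)}
    (h1 : 0 < W.count (x, true)) (h2 : 0 < W.count (x, false)) : W = {(x, true), (x, false)} := by
  have hle : ({(x, true), (x, false)} : Multiset (Option (Fin r) × Bool)) ≤ W := by
    rw [Multiset.insert_eq_cons, Multiset.cons_le_of_notMem (by simp)]
    exact ⟨Multiset.count_pos.1 h1, by simpa using Multiset.count_pos.1 h2⟩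
  have := hW.2.2 _ (Multiset.map_le_map hle) (by simp) (by simp [sgnVal])
  refine (Multiset.eq_of_le_of_card_le hle ?_).symm
  have h3 := congrArg Multiset.card this
  rw [Multiset.card_map, Multiset.card_map] at h3
  exact h3.ge

theorem balanced_case (hI : Indep n e) (hn : ∀ i, 2 ≤ n i) {W : Multiset (Option (Fin r) × Bool)}
    (hle : W ≤ symLab n)
    (hW : Atom (W.map (sgnVal e))) (h : W.count (none, true) = W.count (none, false)) :
    ∃ x : Option (Fin r), W = {(x, true), (x, false)} := by
  by_cases h0 : W.count (none, true) = 0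
  · have hs := hW.2.1
    rw [sum_sgnVal] at hs
    have hz := hI _ hs
    have hab : ∀ i, W.count (some i, true) = W.count (some i, false) := by
      intro i
      have h1 := Multiset.le_iff_count.1 hle (some i, true)
      have h2 := Multiset.le_iff_count.1 hle (some i, false)
      rw [count_symLab, count_stdLab_some] at h1 h2
      have h3 := hn i
      have := Int.eq_zero_of_abs_lt_dvd (hz i) (by rw [abs_lt]; constructor <;> push_cast <;> omega)
      omega
    by_contra! hcon
    refine hW.1 (Multiset.map_eq_zero.2 (Multiset.eq_zero_iff_forall_notMem.2 ?_))
    rintro ⟨x, b⟩ hx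
    have h1 := Multiset.count_pos.2 hx
    cases x with
    | none => cases b <;> omega
    | some i =>
      have := hab i
      exact hcon (some i) (pair_case hW (by cases b <;> omega) (by cases b <;> omega))
  · exact ⟨none, pair_case hW (by omega) (by omega)⟩

theorem plus_case (hI : Indep n e) (hn : ∀ i, 2 ≤ n i) {W : Multiset (Option (Fin r) × Bool)}
    (hle : W ≤ symLab n)
    (hW : Atom (W.map (sgnVal e))) (s : Bool) (h1 : W.count (none, s) = 1)
    (h0 : W.count (none, !s) = 0) (i : Fin r) :
    W.count (some i, s) = 0 ∧ W.count (some i, !s) = 1 ∨ W.count (some i, s) = n i - 1 ∧ W.count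
    (some i, !s) = 0 := by
  have hs := hW.2.1
  rw [sum_sgnVal] at hs
  have hz := hI _ hs i
  have h2 := Multiset.le_iff_count.1 hle (some i, true)
  have h3 := Multiset.le_iff_count.1 hle (some i, false)
  rw [count_symLab, count_stdLab_some] at h2 h3
  have h4 := hn i
  have h5 : W.count (some i, true) = 0 ∨ W.count (some i, false) = 0 := by
    by_contra! hcon
    have := pair_case hW (Nat.pos_of_ne_zero hcon.1) (Nat.pos_of_ne_zero hcon.2)
    rw [this] at h1
    simp at h1
  obtain ⟨k, hk⟩ := hz
  have hk1 : k = -1 ∨ k = 0 ∨ k = 1 := by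
    have h6 : (n i : ℤ) * k < n i * 2 := by
      rw [← hk]; cases s <;> simp only [Bool.not_true, Bool.not_false] at h1 h0 <;> push_cast <;> omega
    have h7 : (n i : ℤ) * (-2) < n i * k := by
      rw [← hk]; cases s <;> simp only [Bool.not_true, Bool.not_false] at h1 h0 <;> push_cast <;> omega
    have h8 := lt_of_mul_lt_mul_left h6 (by omega)
    have h9 := lt_of_mul_lt_mul_left h7 (by omega)
    omega
  rcases hk1 with rfl | rfl | rfl <;> cases s <;> simp only [Bool.not_true, Bool.not_false] at h1 h0 ⊢ <;>
    push_cast at hk <;> omega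

theorem std_symLen (hI : Indep n e) (hn : ∀ i, 2 ≤ n i) {k : ℕ}
    (hk : k ∈ symLen ((stdLab n).map (stdVal e))) :
    k = 1 + ∑ i, (n i - 1) ∨ ∃ x : Fin r → ℕ, (∀ i, x i = 0 ∨ x i = n i - 2) ∧ k = 2 + ∑ i, x i := by
  obtain ⟨F, rfl, hF, hs⟩ := mem_lengthSet.1 hk
  rw [← symLab_map] at hs
  obtain ⟨F, rfl, hs'⟩ := exists_lift _ _ _ hs
  replace hs := hs'
  clear hs'
  rw [Multiset.card_map]
  have hA : ∀ W ∈ F, Atom (W.map (sgnVal e)) := fun W hW => hF _ (Multiset.mem_map_of_mem _ hW)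
  have hle : ∀ W ∈ F, W ≤ symLab n := fun W hW => hs ▸ Multiset.le_sum_of_mem hW
  have hpairs : ∀ F' : Multiset (Multiset (Option (Fin r) × Bool)),
      (∀ W ∈ F', ∃ x, W = {(x, true), (x, false)}) → ∃ X : Multiset (Option (Fin r)), X.card = F'.card ∧
        ∀ x b, F'.sum.count (x, b) = X.count x := by
    intro F'
    induction F' using Multiset.induction with
    | empty => exact fun _ => ⟨0, rfl, fun x b => by simp⟩
    | cons W F' ih =>
      intro h
      obtain ⟨X, h1, h2⟩ := ih fun W hW => h W (Multiset.mem_cons_of_mem hW)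
      obtain ⟨x, rfl⟩ := h W (Multiset.mem_cons_self _ _)
      refine ⟨x ::ₘ X, by simp [h1], fun y b => ?_⟩
      rw [Multiset.sum_cons, Multiset.count_add, h2, Multiset.count_cons, add_comm]
      congr 1
      cases b <;> simp [Multiset.count_cons, Multiset.count_singleton]
  by_cases hbal : ∀ W ∈ F, W.count (none, true) = W.count (none, false)
  · left
    obtain ⟨X, h1, h2⟩ := hpairs F fun W hW => balanced_case hI hn (hle W hW) (hA W hW) (hbal W hW)
    rw [← h1, ← card_stdLab]
    congr 1
    refine Multiset.ext.2 fun x => ?_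
    rw [← h2 x true, hs, count_symLab]
  · right
    push Not at hbal
    obtain ⟨W, hW, hne⟩ := hbal
    have hcle : ∀ W ∈ F, ∀ s, W.count (none, s) ≤ 1 := by
      intro W hW s
      have := Multiset.le_iff_count.1 (hle W hW) (none, s)
      rwa [count_symLab, count_stdLab_none] at this
    obtain ⟨s, hs1, hs0⟩ : ∃ s, W.count (none, s) = 1 ∧ W.count (none, !s) = 0 := by
      have h1 := hcle W hW true
      have h2 := hcle W hW false
      rcases Nat.eq_zero_or_pos (W.count (none, true)) with h | h
      · exact ⟨false, by omega, h⟩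
      · exact ⟨true, by omega, by simp only [Bool.not_true]; omega⟩
    obtain ⟨F₁, rfl⟩ := Multiset.exists_cons_of_mem hW
    rw [Multiset.sum_cons] at hs
    have hc1 : ∀ x b, W.count (x, b) + F₁.sum.count (x, b) = (stdLab n).count x := by
      intro x b
      rw [← Multiset.count_add, hs, count_symLab]
    have h1 := hc1 none (!s)
    rw [hs0, count_stdLab_none, zero_add] at h1
    obtain ⟨W', hW', hW'1⟩ := mem_sum_iff.1 (Multiset.count_pos.1 (by omega : 0 < F₁.sum.count (none, !s)))
    obtain ⟨F₂, rfl⟩ := Multiset.exists_cons_of_mem hW'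
    rw [Multiset.sum_cons] at hc1
    have h2 := hc1 none (!s)
    have h3 := hc1 none s
    rw [hs0, count_stdLab_none, Multiset.count_add] at h2
    rw [hs1, count_stdLab_none, Multiset.count_add] at h3
    have h4 := Multiset.count_pos.2 hW'1
    obtain ⟨X, hX1, hX2⟩ := hpairs F₂ fun V hV => by
      have hV' : V ∈ W ::ₘ W' ::ₘ F₂ := Multiset.mem_cons_of_mem (Multiset.mem_cons_of_mem hV)
      refine balanced_case hI hn (hle V hV') (hA V hV') ?_
      have h5 := Multiset.le_iff_count.1 (Multiset.le_sum_of_mem hV) (none, s)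
      have h6 := Multiset.le_iff_count.1 (Multiset.le_sum_of_mem hV) (none, !s)
      cases s <;> simp only [Bool.not_true, Bool.not_false] at * <;> omega
    refine ⟨fun i => X.count (some i), fun i => ?_, ?_⟩
    · have p1 := plus_case hI hn (hle W (by simp)) (hA W (by simp)) s hs1 hs0 i
      have p2 := plus_case hI hn (hle W' (by simp)) (hA W' (by simp)) (!s) (by omega)
          (by rw [Bool.not_not]; omega) i
      rw [Bool.not_not] at p2
      have q1 := hc1 (some i) s
      have q2 := hc1 (some i) (!s)
      rw [Multiset.count_add, hX2, count_stdLab_some] at q1 q2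
      have := hn i
      beta_reduce
      omega
    · rw [Multiset.card_cons, Multiset.card_cons, ← hX1, card_eq_sum_count X, Fintype.sum_option]
      rw [← hX2 none s]
      beta_reduce
      omega

end Std

/-- The standard basis of `GT l`. -/
def GT.basis : (l : List ℕ) → Fin l.length → GT l
  | [] => fun _ => 0
  | m :: l => Fin.cons ((1, 0) : ZMod m × GT l) fun i => ((0, GT.basis l i) : ZMod m × GT l)

theorem GT.smul_basis : ∀ (l : List ℕ) (i : Fin l.length), l.get i • GT.basis l i = 0
  | [], i => i.elim0
  | m :: l, i => by
    refine Fin.cases ?_ (fun i => ?_) i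
    · refine Prod.ext ?_ ?_
      · change m • (1 : ZMod m) = 0
        simp
      · exact smul_zero (A := GT l) m
    · refine Prod.ext ?_ ?_
      · exact smul_zero (A := ZMod m) (l.get i)
      · exact GT.smul_basis l i

theorem GT.sum_basis_cons (m : ℕ) (l : List ℕ) (z : Fin (m :: l).length → ℤ) :
    ∑ i, z i • GT.basis (m :: l) i =
      ((z 0 : ZMod m), ∑ i : Fin l.length, z i.succ • GT.basis l i) := by
  rw [show (∑ i, z i • GT.basis (m :: l) i) = z 0 • GT.basis (m :: l) 0 +
    ∑ i : Fin l.length, z i.succ • GT.basis (m :: l) i.succ from Fin.sum_univ_succ (n := l.length) _]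
  have h : ∀ s : Finset (Fin l.length), (∑ i ∈ s, z i.succ • GT.basis (m :: l) i.succ : GT (m :: l)) =
      ((0, ∑ i ∈ s, z i.succ • GT.basis l i) : ZMod m × GT l) := by
    intro s
    induction s using Finset.induction_on with
    | empty => rfl
    | insert a s ha ih =>
      rw [Finset.sum_insert ha, Finset.sum_insert ha, ih]
      refine Prod.ext ?_ ?_
      · change z a.succ • (0 : ZMod m) + 0 = 0
        simp
      · rfl
  rw [h]
  refine Prod.ext ?_ ?_
  · change z 0 • (1 : ZMod m) + 0 = _
    simp
  · change z 0 • (0 : GT l) + _ = _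
    rw [smul_zero, zero_add]

theorem GT.indep_basis : ∀ l : List ℕ, Indep l.get (GT.basis l)
  | [] => fun _ _ i => i.elim0
  | m :: l => fun z hz i => by
    rw [GT.sum_basis_cons] at hz
    refine Fin.cases ?_ (fun i => ?_) i
    · exact (ZMod.intCast_zmod_eq_zero_iff_dvd _ _).1 (congrArg Prod.fst hz)
    · exact GT.indep_basis l (fun i => z i.succ) (congrArg Prod.snd hz) i

/-- The sums of subfamilies of `(m - 2)`. -/
def subSums : List ℕ → List ℕ
  | [] => [0]
  | m :: l => subSums l ++ (subSums l).map (m - 2 + ·)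

theorem mem_subSums : ∀ (l : List ℕ) (x : Fin l.length → ℕ), (∀ i, x i = 0 ∨ x i = l.get i - 2) →
    ∑ i, x i ∈ subSums l
  | [], x, _ => by simp [subSums]
  | m :: l, x, h => by
    have h1 := mem_subSums l (fun i => x i.succ) fun i => h i.succ
    rw [show (∑ i, x i) = x 0 + ∑ i : Fin l.length, x i.succ from Fin.sum_univ_succ (n := l.length) _]
    rw [subSums, List.mem_append]
    rcases h 0 with h0 | h0
    · left
      rwa [h0, zero_add]
    · right
      rw [h0]
      exact List.mem_map_of_mem h1

/-- The natural lower bound for the Davenport constant. -/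
def dStar (l : List ℕ) : ℕ := 1 + (l.map (· - 1)).sum

theorem dStar_eq (l : List ℕ) : 1 + ∑ i : Fin l.length, (l.get i - 1) = dStar l := by
  rw [dStar]
  congr 1
  exact Fin.sum_univ_fun_getElem l (· - 1)

/-- `G` has an atom `U` of maximal length `D` such that all lengths of `U (-U)` lie in `p`. -/
def Squeezed (G : Type*) [AddCommGroup G] (D : ℕ) (p : List ℕ) : Prop :=
  ∃ U : Multiset G, MaxAtom U ∧ U.card = D ∧ ∀ k ∈ symLen U, k ∈ p

theorem exists_atom_dStar (l : List ℕ) (hl : ∀ m ∈ l, 2 ≤ m) :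
    ∃ U : Multiset (GT l), Atom U ∧ U.card = dStar l ∧ ∀ k ∈ symLen U,
    k = dStar l ∨ ∃ s ∈ subSums l, k = 2 + s := by
  have hn : ∀ i, 2 ≤ l.get i := fun i => hl _ (List.get_mem _ _)
  refine ⟨(stdLab l.get).map (stdVal (GT.basis l)), atom_std hn (GT.smul_basis l)
      (GT.indep_basis l), ?_, fun k hk => ?_⟩
  · rw [Multiset.card_map, card_stdLab, dStar_eq]
  · rcases std_symLen (GT.indep_basis l) hn hk with h | ⟨x, hx, h⟩
    · left
      rw [h, dStar_eq]
    · exact Or.inr ⟨_, mem_subSums l x hx, h⟩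

theorem squeezed_std {l : List ℕ} (hl : ∀ m ∈ l, 2 ≤ m) {D : ℕ} (hD : dStar l = D)
    (hmax : ∀ A : Multiset (GT l), Atom A → A.card ≤ D) :
    Squeezed (GT l) D (D :: (subSums l).map (2 + ·)) := by
  obtain ⟨U, h1, h2, h3⟩ := exists_atom_dStar l hl
  refine ⟨U, ⟨h1, fun A hA => (hmax A hA).trans (h2.trans hD).ge⟩, h2.trans hD, fun k hk => ?_⟩
  rcases h3 k hk with h | ⟨s, hs, h⟩
  · rw [h, hD]
    exact List.mem_cons_self
  · rw [h]
    exact List.mem_cons_of_mem _ (List.mem_map_of_mem hs)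
end SetsOfLengths

namespace SetsOfLengths

theorem ideal_sup_pow_eq_bot {R : Type*} [CommRing R] {I J : Ideal R} {a b : ℕ} (hI : I ^ (a + 1) = ⊥)
    (hJ : J ^ b = ⊥) : (I ⊔ J) ^ (b + a) = ⊥ := by
  rw [← Ideal.add_eq_sup, add_pow, ← Ideal.zero_eq_bot]
  refine Finset.sum_eq_zero fun m _ => ?_
  rcases Nat.lt_or_ge a m with h | h
  · rw [show m = a + 1 + (m - (a + 1)) by omega, pow_add, hI, ← Ideal.zero_eq_bot, zero_mul,
      zero_mul, zero_mul]
  · rw [show b + a - m = b + (a - m) by omega, pow_add J, hJ, ← Ideal.zero_eq_bot, zero_mul,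
      mul_zero, zero_mul]

/-- The augmentation ideal along a homomorphism. -/
def augIdeal {G R : Type*} [AddCommGroup G] [CommRing R] (φ : Multiplicative G →* R) : Ideal R :=
  Ideal.span (Set.range fun g : G => 1 - φ (Multiplicative.ofAdd g))

theorem augIdeal_pow {p : ℕ} [Fact p.Prime] {R : Type*} [CommRing R] [CharP R p] :
    ∀ (l : List ℕ) (_ : ∀ m ∈ l, ∃ k, m = p ^ k) (φ : Multiplicative (GT l) →* R), augIdeal φ ^ dStar l = ⊥
  | [], _, φ => by
    rw [show dStar [] = 1 from rfl, pow_one, augIdeal, Ideal.span_eq_bot]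
    rintro _ ⟨g, rfl⟩
    have : (Multiplicative.ofAdd g : Multiplicative (GT [])) = 1 := rfl
    simp [this]
  | m :: l, hl, φ => by
    obtain ⟨k, rfl⟩ := hl m List.mem_cons_self
    have hpos : 0 < p ^ k := pow_pos (Fact.out : p.Prime).pos k
    have : NeZero (p ^ k) := ⟨hpos.ne'⟩
    let inr : GT l →+ GT (p ^ k :: l) := AddMonoidHom.inr (ZMod (p ^ k)) (GT l)
    let g₁ : GT (p ^ k :: l) := ((1, 0) : ZMod (p ^ k) × GT l)
    have ih := augIdeal_pow l (fun m hm => hl m (List.mem_cons_of_mem _ hm)) (φ.comp inr.toMultiplicative)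
    have hx : (Ideal.span {1 - φ (Multiplicative.ofAdd g₁)}) ^ (p ^ k - 1 + 1) = ⊥ := by
      rw [Nat.sub_add_cancel hpos, Ideal.span_singleton_pow, Ideal.span_singleton_eq_bot,
          sub_pow_char_pow, one_pow,
        ← map_pow, ← ofAdd_nsmul, sub_eq_zero]
      have : p ^ k • g₁ = 0 := by
        refine Prod.ext ?_ ?_
        · change p ^ k • (1 : ZMod (p ^ k)) = 0
          rw [nsmul_one]
          exact ZMod.natCast_self _
        · exact smul_zero (A := GT l) (p ^ k)
      rw [this, ofAdd_zero, map_one]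
    have hle : augIdeal φ ≤ Ideal.span {1 - φ (Multiplicative.ofAdd g₁)} ⊔ augIdeal (φ.comp inr.toMultiplicative) := by
      rw [augIdeal, Ideal.span_le]
      rintro _ ⟨⟨a, h⟩, rfl⟩
      have h1 : ((a, h) : GT (p ^ k :: l)) = a.val • g₁ + inr h := by
        refine Prod.ext ?_ ?_
        · change a = a.val • (1 : ZMod (p ^ k)) + 0
          rw [add_zero, nsmul_one]
          exact (ZMod.natCast_zmod_val a).symm
        · change h = a.val • (0 : GT l) + h
          rw [smul_zero, zero_add]
      beta_reduce
      rw [h1, ofAdd_add, map_mul, ofAdd_nsmul, map_pow]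
      generalize φ (Multiplicative.ofAdd g₁) = x
      have h2 : φ (Multiplicative.ofAdd (inr h)) = (φ.comp inr.toMultiplicative) (Multiplicative.ofAdd h) := rfl
      rw [h2, show ∀ y : R, 1 - x ^ a.val * y = (1 - x ^ a.val) + x ^ a.val * (1 - y) from fun y => by ring]
      refine Submodule.add_mem_sup ?_ ?_
      · rw [Ideal.mem_span_singleton]
        have := sub_dvd_pow_sub_pow 1 x a.val
        rwa [one_pow] at this
      · exact Ideal.mul_mem_left _ _ (Ideal.subset_span ⟨h, rfl⟩)
    have h3 := ideal_sup_pow_eq_bot hx ih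
    have h4 : dStar (p ^ k :: l) = dStar l + (p ^ k - 1) := by
      simp only [dStar, List.map_cons, List.sum_cons]
      omega
    rw [h4]
    exact le_bot_iff.1 (h3 ▸ Ideal.pow_right_mono hle _)

theorem coeff_prod {G R : Type*} [AddCommGroup G] [DecidableEq G] [CommRing R] (S : Multiset G) :
    ∀ h : G, (¬ ∃ T ≤ S, T ≠ 0 ∧ T.sum = h) →
      ((S.map fun g => (1 - AddMonoidAlgebra.single g 1 :
    AddMonoidAlgebra R G)).prod).coeff h = if h = 0 then 1 else 0 := by
  induction S using Multiset.induction with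
  | empty =>
    intro h _
    rw [Multiset.map_zero, Multiset.prod_zero, AddMonoidAlgebra.one_def,
        AddMonoidAlgebra.coeff_single, Finsupp.single_apply]
    simp [eq_comm]
  | cons g S ih =>
    intro h hh
    rw [Multiset.map_cons, Multiset.prod_cons, sub_mul, one_mul]
    have h1 : h - g ≠ 0 := fun h0 => hh ⟨{g}, by simp, by simp, by simpa using (sub_eq_zero.1 h0).symm⟩
    have h2 := ih h fun ⟨T, hT, h3, h4⟩ => hh ⟨T, hT.trans (Multiset.le_cons_self _ _), h3, h4⟩
    have h3 := ih (h - g) fun ⟨T, hT, h3, h4⟩ => hh ⟨g ::ₘ T, (Multiset.cons_le_cons_iff _).2 hT,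
        by simp, by simp [h4]⟩
    rw [if_neg h1] at h3
    rw [AddMonoidAlgebra.coeff_sub, Finsupp.sub_apply, h2, AddMonoidAlgebra.coeff_single_mul_apply,
        neg_add_eq_sub, h3]
    simp

theorem card_le_dStar_of_prime_pow {p : ℕ} (hp : p.Prime) {l : List ℕ} (hl : ∀ m ∈ l, ∃ k, m = p ^ k)
    (A : Multiset (GT l)) (hA : Atom A) : A.card ≤ dStar l := by
  have : Fact p.Prime := ⟨hp⟩
  by_contra! hlt
  obtain ⟨g, S, rfl⟩ : ∃ g S, A = g ::ₘ S := by
    obtain ⟨g, hg⟩ := Multiset.exists_mem_of_ne_zero hA.1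
    exact ⟨g, Multiset.exists_cons_of_mem hg⟩
  have h1 := coeff_prod (R := ZMod p) S 0 (by
    rintro ⟨T, hT, h0, hs⟩
    have := hA.2.2 T (hT.trans (Multiset.le_cons_self _ _)) h0 hs
    have := Multiset.card_le_card hT
    subst T
    simp at this)
  have h2 : (S.map fun g => (1 - AddMonoidAlgebra.single g 1 : AddMonoidAlgebra (ZMod p) (GT l))).prod ∈
      augIdeal (AddMonoidAlgebra.of (ZMod p) (GT l)) ^ S.card := by
    have : ∀ S : Multiset (GT l), (S.map fun g => (1 - AddMonoidAlgebra.single g 1 : AddMonoidAlgebra (ZMod p) (GT l))).prod ∈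
      augIdeal (AddMonoidAlgebra.of (ZMod p) (GT l)) ^ S.card := by
      intro S
      induction S using Multiset.induction with
      | empty => simp
      | cons g S ih =>
        rw [Multiset.map_cons, Multiset.prod_cons, Multiset.card_cons, pow_succ']
        exact Ideal.mul_mem_mul (Ideal.subset_span ⟨g, rfl⟩) ih
    exact this S
  have : CharP (AddMonoidAlgebra (ZMod p) (GT l)) p := charP_of_injective_algebraMap
      (algebraMap (ZMod p) _).injective p
  rw [Multiset.card_cons] at hlt
  have h3 := Ideal.pow_le_pow_right (Nat.lt_succ_iff.1 hlt) h2
  rw [augIdeal_pow l hl, Ideal.mem_bot] at h3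
  rw [h3] at h1
  simp at h1

end SetsOfLengths

namespace SetsOfLengths
variable {G : Type*} [AddCommGroup G]

theorem le_of_mem_symLen {U : Multiset G} {k : ℕ} (hk : k ∈ symLen U) : k ≤ 2 * U.card := by
  obtain ⟨F, rfl, hF, hs⟩ := mem_lengthSet.1 hk
  have h1 := congrArg Multiset.card hs
  rw [card_sum', Multiset.card_add, Multiset.card_map] at h1
  have h2 := Multiset.card_nsmul_le_sum (s := F.map Multiset.card) (a := 1) (by
    intro x hx
    obtain ⟨A, hA, rfl⟩ := Multiset.mem_map.1 hx
    exact (hF A hA).card_pos)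
  rw [Multiset.card_map, smul_eq_mul] at h2
  omega

/-- Shorten an atom while keeping a given subsequence. -/
theorem Atom.exists_shorter_of_le {P : Multiset G} {n : ℕ} (hn : P.card + 1 ≤ n) : ∀ (k : ℕ)
    {U : Multiset G}, Atom U →
    P ≤ U → U.card = n + k → ∃ V : Multiset G, Atom V ∧ P ≤ V ∧ V.card = n
  | 0, U, hU, hP, hk => ⟨U, hU, hP, hk⟩
  | k + 1, U, hU, hP, hk => by
    obtain ⟨R, rfl⟩ := Multiset.le_iff_exists_add.1 hP
    rw [Multiset.card_add] at hk
    obtain ⟨x, hx⟩ := Multiset.card_pos_iff_exists_mem.1 (by omega : 0 < R.card)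
    obtain ⟨R, rfl⟩ := Multiset.exists_cons_of_mem hx
    rw [Multiset.card_cons] at hk
    obtain ⟨y, hy⟩ := Multiset.card_pos_iff_exists_mem.1 (by omega : 0 < R.card)
    obtain ⟨R, rfl⟩ := Multiset.exists_cons_of_mem hy
    rw [Multiset.card_cons] at hk
    refine Atom.exists_shorter_of_le hn k (U := (x + y) ::ₘ (P + R)) (Atom.merge ?_) ?_ ?_
    · convert hU using 1
      rw [Multiset.add_cons, Multiset.add_cons]
    · exact (Multiset.le_add_right _ _).trans (Multiset.le_cons_self _ _)
    · rw [Multiset.card_cons, Multiset.card_add]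
      omega

theorem exists_le_of_forall_exists {α β : Type*} (f : α → β) (U : Multiset α) : ∀ pre : List β,
    (∀ c ∈ pre, ∃ x ∈ U, c = f x) → ∃ P ≤ U, P.card ≤ pre.length ∧ ∀ c ∈ pre, ∃ x ∈ P, c = f x
  | [], _ => ⟨0, U.zero_le, by simp, by simp⟩
  | c :: pre, h => by
    obtain ⟨P, hP, h1, h2⟩ := exists_le_of_forall_exists f U pre fun c hc => h c (List.mem_cons_of_mem _ hc)
    obtain ⟨x, hx, rfl⟩ := h _ List.mem_cons_self
    by_cases hxP : x ∈ P
    · refine ⟨P, hP, by rw [List.length_cons]; omega, fun c hc => ?_⟩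
      rcases List.mem_cons.1 hc with rfl | hc
      · exact ⟨x, hxP, rfl⟩
      · exact h2 c hc
    · refine ⟨x ::ₘ P, (Multiset.cons_le_of_notMem hxP).2 ⟨hx, hP⟩, by simpa using h1, fun c hc => ?_⟩
      rcases List.mem_cons.1 hc with rfl | hc
      · exact ⟨x, Multiset.mem_cons_self _ _, rfl⟩
      · obtain ⟨y, hy, rfl⟩ := h2 c hc
        exact ⟨y, Multiset.mem_cons_of_mem hy, rfl⟩

theorem card_le_of_exclude {l : List ℕ} {n : ℕ} {pre ds : List ℕ} {inv : Bool}
    (hex : exclude l (n + 1) 0 [] pre ds inv = true) (hn : 0 < n) (hlen : pre.length ≤ n)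
    {U : Multiset G} (hU : Atom U)
    (e : G ≃+ GT l) (hpre : n < U.card → ∀ c ∈ pre, ∃ x ∈ U, c = enc l (e x))
    (hinv : inv = true → ∀ V : Multiset G, Atom V → V.card = n + 1 → ∀ x ∈ V, x + x ≠ 0) : U.card ≤ n := by
  by_contra! hlt
  obtain ⟨P, hP, h1, h2⟩ := exists_le_of_forall_exists (fun x => enc l (e x)) U pre (hpre hlt)
  obtain ⟨V, hV, hPV, hc⟩ := Atom.exists_shorter_of_le (P := P) (n := n + 1) (by omega)
      (U.card - (n + 1)) hU hP (by omega)
  refine false_of_exclude (p := List.range (2 * (n + 1) + 1)) hex (by omega) (by omega)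
      (by simp) hV hc (fun k hk => ?_) e
    (fun c hc => ?_) (fun h => hinv h V hV hc)
  · have := le_of_mem_symLen hk
    rw [List.mem_range]
    omega
  · obtain ⟨x, hx, h⟩ := h2 c hc
    exact ⟨x, Multiset.mem_of_le hPV hx, h⟩

theorem Atom.map_quotient {H : Type*} [AddCommGroup H] {f : G} {S : Multiset G}
    (hU : Atom (f ::ₘ S)) (hS : S ≠ 0) (π : G →+ H)
    (hπ : ∀ x, π x = 0 → x = 0 ∨ x = f) (hf : π f = 0) (hff : f + f = 0) : Atom (S.map π) := by
  refine ⟨by simpa using hS, ?_, fun B hB hB0 hs => ?_⟩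
  · rw [← map_multiset_sum]
    have := hU.2.1
    rw [Multiset.sum_cons] at this
    have h2 := congrArg π this
    rwa [map_add, hf, zero_add, map_zero] at h2
  · obtain ⟨T, hT, rfl⟩ := le_map_iff.1 hB
    rw [← map_multiset_sum] at hs
    rw [Ne, Multiset.map_eq_zero] at hB0
    rcases hπ _ hs with h | h
    · have := hU.2.2 T (hT.trans (Multiset.le_cons_self _ _)) hB0 h
      have h1 := Multiset.card_le_card hT
      rw [this, Multiset.card_cons] at h1
      omega
    · have := hU.2.2 (f ::ₘ T) ((Multiset.cons_le_cons_iff _).2 hT) (by simp)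
        (by rw [Multiset.sum_cons, h, hff])
      rw [(Multiset.cons_inj_right f).1 this]

/-- The quotient by an involution. -/
theorem exists_quotient_involution (l : List ℕ) (hl : ∀ x : GT l, x + x = 0 → x = 0) : ∀ (r : ℕ)
    (f : GT (List.replicate (r + 1) 2 ++ l)),
    f + f = 0 → f ≠ 0 → ∃ π : GT (List.replicate (r + 1) 2 ++ l) →+ GT (List.replicate r 2 ++ l),
      π f = 0 ∧ ∀ x, π x = 0 → x = 0 ∨ x = f := by
  have aux : ∀ (l' : List ℕ) (a : ZMod 2) (f : GT l'), f + f = 0 → a ≠ 0 → ∃ π : GT (2 :: l') →+ GT l',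
      π ((a, f) : ZMod 2 × GT l') = 0 ∧ ∀ x, π x = 0 → x = 0 ∨ x = ((a, f) : ZMod 2 × GT l') := by
    intro l' a f hf ha
    have hf2 : zmultiplesHom (GT l') f (2 : ℕ) = 0 := by
      simpa [two_smul] using hf
    let φ : ZMod 2 →+ GT l' := ZMod.lift 2 ⟨zmultiplesHom (GT l') f, hf2⟩
    have h1 : φ 1 = f := by
      have := ZMod.lift_coe 2 ⟨zmultiplesHom (GT l') f, hf2⟩ 1
      simpa using this
    have ha1 : ∀ a : ZMod 2, a ≠ 0 → a = 1 := by decide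
    rw [ha1 a ha]
    refine ⟨AddMonoidHom.snd (ZMod 2) (GT l') - φ.comp (AddMonoidHom.fst (ZMod 2) (GT l')), ?_, ?_⟩
    · change f - φ 1 = 0
      rw [h1, sub_self]
    · rintro ⟨b, x⟩ hx
      have hx' : x = φ b := sub_eq_zero.1 hx
      by_cases hb : b = 0
      · left
        rw [hx', hb, map_zero]
        rfl
      · right
        rw [hx', ha1 b hb, h1]
  intro r
  induction r with
  | zero =>
    rintro ⟨a, f⟩ hff hne
    refine aux l a f (congrArg Prod.snd hff) fun ha => hne ?_
    rw [ha, hl f (congrArg Prod.snd hff)]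
    rfl
  | succ r ih =>
    rintro ⟨a, f⟩ hff hne
    by_cases ha : a = 0
    · obtain ⟨π, h1, h2⟩ := ih f (congrArg Prod.snd hff) fun h => hne (by rw [ha, h]; rfl)
      refine ⟨AddMonoidHom.prodMap (AddMonoidHom.id (ZMod 2)) π, Prod.ext ha h1, ?_⟩
      rintro ⟨b, x⟩ hx
      have hb : b = 0 := congrArg Prod.fst hx
      rcases h2 x (congrArg Prod.snd hx) with h | h
      · left
        rw [hb, h]
        rfl
      · right
        rw [hb, h, ha]
    · exact aux _ a f (congrArg Prod.snd hff) ha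

theorem add_self_ne_zero {r n : ℕ} (hb : ∀ A : Multiset (GT (List.replicate r 2 ++ [3])), Atom A → A.card ≤ n)
    {V : Multiset (GT (List.replicate (r + 1) 2 ++ [3]))} (hV : Atom V) (hc : n + 1 < V.card) :
    ∀ x ∈ V, x + x ≠ 0 := by
  intro x hx hxx
  obtain ⟨S, rfl⟩ := Multiset.exists_cons_of_mem hx
  rw [Multiset.card_cons] at hc
  have hl : ∀ x : GT [3], x + x = 0 → x = 0 := by
    have : ∀ a : ZMod 3, a + a = 0 → a = 0 := by decide
    rintro ⟨a, ⟨⟩⟩ h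
    rw [this a (congrArg Prod.fst h)]
    rfl
  obtain ⟨π, h1, h2⟩ := exists_quotient_involution [3] hl r x hxx fun h =>
    hV.zero_notMem (by rw [Multiset.card_cons]; omega) (h ▸ hx)
  have h3 := hb _ (hV.map_quotient (by rintro rfl; simp at hc) π h2 h1 hxx)
  rw [Multiset.card_map] at h3
  omega

theorem exists_maxAtom [Finite G] : ∃ U : Multiset G, MaxAtom U := by
  have := Fintype.ofFinite G
  obtain ⟨U, h1, h2⟩ := exists_atom_card_eq_davenportC (G := G)
  exact ⟨U, h1, fun A hA => h2 ▸ hA.card_le_davenportC⟩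

theorem card_le_of_maxAtom [Finite G] {n : ℕ} (h : ∀ U : Multiset G, MaxAtom U → U.card ≤ n)
    (A : Multiset G) (hA : Atom A) :
    A.card ≤ n := by
  obtain ⟨U, hU⟩ := exists_maxAtom (G := G)
  exact (hU.2 A hA).trans (h U hU)

theorem card_le_of_exclude_three {r n : ℕ} {ds : List ℕ}
    (hex : ∀ k ∈ List.range (r + 2), r + 1 ≤ 2 * k → exclude (List.replicate (r + 1) 2 ++ [3])
    (n + 2) 0 [] (coprimePre 2 (r + 1) k 1 2) ds true = true)
    (hlen : ∀ k ∈ List.range (r + 2), (coprimePre 2 (r + 1) k 1 2).length ≤ n)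
    (hb : ∀ A : Multiset (GT (List.replicate r 2 ++ [3])), Atom A → A.card ≤ n)
    (A : Multiset (GT (List.replicate (r + 1) 2 ++ [3]))) (hA : Atom A) : A.card ≤ n + 1 := by
  have : Finite (GT (List.replicate (r + 1) 2 ++ [3])) := GT.finite (by
    intro a ha
    rcases List.mem_append.1 ha with h | h
    · rw [(List.mem_replicate.1 h).2]; omega
    · rw [List.mem_singleton.1 h]; omega)
  refine card_le_of_maxAtom (fun U hU => ?_) A hA
  by_contra! hlt
  obtain ⟨k, hk, hk2, e, he⟩ := exists_coprimePre_three hU.closure_eq_top (add_self_ne_zero hb hU.1 hlt)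
  have h := card_le_of_exclude (hex k (List.mem_range.2 (by omega)) hk2) (by omega)
    ((hlen k (List.mem_range.2 (by omega))).trans (by omega)) hU.1 e (fun _ => he)
    (fun _ V hV hc => add_self_ne_zero hb hV (by omega))
  omega

theorem card_le_two_six (A : Multiset (GT (List.replicate 1 2 ++ [3]))) (hA : Atom A) : A.card ≤ 6 :=
  card_le_of_exclude (l := List.replicate 1 2 ++ [3]) (pre := []) (ds := [6, 3, 2]) (inv := false)
      (by decide +kernel) (by omega)
    (by simp) hA (AddEquiv.refl _) (by simp) (by simp)

theorem card_le_two_two_six (A : Multiset (GT (List.replicate 2 2 ++ [3]))) (hA : Atom A) : A.card ≤ 7 :=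
  card_le_of_exclude (l := List.replicate 2 2 ++ [3]) (pre := []) (ds := [6, 3, 2]) (inv := false)
      (by decide +kernel) (by omega)
    (by simp) hA (AddEquiv.refl _) (by simp) (by simp)

theorem card_le_ten (A : Multiset (GT [10])) (hA : Atom A) : A.card ≤ 10 :=
  card_le_of_exclude (l := [10]) (pre := []) (ds := [10, 5, 2]) (inv := false) (by decide +kernel) (by omega)
    (by simp) hA (AddEquiv.refl _) (by simp) (by simp)

theorem card_le_two_two_two_six (A : Multiset (GT (List.replicate 3 2 ++ [3]))) (hA : Atom A) : A.card ≤ 8 :=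
  card_le_of_exclude_three (r := 2) (n := 7) (ds := [6, 3]) (by decide +kernel)
      (by decide) card_le_two_two_six A hA

theorem card_le_two_two_two_two_six (A : Multiset (GT (List.replicate 4 2 ++ [3]))) (hA : Atom A) :
    A.card ≤ 9 :=
  card_le_of_exclude_three (r := 3) (n := 8) (ds := [6, 3]) (by decide +kernel)
      (by decide) card_le_two_two_two_six A hA

end SetsOfLengths

namespace SetsOfLengths

theorem Atom.map_of_injOn {G H : Type*} [AddCommGroup G] [AddCommGroup H] {A : Multiset G}
    (hA : Atom A) (π : G →+ H)
    (hπ : ∀ T ≤ A, π T.sum = 0 → T.sum = 0) : Atom (A.map π) := by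
  refine ⟨by simpa using hA.1, by rw [← map_multiset_sum, hA.2.1, map_zero], fun B hB hB0 hs => ?_⟩
  obtain ⟨T, hT, rfl⟩ := le_map_iff.1 hB
  rw [← map_multiset_sum] at hs
  rw [hA.2.2 T hT (by simpa using hB0) (hπ T hT hs)]

/-- Pair up elements of a subsequence of an atom. -/
theorem Atom.exists_pairing {G : Type*} [AddCommGroup G] {P Q : G → Prop} (hPQ : ∀ x y, P x → P y →
    Q (x + y)) : ∀ (k : ℕ) {A B : Multiset G},
    Atom (A + B) → B.card = 2 * k → (∀ x ∈ A, Q x) → (∀ x ∈ B, P x) → ∃ V : Multiset G, Atom V ∧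
    V.card = A.card + k ∧ ∀ x ∈ V, Q x
  | 0, A, B, h, hB, hQ, _ => by
    rw [Multiset.card_eq_zero.1 hB, add_zero] at h
    exact ⟨A, h, rfl, hQ⟩
  | k + 1, A, B, h, hB, hQ, hP => by
    obtain ⟨x, hx⟩ := Multiset.card_pos_iff_exists_mem.1 (by omega : 0 < B.card)
    obtain ⟨B, rfl⟩ := Multiset.exists_cons_of_mem hx
    rw [Multiset.card_cons] at hB
    obtain ⟨y, hy⟩ := Multiset.card_pos_iff_exists_mem.1 (by omega : 0 < B.card)
    obtain ⟨B, rfl⟩ := Multiset.exists_cons_of_mem hy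
    rw [Multiset.card_cons] at hB
    have h1 : Atom ((x + y) ::ₘ A + B) := by
      rw [Multiset.cons_add]
      refine Atom.merge ?_
      rwa [Multiset.add_cons, Multiset.add_cons] at h
    obtain ⟨V, hV, h2, h3⟩ := Atom.exists_pairing hPQ k h1 (by omega) (by
      intro z hz
      rcases Multiset.mem_cons.1 hz with rfl | hz
      · exact hPQ x y (hP x (by simp)) (hP y (by simp))
      · exact hQ z hz) fun z hz => hP z (by simp [hz])
    exact ⟨V, hV, by rw [h2, Multiset.card_cons]; omega, h3⟩

theorem card_le_three_six (A : Multiset (GT (List.replicate 2 3 ++ [2]))) (hA : Atom A) : A.card ≤ 8 := by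
  have : Finite (GT (List.replicate 2 3 ++ [2])) := GT.finite (by decide)
  refine card_le_of_maxAtom (fun U hU => ?_) A hA
  obtain ⟨k, hk, e, he⟩ := exists_coprimePre_two Nat.prime_three rfl hU.closure_eq_top
  have hex : ∀ k ∈ List.range 3, exclude (List.replicate 2 3 ++ [2]) (8 + 1) 0 [] (coprimePre 3 2 k 1 0) [6, 3, 2] false = true ∧
      (coprimePre 3 2 k 1 0).length ≤ 8 := by decide +kernel
  have h := hex k (List.mem_range.2 (by omega))
  exact card_le_of_exclude h.1 (by omega) h.2 hU.1 e (fun _ => he) (by simp)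

/-- The component of order two. -/
def lastHom : GT [3, 3, 3, 2] →+ ZMod 2 where
  toFun x := x.2.2.2.1
  map_zero' := rfl
  map_add' _ _ := rfl

/-- The components of order three. -/
def initHom : GT [3, 3, 3, 2] →+ GT [3, 3, 3] where
  toFun x := (x.1, x.2.1, x.2.2.1, x.2.2.2.2)
  map_zero' := rfl
  map_add' _ _ := rfl

theorem eq_zero_of_lastHom {x : GT [3, 3, 3, 2]} (h1 : lastHom x = 0) (h2 : initHom x = 0) : x = 0 := by
  obtain ⟨a, b, c, d, e⟩ := x
  have h3 : a = 0 := congrArg (fun y : GT [3, 3, 3] => y.1) h2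
  have h4 : b = 0 := congrArg (fun y : GT [3, 3, 3] => y.2.1) h2
  have h5 : c = 0 := congrArg (fun y : GT [3, 3, 3] => y.2.2.1) h2
  have h6 : d = 0 := h1
  subst h3 h4 h5 h6
  rfl

theorem lastHom_of_lt {x : GT [3, 3, 3, 2]} (h : enc _ x < 27) : lastHom x = 0 := by
  obtain ⟨a, b, c, d, e⟩ := x
  change a.val + 3 * (b.val + 3 * (c.val + 3 * (d.val + 2 * 0))) < 27 at h
  exact (ZMod.val_eq_zero d).1 (by omega)

theorem card_filter_lastHom {V : Multiset (GT [3, 3, 3, 2])} (hV : Atom V) (hc : V.card = 11) :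
    (V.filter fun x => lastHom x = 0).card ≤ 3 := by
  have h1 := Multiset.filter_add_not (fun x => lastHom x = 0) V
  set A := V.filter fun x => lastHom x = 0
  set B := V.filter fun x => ¬ lastHom x = 0
  have hB : ∀ x ∈ B, lastHom x = 1 := fun x hx => by
    have : ∀ a : ZMod 2, a ≠ 0 → a = 1 := by decide
    exact this _ (Multiset.mem_filter.1 hx).2
  have hA : ∀ x ∈ A, lastHom x = 0 := fun x hx => (Multiset.mem_filter.1 hx).2
  have h2 : (B.card : ZMod 2) = 0 := by
    have h3 := congrArg lastHom hV.2.1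
    rw [← h1, map_multiset_sum, Multiset.map_add, Multiset.sum_add, Multiset.map_congr rfl hA,
        Multiset.map_congr rfl hB] at h3
    simpa using h3
  obtain ⟨k, hk⟩ := (ZMod.natCast_eq_zero_iff _ _).1 h2
  rw [← h1] at hV
  obtain ⟨W, hW, h4, h5⟩ := Atom.exists_pairing (P := fun x => lastHom x = 1) (Q := fun x => lastHom x = 0)
    (fun x y hx hy => by rw [map_add, hx, hy]; decide) k hV hk hA hB
  have h6 : ∀ T ≤ W, lastHom T.sum = 0 := by
    intro T hT
    rw [map_multiset_sum, Multiset.map_congr rfl fun x hx => h5 x (Multiset.mem_of_le hT hx)]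
    simp
  have h7 := card_le_dStar_of_prime_pow Nat.prime_three (l := [3, 3, 3]) (by
    intro m hm
    simp only [List.mem_cons, List.not_mem_nil, or_false, or_self] at hm
    exact ⟨1, by omega⟩) _ (hW.map_of_injOn initHom fun T hT h => eq_zero_of_lastHom (h6 T hT) h)
  rw [Multiset.card_map, h4] at h7
  rw [← h1, Multiset.card_add] at hc
  have : dStar [3, 3, 3] = 7 := rfl
  omega

/-- The search for atoms of length eleven with at most three elements of odd order. -/
noncomputable def threeThreeSixRun (pre : List ℕ) : Bool :=
  entriesOK [3, 3, 3, 2] 11 [] pre (codesByOrder [3, 3, 3, 2] (pre ++ List.range 27) [6, 2])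
    (codesByOrder [3, 3, 3, 2] (pre ++ List.range' 27 27) [3]) &&
  ((List.range 54).all fun c => c == 0 ||
    (pre ++ (codesByOrder [3, 3, 3, 2] (pre ++ List.range 27) [6, 2] ++ codesByOrder [3, 3, 3,
        2] (pre ++ List.range' 27 27) [3])).contains c) &&
  run [3, 3, 3, 2] 11 0 [] (entries pre (codesByOrder [3, 3, 3, 2] (pre ++ List.range 27) [6, 2])
    (codesByOrder [3, 3, 3, 2] (pre ++ List.range' 27 27) [3]) 8)

theorem false_of_threeThreeSixRun {pre : List ℕ} (h : threeThreeSixRun pre = true)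
    {V : Multiset (GT [3, 3, 3, 2])} (hV : Atom V)
    (hc : V.card = 11) (hpre : ∀ c ∈ pre, ∃ x ∈ V, c = enc _ x) : False := by
  simp only [threeThreeSixRun, Bool.and_eq_true, List.all_eq_true] at h
  obtain ⟨⟨h1, h2⟩, h3⟩ := h
  refine run_entries h1 h3 hV hc (fun A B _ _ _ => by simp) (by omega) hpre
      (fun x hx => ?_) fun W hW hW2 _ => ?_
  · have hlt := enc_lt (l := [3, 3, 3, 2]) (by decide) x
    have h4 := h2 (enc _ x) (List.mem_range.2 hlt)
    rw [Bool.or_eq_true, List.contains_iff_mem, beq_iff_eq] at h4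
    rcases h4 with h4 | h4
    · have h5 : x = 0 := enc_injective (l := [3, 3, 3, 2]) (by decide) (h4.trans (enc_zero _).symm)
      exact absurd (h5 ▸ hx) (hV.zero_notMem (by omega))
    · exact h4
  · have h5 : W ≤ V.filter fun x => lastHom x = 0 := by
      refine Multiset.le_filter.2 ⟨hW, fun x hx => lastHom_of_lt ?_⟩
      have h6 := hW2 x hx
      by_contra! hge
      have hlt : enc _ x < 54 := enc_lt (l := [3, 3, 3, 2]) (by decide) x
      rw [codesByOrder, List.mem_flatMap] at h6
      obtain ⟨d, -, h7⟩ := h6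
      have h8 := (List.mem_filter.1 h7).2
      rw [Bool.and_eq_true, Bool.not_eq_true', ← Bool.not_eq_true, List.contains_iff_mem] at h8
      exact h8.2 (List.mem_append_right _ (List.mem_range'_1.2 ⟨hge, hlt⟩))
    have := (Multiset.card_le_card h5).trans (card_filter_lastHom hV hc)
    omega

theorem card_le_three_three_six (A : Multiset (GT (List.replicate 3 3 ++ [2]))) (hA : Atom A) :
    A.card ≤ 10 := by
  have : Finite (GT (List.replicate 3 3 ++ [2])) := GT.finite (by decide)
  refine card_le_of_maxAtom (fun U hU => ?_) A hA
  by_contra! hlt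
  obtain ⟨k, hk, e, he⟩ := exists_coprimePre_two Nat.prime_three rfl hU.closure_eq_top
  have hex : ∀ k ∈ List.range 4, threeThreeSixRun (coprimePre 3 3 k 1 0) = true ∧ (coprimePre 3 3 k 1 0).length ≤ 3 := by
    decide +kernel
  have h := hex k (List.mem_range.2 (by omega))
  obtain ⟨P, hP, h1, h2⟩ := exists_le_of_forall_exists (fun x => enc _ (e x)) U _ he
  obtain ⟨V, hV, hPV, hc⟩ := Atom.exists_shorter_of_le (P := P) (n := 11) (by omega)
      (U.card - 11) hU.1 hP (by omega)
  refine false_of_threeThreeSixRun h.1 (hV.map (f := e.toAddMonoidHom) e.injective)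
      (by rw [Multiset.card_map, hc]) fun c hc => ?_
  obtain ⟨x, hx, rfl⟩ := h2 c hc
  exact ⟨e x, Multiset.mem_map_of_mem _ (Multiset.mem_of_le hPV hx), rfl⟩

end SetsOfLengths

namespace SetsOfLengths

theorem GT.nonempty_cons {l l' : List ℕ} (m : ℕ) (h : Nonempty (GT l ≃+ GT l')) :
    Nonempty (GT (m :: l) ≃+ GT (m :: l')) :=
  h.map fun e => ((AddEquiv.refl (ZMod m)).prodCongr e : ZMod m × GT l ≃+ ZMod m × GT l')

theorem GT.nonempty_of_perm {l l' : List ℕ} (h : l.Perm l') : Nonempty (GT l ≃+ GT l') := by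
  induction h with
  | nil => exact ⟨AddEquiv.refl _⟩
  | cons m _ ih => exact GT.nonempty_cons m ih
  | swap a b l =>
    exact ⟨((AddEquiv.prodAssoc (M := ZMod b) (N := ZMod a) (P := GT l)).symm.trans
      ((AddEquiv.prodComm (M := ZMod b) (N := ZMod a)).prodCongr (AddEquiv.refl (GT l)))).trans
      (AddEquiv.prodAssoc (M := ZMod a) (N := ZMod b) (P := GT l))⟩
  | trans _ _ ih₁ ih₂ => obtain ⟨e₁⟩ := ih₁; obtain ⟨e₂⟩ := ih₂; exact ⟨e₁.trans e₂⟩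

theorem GT.nonempty_mul {a b : ℕ} (h : a.Coprime b) (l : List ℕ) :
    Nonempty (GT ((a * b) :: l) ≃+ GT (a :: b :: l)) :=
  ⟨((ZMod.chineseRemainder h).toAddEquiv.prodCongr (AddEquiv.refl (GT l))).trans
    (AddEquiv.prodAssoc (M := ZMod a) (N := ZMod b) (P := GT l))⟩

theorem GT.exists_equiv_pi : ∀ (k : ℕ) (n : Fin k → ℕ), Nonempty ((∀ i, ZMod (n i)) ≃+ GT (List.ofFn n))
  | 0, n => by
    rw [List.ofFn_zero]
    exact ⟨{ toFun := fun _ => PUnit.unit, invFun := fun _ i => i.elim0,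
             left_inv := fun x => funext fun i => i.elim0, right_inv := fun _ => rfl, map_add' := fun _ _ => rfl }⟩
  | k + 1, n => by
    rw [List.ofFn_succ]
    obtain ⟨e⟩ := GT.exists_equiv_pi k fun i => n i.succ
    exact ⟨{ toFun := fun x => ((x 0, e fun i => x i.succ) : ZMod (n 0) × GT _)
             invFun := fun y => Fin.cons (α := fun i => ZMod (n i)) y.1 (e.symm y.2)
             left_inv := fun x => by
              funext i
              refine Fin.cases ?_ (fun i => ?_) i
              · rfl
              · simp
             right_inv := fun y => Prod.ext rfl (by simp)
             map_add' := fun x y => Prod.ext rfl (e.map_add (fun i => x i.succ) fun i => y i.succ) }⟩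

theorem exists_equiv_GT (G : Type*) [AddCommGroup G] [Finite G] :
    ∃ l : List ℕ, (∀ m ∈ l, 2 ≤ m) ∧ Nonempty (G ≃+ GT l) := by
  classical
  obtain ⟨ι, _, n, hn, ⟨e⟩⟩ := AddCommGroup.equiv_directSum_zmod_of_finite' G
  obtain ⟨e'⟩ := GT.exists_equiv_pi (Fintype.card ι) fun i => n ((Fintype.equivFin ι).symm i)
  refine ⟨_, ?_, ⟨((e.trans (DirectSum.addEquivProd fun i => ZMod (n i))).trans ?_).trans e'⟩⟩
  · intro m hm
    obtain ⟨i, rfl⟩ := List.mem_ofFn.1 hm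
    exact hn _
  · exact { toFun := fun x i => x ((Fintype.equivFin ι).symm i)
            invFun := fun y i => cast (by simp) (y (Fintype.equivFin ι i))
            left_inv := fun x => by
              funext i
              have h : ∀ j, j = i → HEq (x j) (x i) := by
                rintro _ rfl
                rfl
              exact eq_of_heq ((cast_heq _ _).trans (h _ (Equiv.symm_apply_apply _ _)))
            right_inv := fun y => by
              funext i
              refine eq_of_heq ((cast_heq _ _).trans ?_)
              rw [Equiv.apply_symm_apply]
            map_add' := fun _ _ => rfl }

/-- Lists with entries in `[2, k + 1]` whose sum of entries minus length is at most `n`. -/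
def parts : ℕ → ℕ → List (List ℕ)
  | 0, _ => [[]]
  | k + 1, n => (List.range (n / (k + 1) + 1)).flatMap fun c =>
      (parts k (n - c * (k + 1))).map (List.replicate c (k + 2) ++ ·)

theorem exists_perm_parts : ∀ (k n : ℕ) (l : List ℕ), (∀ m ∈ l, 2 ≤ m ∧ m ≤ k + 1) → (l.map (· - 1)).sum ≤ n →
    ∃ l' ∈ parts k n, l.Perm l'
  | 0, n, l, h, _ => by
    obtain rfl : l = [] := List.eq_nil_iff_forall_not_mem.2 fun m hm => by have := h m hm; omega
    exact ⟨[], by simp [parts], List.Perm.refl _⟩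
  | k + 1, n, l, h, hn => by
    have hp := (List.filter_append_perm (fun x => decide (x = k + 2)) l).symm
    have hr : l.filter (fun x => decide (x = k + 2)) = List.replicate
        (l.filter (fun x => decide (x = k + 2))).length (k + 2) :=
      List.eq_replicate_of_mem fun x hx => by simpa using (List.mem_filter.1 hx).2
    set c := (l.filter (fun x => decide (x = k + 2))).length with hc
    rw [hr] at hp
    have hs := (hp.map (· - 1)).sum_eq
    rw [List.map_append, List.sum_append, List.map_replicate, List.sum_replicate, smul_eq_mul] at hs
    have e1 : k + 2 - 1 = k + 1 := rfl
    rw [e1] at hs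
    obtain ⟨l', hl', hp'⟩ := exists_perm_parts k (n - c * (k + 1)) (l.filter (fun x => !decide (x = k + 2)))
      (fun m hm => by
        obtain ⟨h1, h2⟩ := List.mem_filter.1 hm
        have := h m h1
        have : m ≠ k + 2 := by simpa using h2
        omega) (by omega)
    refine ⟨List.replicate c (k + 2) ++ l', List.mem_flatMap.2 ⟨c, List.mem_range.2 ?_,
        List.mem_map.2 ⟨l', hl', rfl⟩⟩,
      hp.trans (hp'.append_left _)⟩
    rw [Nat.lt_succ_iff, Nat.le_div_iff_mul_le (Nat.succ_pos k), Nat.succ_eq_add_one]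
    omega

/-- Candidates for lists with maximal `dStar` among the lists of a given group. -/
def goodLists : List (List ℕ) :=
  (parts 10 10).filter fun l => decide (l.Pairwise fun a b => a.gcd b ≠ 1 ∧ ¬(a = 6 ∧ b = 4))

theorem exists_goodList (G : Type*) [AddCommGroup G] [Finite G] (h : ∀ A : Multiset G, Atom A → A.card ≤ 11) :
    ∃ l ∈ goodLists, Nonempty (G ≃+ GT l) := by
  have key : ∀ n : ℕ, ∀ l : List ℕ, n = 11 - dStar l → (∀ m ∈ l, 2 ≤ m) → Nonempty (G ≃+ GT l) →
      ∃ l' ∈ goodLists, Nonempty (G ≃+ GT l') := by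
    intro n
    induction n using Nat.strong_induction_on with
    | _ n ih =>
    intro l hn hl he
    have hb : ∀ l : List ℕ, (∀ m ∈ l, 2 ≤ m) → Nonempty (G ≃+ GT l) → dStar l ≤ 11 := by
      rintro l hl ⟨e⟩
      obtain ⟨U, hU, hc, -⟩ := exists_atom_dStar l hl
      have := h (U.map e.symm) (Atom.map (f := (e.symm : GT l →+ G)) e.symm.injective hU)
      rw [Multiset.card_map] at this
      omega
    have hup : ∀ l' : List ℕ, (∀ m ∈ l', 2 ≤ m) → Nonempty (G ≃+ GT l') → dStar l < dStar l' →
        ∃ l' ∈ goodLists, Nonempty (G ≃+ GT l') := by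
      intro l' h1 h2 h3
      have := hb l' h1 h2
      exact ih (11 - dStar l') (by omega) l' rfl h1 h2
    have hle := hb l hl he
    rw [dStar] at hle
    obtain ⟨l', hl', hp⟩ := exists_perm_parts 10 10 l (fun m hm => ⟨hl m hm, by
      have : m - 1 ≤ (l.map (· - 1)).sum := List.single_le_sum (by simp) _ (List.mem_map.2 ⟨m, hm, rfl⟩)
      omega⟩) (by omega)
    by_cases hg : l'.Pairwise fun a b => a.gcd b ≠ 1 ∧ ¬(a = 6 ∧ b = 4)
    · obtain ⟨e⟩ := he
      obtain ⟨e'⟩ := GT.nonempty_of_perm hp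
      exact ⟨l', List.mem_filter.2 ⟨hl', by simpa using hg⟩, ⟨e.trans e'⟩⟩
    · rw [List.pairwise_iff_forall_sublist] at hg
      push Not at hg
      obtain ⟨a, b, hab, h1⟩ := hg
      obtain ⟨r, hr⟩ := hab.exists_perm_append
      have hpr := hp.trans hr
      obtain ⟨e⟩ := he
      obtain ⟨e'⟩ := GT.nonempty_of_perm hpr
      have h2 : ∀ m ∈ a :: b :: r, 2 ≤ m := fun m hm => hl m (hpr.mem_iff.2 hm)
      have ha := h2 a (by simp)
      have hb := h2 b (by simp)
      have hd : dStar l = dStar (a :: b :: r) := by rw [dStar, dStar, (hpr.map _).sum_eq]; rfl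
      by_cases hc : a.gcd b = 1
      · obtain ⟨e''⟩ := GT.nonempty_mul hc r
        refine hup (a * b :: r) ?_ ⟨(e.trans e').trans e''.symm⟩ ?_
        · intro m hm
          rcases List.mem_cons.1 hm with rfl | hm
          · nlinarith
          · exact h2 m (by simp [hm])
        · rw [hd]
          simp only [dStar, List.map_cons, List.sum_cons]
          have : a + b ≤ a * b := by nlinarith
          omega
      · obtain ⟨rfl, rfl⟩ := h1 hc
        obtain ⟨e₁⟩ := GT.nonempty_mul (show Nat.Coprime 2 3 by decide) (4 :: r)
        obtain ⟨e₂⟩ := GT.nonempty_mul (show Nat.Coprime 3 4 by decide) r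
        obtain ⟨e₃⟩ := GT.nonempty_cons 2 ⟨e₂.symm⟩
        refine hup (2 :: 12 :: r) ?_ ⟨((e.trans e').trans e₁).trans e₃⟩ ?_
        · intro m hm
          simp only [List.mem_cons] at hm
          rcases hm with rfl | rfl | hm
          · norm_num
          · norm_num
          · exact h2 m (by simp [hm])
        · rw [hd]
          simp only [dStar, List.map_cons, List.sum_cons]
          omega
  obtain ⟨l, hl, he⟩ := exists_equiv_GT G
  exact key _ l rfl hl he
end SetsOfLengths

namespace SetsOfLengths

/-- No nonempty subsequence of `cs` has code sum `-s`. -/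
def zeroFree (l : List ℕ) : List ℕ → ℕ → Bool
  | [], _ => true
  | c :: cs, s => zeroFree l cs s && (codeAdd l s c != 0 && zeroFree l cs (codeAdd l s c))

theorem sum_ne_zero_of_zeroFree {l : List ℕ} (hl : PosMod l) : ∀ (cs : List (GT l)) (s : GT l),
    zeroFree l (cs.map (enc l)) (enc l s) = true → ∀ T ≤ (cs : Multiset (GT l)), T ≠ 0 → s + T.sum ≠ 0
  | [], s, _, T, hT, h0 => absurd (by simpa using hT) h0
  | c :: cs, s, h, T, hT, h0 => by
    rw [List.map_cons, zeroFree, Bool.and_eq_true, Bool.and_eq_true, codeAdd_enc hl] at h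
    obtain ⟨h1, h2, h3⟩ := h
    by_cases hc : c ∈ T
    · obtain ⟨T, rfl⟩ := Multiset.exists_cons_of_mem hc
      rw [← Multiset.cons_coe, Multiset.cons_le_cons_iff] at hT
      rw [Multiset.sum_cons, ← add_assoc]
      by_cases hT0 : T = 0
      · subst hT0
        intro h
        rw [Multiset.sum_zero, add_zero] at h
        rw [h, enc_zero] at h2
        simp at h2
      · exact sum_ne_zero_of_zeroFree hl cs _ h3 T hT hT0
    · rw [← Multiset.cons_coe, Multiset.le_cons_of_notMem hc] at hT
      exact sum_ne_zero_of_zeroFree hl cs _ h1 T hT h0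

theorem atom_of_zeroFree {l : List ℕ} (hl : PosMod l) (c : ℕ) (cs : List ℕ)
    (hlt : ∀ x ∈ c :: cs, x < l.foldr (· * ·) 1) (hs : cs.foldr (codeAdd l) c = 0)
    (h : zeroFree l cs 0 = true) : Atom (((c :: cs).map (dec l) : List (GT l)) : Multiset (GT l)) := by
  obtain ⟨x, hx, hxc⟩ : ∃ x : GT l, x = dec l c ∧ enc l x = c := ⟨_, rfl, enc_dec hl (hlt c (by simp))⟩
  obtain ⟨xs, hxs, hxcs⟩ : ∃ xs : List (GT l), xs = cs.map (dec l) ∧ xs.map (enc l) = cs := by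
    refine ⟨cs.map (dec l), rfl, ?_⟩
    rw [List.map_map]
    exact (List.map_congr_left fun c hc => enc_dec hl (hlt c (by simp [hc]))).trans (List.map_id _)
  rw [List.map_cons, ← hx, ← hxs, ← Multiset.cons_coe]
  subst hxc hxcs
  have hsum : ∀ ys : List (GT l), (ys.map (enc l)).foldr (codeAdd l) (enc l x) = enc l (x + ys.sum) := by
    intro ys
    induction ys with
    | nil => simp
    | cons y ys ih => rw [List.map_cons, List.foldr_cons, ih, codeAdd_enc hl, List.sum_cons, add_left_comm]
  have hz : x + xs.sum = 0 := enc_injective hl (by rw [← hsum, hs, enc_zero])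
  have hf := sum_ne_zero_of_zeroFree hl xs 0 (by rw [enc_zero]; exact h)
  refine ⟨by simp, by simpa using hz, fun B hB hB0 hBs => ?_⟩
  obtain ⟨C, hC⟩ := Multiset.le_iff_exists_add.1 hB
  by_cases hx : x ∈ B
  · obtain ⟨B, rfl⟩ := Multiset.exists_cons_of_mem hx
    rw [Multiset.cons_add, Multiset.cons_inj_right] at hC
    have hCs : C.sum = 0 := by
      have := congrArg Multiset.sum hC
      rw [Multiset.sum_coe, Multiset.sum_add] at this
      rw [Multiset.sum_cons] at hBs
      rw [this, ← add_assoc, hBs, zero_add] at hz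
      exact hz
    by_cases hC0 : C = 0
    · rw [hC, hC0, add_zero]
    · exact absurd (by rw [zero_add]; exact hCs) (hf C (hC ▸ Multiset.le_add_left _ _) hC0)
  · exact absurd (by rw [zero_add]; exact hBs) (hf B ((Multiset.le_cons_of_notMem hx).1 hB) hB0)

theorem exists_atom_of_zeroFree {l : List ℕ} (hl : PosMod l) (c : ℕ) (cs : List ℕ)
    (hlt : ∀ x ∈ c :: cs, x < l.foldr (· * ·) 1) (hs : cs.foldr (codeAdd l) c = 0)
    (h : zeroFree l cs 0 = true) : ∃ A : Multiset (GT l), Atom A ∧ A.card = cs.length + 1 :=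
  ⟨_, atom_of_zeroFree hl c cs hlt hs h, by simp⟩

theorem exists_atom_eleven : ∃ A : Multiset (GT [6, 2, 2, 2, 2]), Atom A ∧ A.card = 11 :=
  exists_atom_of_zeroFree (by decide) 13 [73, 91, 50, 50, 50, 28, 46, 58, 64,
      59] (by decide +kernel) (by decide +kernel)
    (by decide +kernel)

theorem exists_atom_twelve : ∃ A : Multiset (GT [6, 2, 2, 2, 2, 2]), Atom A ∧ A.card = 12 :=
  exists_atom_of_zeroFree (by decide) 13 [73, 91, 50, 50, 50, 28, 46, 58, 64, 155, 96] (by decide +kernel)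
    (by decide +kernel) (by decide +kernel)

theorem GT.nonempty_six (r : ℕ) :
    Nonempty (GT (6 :: List.replicate r 2) ≃+ GT (List.replicate (r + 1) 2 ++ [3])) := by
  obtain ⟨e⟩ := GT.nonempty_mul (show Nat.Coprime 2 3 by decide) (List.replicate r 2)
  obtain ⟨e'⟩ := GT.nonempty_of_perm (l := 2 :: 3 :: List.replicate r 2)
      (l' := List.replicate (r + 1) 2 ++ [3])
    (by rw [List.replicate_succ]; exact (List.perm_append_singleton _ _).symm.cons 2)
  exact ⟨e.trans e'⟩

theorem GT.nonempty_six_three (r : ℕ) :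
    Nonempty (GT (6 :: List.replicate r 3) ≃+ GT (List.replicate (r + 1) 3 ++ [2])) := by
  obtain ⟨e⟩ := GT.nonempty_mul (show Nat.Coprime 3 2 by decide) (List.replicate r 3)
  obtain ⟨e'⟩ := GT.nonempty_of_perm (l := 3 :: 2 :: List.replicate r 3)
      (l' := List.replicate (r + 1) 3 ++ [2])
    (by rw [List.replicate_succ]; exact (List.perm_append_singleton _ _).symm.cons 3)
  exact ⟨e.trans e'⟩

theorem card_le_congr {G H : Type*} [AddCommGroup G] [AddCommGroup H] {n : ℕ}
    (h : ∀ A : Multiset H, Atom A → A.card ≤ n)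
    (e : Nonempty (G ≃+ H)) (A : Multiset G) (hA : Atom A) : A.card ≤ n := by
  obtain ⟨e⟩ := e
  rw [← Multiset.card_map e A]
  exact h _ (Atom.map (f := (e : G →+ H)) e.injective hA)

theorem card_le_dStar {l : List ℕ} (hl : l ∈ goodLists) (h10 : dStar l ≤ 10) (hne : l ≠ [6, 2, 2, 2, 2])
    (A : Multiset (GT l)) (hA : Atom A) : A.card ≤ dStar l := by
  have h : ∀ l ∈ goodLists, dStar l ≤ 10 → l ≠ [6, 2, 2, 2, 2] →
      (∃ p ∈ [2, 3, 5, 7], ∀ m ∈ l, ∃ k ∈ [1, 2, 3], m = p ^ k) ∨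
      l ∈ [[6], [10], [6, 2], [6, 2, 2], [6, 2, 2, 2], [6, 3], [6, 3, 3]] := by decide +kernel
  rcases h l hl h10 hne with ⟨p, hp, h⟩ | h
  · refine card_le_dStar_of_prime_pow (p := p) ?_ (fun m hm => ?_) A hA
    · simp only [List.mem_cons, List.not_mem_nil, or_false] at hp
      rcases hp with rfl | rfl | rfl | rfl <;> norm_num
    · obtain ⟨k, -, hk⟩ := h m hm
      exact ⟨k, hk⟩
  · simp only [List.mem_cons, List.not_mem_nil, or_false] at h
    rcases h with rfl | rfl | rfl | rfl | rfl | rfl | rfl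
    · exact card_le_congr card_le_two_six (GT.nonempty_six 0) A hA
    · exact card_le_ten A hA
    · exact card_le_congr card_le_two_two_six (GT.nonempty_six 1) A hA
    · exact card_le_congr card_le_two_two_two_six (GT.nonempty_six 2) A hA
    · exact card_le_congr card_le_two_two_two_two_six (GT.nonempty_six 3) A hA
    · exact card_le_congr card_le_three_six (GT.nonempty_six_three 1) A hA
    · exact card_le_congr card_le_three_three_six (GT.nonempty_six_three 2) A hA

/-- The groups with Davenport constant `D ≤ 11`. -/
def groups (D : ℕ) : List (List ℕ) :=
  goodLists.filter fun l => decide (if l = [6, 2, 2, 2, 2] then D = 11 else dStar l = D ∧ l ≠ [6, 2,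
      2, 2, 2, 2])

theorem exists_group {G : Type*} [AddCommGroup G] [Finite G] {U : Multiset G} (hU : MaxAtom U)
    (hD : U.card ≤ 11) :
    ∃ l ∈ groups U.card, Nonempty (G ≃+ GT l) := by
  obtain ⟨l, hl, e⟩ := exists_goodList G fun A hA => (hU.2 A hA).trans hD
  have hb := card_le_congr (G := GT l) hU.2 (e.map AddEquiv.symm)
  refine ⟨l, List.mem_filter.2 ⟨hl, ?_⟩, e⟩
  rw [decide_eq_true_eq]
  by_cases h1 : l = [6, 2, 2, 2, 2]
  · rw [if_pos h1]
    subst h1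
    obtain ⟨A, hA, h⟩ := exists_atom_eleven
    have := hb A hA
    omega
  · have h2 : l ≠ [6, 2, 2, 2, 2, 2] := by
      rintro rfl
      obtain ⟨A, hA, h⟩ := exists_atom_twelve
      have := hb A hA
      omega
    rw [if_neg h1]
    refine ⟨?_, h2⟩
    have h3 : ∀ l ∈ goodLists, dStar l ≤ 11 ∧ ∀ m ∈ l, 2 ≤ m := by decide +kernel
    obtain ⟨A, hA, hc, -⟩ := exists_atom_dStar l (h3 l hl).2
    have h4 := hb A hA
    rcases Nat.lt_or_ge (dStar l) 11 with h5 | h5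
    · have := card_le_congr (card_le_dStar hl (by omega) h1) e U hU.1
      omega
    · omega
end SetsOfLengths

namespace SetsOfLengths

section Rules
variable {G : Type*} [AddCommGroup G]

theorem MaxAtom.smul_eq_zero {U : Multiset G} (hU : MaxAtom U) {n : ℕ} (h : ∀ g ∈ U, n • g = 0)
    (x : G) : n • x = 0 := by
  have hx : x ∈ AddSubgroup.closure {g | g ∈ U} := by rw [hU.closure_eq_top]; trivial
  induction hx using AddSubgroup.closure_induction with
  | mem y hy => exact h y hy
  | zero => simp
  | add y z _ _ h1 h2 => rw [smul_add, h1, h2, add_zero]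
  | neg y _ h => rw [smul_neg, h, neg_zero]

theorem MaxAtom.zero_notMem {U : Multiset G} (hU : MaxAtom U) (h3 : 2 < U.card) : (0 : G) ∉ U :=
  hU.1.zero_notMem (by omega)

theorem MaxAtom.card_le_of_forall_eq {U : Multiset G} (hU : MaxAtom U) (h0 : 0 < U.card) {g : G}
    (hrep : ∀ y ∈ U, y = g) : Nat.card G ≤ U.card := by
  have hUg : U = Multiset.replicate U.card g := Multiset.eq_replicate.2 ⟨rfl, hrep⟩
  have hz : U.card • g = 0 := by
    have := hU.1.2.1
    rw [hUg, Multiset.sum_replicate] at this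
    simpa using this
  have htop : ∀ y : G, y ∈ AddSubgroup.zmultiples g := by
    intro y
    have hy : y ∈ AddSubgroup.closure {g | g ∈ U} := by rw [hU.closure_eq_top]; trivial
    refine (AddSubgroup.closure_le _).2 ?_ hy
    intro z hz
    rw [hrep z hz]
    exact AddSubgroup.mem_zmultiples g
  rw [← addOrderOf_eq_card_of_forall_mem_zmultiples htop]
  exact addOrderOf_le_of_nsmul_eq_zero (h0) hz

/-- If `U (-U)` has only the trivial lengths, then the group is cyclic or elementary. -/
theorem MaxAtom.two_rule {U : Multiset G} (hU : MaxAtom U) (h3 : 2 < U.card)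
    (hp : ∀ k ∈ symLen U, k = 2 ∨ k = U.card) {x : G} (hx : x + x ≠ 0) : Nat.card G ≤ U.card := by
  classical
  have key : ∀ g ∈ U, ∀ g₂ ∈ U, g₂ ≠ g → g + g = 0 := by
    intro g hg g₂ hg₂ hne
    obtain ⟨T, R, hUe, -, -, -, -, hs, hw, hlt⟩ := hU.exists_relation h3 hg hg₂ hne
    have hc := Multiset.count_pos.2 hg
    rcases hp _ hw with h | h
    · have hc1 : U.count g = 1 := by omega
      have hR : R = 0 := Multiset.card_eq_zero.1 (by omega)
      rw [hR, hc1, Multiset.sum_zero, add_zero, two_nsmul] at hs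
      exact hs
    · omega
  by_cases hall : ∀ g ∈ U, g + g = 0
  · exact absurd (by rw [← two_nsmul]; exact hU.smul_eq_zero (fun g hg => by rw [two_nsmul]; exact hall g hg) x) hx
  push Not at hall
  obtain ⟨g, hg, hgg⟩ := hall
  refine hU.card_le_of_forall_eq (by omega) (g := g) fun y hy => ?_
  by_contra hne
  exact hgg (key g hg y hy hne)

/-- If `U (-U)` has only the lengths `2`, `D - 1`, `D`, then the group has a large cyclic subgroup. -/
theorem MaxAtom.three_rule {U : Multiset G} (hU : MaxAtom U) (h3 : 3 < U.card)
    (hp : ∀ k ∈ symLen U, k = 2 ∨ k = U.card - 1 ∨ k = U.card) {x : G} (hx : x + x ≠ 0) {n : ℕ} (hn : 0 < n)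
    (hnG : ∀ y : G, n • y = 0) : Nat.card G ≤ 2 * n := by
  classical
  have h0 := hU.zero_notMem (by omega)
  have key : ∀ g ∈ U, g + g ≠ 0 → ∀ g₂ ∈ U, g₂ ≠ g → g - g₂ ∈ U := by
    intro g hg hgg g₂ hg₂ hne
    obtain ⟨T, R, hUe, -, -, -, hgT, hs, hw, hlt⟩ := hU.exists_relation (by omega) hg hg₂ hne
    have hc := Multiset.count_pos.2 hg
    have hcard := congrArg Multiset.card hUe
    simp only [Multiset.card_add, Multiset.card_replicate, Multiset.card_cons] at hcard
    rcases hp _ hw with h | h | h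
    · have hc1 : U.count g = 1 := by omega
      have hR : R = 0 := Multiset.card_eq_zero.1 (by omega)
      rw [hR, hc1, Multiset.sum_zero, add_zero, two_nsmul] at hs
      exact absurd hs hgg
    · obtain ⟨t, rfl⟩ := Multiset.card_eq_one.1 (show T.card = 1 by omega)
      rw [Multiset.sum_singleton] at hgT
      rw [hgT, add_sub_cancel_left, hUe]
      simp
    · omega
  have hnopair : ∀ h ∈ U, -h ∈ U → h + h = 0 := by
    intro h h1 h2
    by_contra hne
    refine hU.1.no_pair (by omega) h (pair_le (fun he => hne ?_) (Multiset.count_pos.2 h1)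
        (Multiset.count_pos.2 h2))
    nth_rewrite 1 [← he]
    exact neg_add_cancel h
  obtain ⟨g, hg, hgg⟩ : ∃ g ∈ U, g + g ≠ 0 := by
    by_contra! hall
    exact hx (by rw [← two_nsmul]; exact hU.smul_eq_zero (fun g hg => by rw [two_nsmul]; exact hall g hg) x)
  -- the set of involutions in `U` has at most one element
  have hinv : ∀ f ∈ U, f + f = 0 → g - f ∈ U ∧ (g - f) + (g - f) ≠ 0 := by
    intro f hf hff
    refine ⟨key g hg hgg f hf fun h => hgg (h ▸ hff), fun h => hgg ?_⟩
    have : g - f + (g - f) = g + g - (f + f) := by abel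
    rwa [this, hff, sub_zero] at h
  have huniq : ∀ f ∈ U, f + f = 0 → ∀ f' ∈ U, f' + f' = 0 → f = f' := by
    intro f hf hff f' hf' hff'
    by_contra hne
    obtain ⟨h1, h2⟩ := hinv f hf hff
    have h3' : g - f - f' ∈ U := key _ h1 h2 f' hf' fun h => h2 (by rw [← h]; exact hff')
    have hfn : -f = f := neg_eq_of_add_eq_zero_left hff
    have hfn' : -f' = f' := neg_eq_of_add_eq_zero_left hff'
    have hne2 : g - f - f' ≠ g := by
      intro h
      apply hne
      have : f + f' = 0 := by rw [sub_sub] at h; simpa using h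
      rw [← hfn', eq_neg_iff_add_eq_zero]
      exact this
    have h4 := key g hg hgg _ h3' hne2
    have h5 : g - (g - f - f') = f + f' := by abel
    rw [h5] at h4
    have hf0 : f ≠ 0 := fun h => h0 (h ▸ hf)
    have hf0' : f' ≠ 0 := fun h => h0 (h ▸ hf')
    have hle : ({f, f', f + f'} : Multiset G) ≤ U := by
      refine (Multiset.le_iff_subset (by simp [hne, hf0, hf0'])).2 ?_
      intro z hz
      simp only [Multiset.insert_eq_cons, Multiset.mem_cons, Multiset.mem_singleton] at hz
      rcases hz with rfl | rfl | rfl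
      · exact hf
      · exact hf'
      · exact h4
    have := hU.1.2.2 _ hle (by simp) (by
      simp only [Multiset.insert_eq_cons, Multiset.sum_cons, Multiset.sum_singleton]
      have : f + (f' + (f + f')) = (f + f) + (f' + f') := by abel
      rw [this, hff, hff', add_zero])
    rw [← this] at h3
    simp at h3
  obtain ⟨f, hff, hsup⟩ : ∃ f : G, f + f = 0 ∧ ∀ y ∈ U, y = g ∨ y = f ∨ y = g - f := by
    by_cases hex : ∃ f ∈ U, f + f = 0
    · obtain ⟨f, hf, hff⟩ := hex
      refine ⟨f, hff, fun y hy => ?_⟩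
      by_cases hyy : y + y = 0
      · exact Or.inr (Or.inl (huniq y hy hyy f hf hff))
      · by_cases hyg : y = g
        · exact Or.inl hyg
        · have h1 := key g hg hgg y hy hyg
          have h2 := key y hy hyy g hg (Ne.symm hyg)
          have h3' := hnopair _ h1 (by rwa [neg_sub])
          refine Or.inr (Or.inr ?_)
          rw [← huniq _ h1 h3' f hf hff]
          abel
    · push Not at hex
      refine ⟨0, by simp, fun y hy => ?_⟩
      by_contra! hne
      have h1 := key g hg hgg y hy hne.1
      have h2 := key y hy (hex y hy) g hg (Ne.symm hne.1)
      exact hex _ h1 (hnopair _ h1 (by rwa [neg_sub]))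
  have hsurj : Function.Surjective fun z : Fin 2 × Fin n => z.1.val • f + z.2.val • g := by
    have hrange : ∀ a b : ℕ, ∃ z : Fin 2 × Fin n, z.1.val • f + z.2.val • g = a • f + b • g := by
      intro a b
      refine ⟨(⟨a % 2, Nat.mod_lt _ (by norm_num)⟩, ⟨b % n, Nat.mod_lt _ hn⟩), ?_⟩
      have e1 : a • f = (a % 2) • f := by
        conv_lhs => rw [← Nat.mod_add_div a 2, add_smul, mul_comm, mul_smul, two_nsmul, hff,
            smul_zero (a / 2), add_zero]
      have e2 : b • g = (b % n) • g := by
        conv_lhs => rw [← Nat.mod_add_div b n, add_smul, mul_smul, hnG, add_zero]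
      rw [e1, e2]
    have hng : -g = (n - 1) • g := by
      rw [neg_eq_iff_add_eq_zero]
      nth_rewrite 1 [← one_nsmul g]
      rw [← add_smul, show 1 + (n - 1) = n by omega, hnG]
    have hfn : -f = f := neg_eq_of_add_eq_zero_left hff
    intro y
    have hy : y ∈ AddSubgroup.closure {g | g ∈ U} := by rw [hU.closure_eq_top]; trivial
    suffices h : ∃ a b : ℕ, y = a • f + b • g by
      obtain ⟨a, b, rfl⟩ := h
      exact hrange a b
    induction hy using AddSubgroup.closure_induction with
    | mem y hy =>
      rcases hsup y hy with h | h | h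
      · exact ⟨0, 1, by simp [h]⟩
      · exact ⟨1, 0, by simp [h]⟩
      · exact ⟨1, 1, by rw [h, one_nsmul, one_nsmul, sub_eq_add_neg, hfn, add_comm]⟩
    | zero => exact ⟨0, 0, by simp⟩
    | add y z _ _ h1 h2 =>
      obtain ⟨a, b, rfl⟩ := h1
      obtain ⟨c, d, rfl⟩ := h2
      exact ⟨a + c, b + d, by rw [add_smul, add_smul]; abel⟩
    | neg y _ h =>
      obtain ⟨a, b, rfl⟩ := h
      exact ⟨a, b * (n - 1), by rw [neg_add, ← smul_neg, hfn, mul_smul, ← hng, smul_neg]⟩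
  have := Nat.card_le_card_of_surjective _ hsurj
  simpa using this

end Rules
end SetsOfLengths

namespace SetsOfLengths

section Rules
variable {G : Type*} [AddCommGroup G]

theorem MaxAtom.no_neg {U : Multiset G} (hU : MaxAtom U) (h3 : 2 < U.card) {x : G} (hx : x ∈ U) (hx' : -x ∈ U)
    (hne : -x ≠ x) : False := by
  classical
  exact hU.1.no_pair h3 x (pair_le hne (Multiset.count_pos.2 hx) (Multiset.count_pos.2 hx'))

theorem MaxAtom.no_double [DecidableEq G] {U : Multiset G} (hU : MaxAtom U) (h3 : 2 < U.card)
    {x : G} (hx : 2 ≤ U.count x) :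
    x + x ≠ 0 :=
  fun h => hU.1.no_pair h3 x (double_le (neg_eq_of_add_eq_zero_left h) hx)

theorem NoRel.pair_eq {U : Multiset G} {fb : List ℕ} (h : NoRel U fb) (h4 : 4 ∈ fb) {x y x' y' : G}
    (h1 : ({x, y} : Multiset G) ≤ U) (h2 : ({x', y'} : Multiset G) ≤ U) (hs : x + y = x' + y') :
    ({x, y} : Multiset G) = {x', y'} := by
  classical
  by_cases a : x = x'
  · subst a
    rw [add_left_cancel hs]
  by_cases b : x = y'
  · subst b
    rw [add_comm x' x] at hs
    rw [add_left_cancel hs, Multiset.pair_comm]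
  by_cases c : y = x'
  · subst c
    rw [add_comm] at hs
    exact absurd (add_left_cancel hs) b
  by_cases d : y = y'
  · subst d
    exact absurd (add_right_cancel hs) a
  refine absurd h4 (h {x, y} {x', y'} ?_ ?_ (by simpa using hs))
  · have hd : Disjoint ({x, y} : Multiset G) {x', y'} := by
      rw [Multiset.disjoint_left]
      intro z hz hz'
      simp only [Multiset.insert_eq_cons, Multiset.mem_cons, Multiset.mem_singleton] at hz hz'
      rcases hz with rfl | rfl <;> rcases hz' with rfl | rfl <;> simp_all
    rw [Multiset.add_eq_union_iff_disjoint.2 hd]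
    exact Multiset.union_le h1 h2
  · intro z hz hz'
    simp only [Multiset.insert_eq_cons, Multiset.mem_cons, Multiset.mem_singleton] at hz hz'
    rcases hz with rfl | rfl <;> rcases hz' with rfl | rfl <;> simp_all

theorem MaxAtom.four_cases [DecidableEq G] {U : Multiset G} (hU : MaxAtom U) (h7 : 6 < U.card)
    (hp : ∀ k ∈ symLen U, k = 2 ∨ k = 4 ∨ k = U.card) {g g₂ : G} (hg : g ∈ U) (hg₂ : g₂ ∈ U) (hne : g₂ ≠ g) :
    U.count g = 1 ∧ g + g = 0 ∨
    U.count g = 1 ∧ (∃ x y, x ≠ g ∧ y ≠ g ∧ g + g + (x + y) = 0 ∧ (g₂ ::ₘ {x, y}) ≤ U) ∨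
    U.count g = 2 ∧ (∃ y, y ≠ g ∧ 3 • g + y = 0 ∧ ({g₂, y} : Multiset G) ≤ U) ∨
    U.count g = 3 ∧ 4 • g = 0 := by
  obtain ⟨T, R, hUe, hgR, -, -, -, hs, hw, hlt⟩ := hU.exists_relation (by omega) hg hg₂ hne
  have hc := Multiset.count_pos.2 hg
  have hle : g₂ ::ₘ R ≤ U := by
    refine le_trans ?_ hUe.symm.le
    rw [add_assoc, Multiset.cons_add]
    exact le_trans (Multiset.cons_le_cons _ (Multiset.le_add_left R T)) (Multiset.le_add_left _ _)
  have h24 : U.count g + 1 + R.card = 2 ∨ U.count g + 1 + R.card = 4 := by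
    rcases hp _ hw with h | h | h
    · exact Or.inl h
    · exact Or.inr h
    · omega
  obtain h | h | h | h : (U.count g = 1 ∧ R.card = 0) ∨ (U.count g = 1 ∧ R.card = 2) ∨ (U.count g = 2 ∧ R.card = 1) ∨
    (U.count g = 3 ∧ R.card = 0) := by omega
  · rw [Multiset.card_eq_zero.1 h.2, h.1, Multiset.sum_zero, add_zero, two_nsmul] at hs
    exact Or.inl ⟨h.1, hs⟩
  · obtain ⟨x, y, rfl⟩ := Multiset.card_eq_two.1 h.2
    rw [h.1, two_nsmul] at hs
    simp only [Multiset.insert_eq_cons, Multiset.mem_cons, Multiset.mem_singleton, not_or] at hgR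
    exact Or.inr (Or.inl ⟨h.1, x, y, Ne.symm hgR.1, Ne.symm hgR.2, by simpa using hs, hle⟩)
  · obtain ⟨y, rfl⟩ := Multiset.card_eq_one.1 h.2
    rw [h.1] at hs
    exact Or.inr (Or.inr (Or.inl ⟨h.1, y, fun h => hgR (by simp [h]), by simpa using hs, hle⟩))
  · rw [Multiset.card_eq_zero.1 h.2, h.1, Multiset.sum_zero, add_zero] at hs
    exact Or.inr (Or.inr (Or.inr ⟨h.1, hs⟩))

/-- If `U (-U)` has only the lengths `2`, `4`, `D`, then `2 G` has at most two elements. -/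
theorem MaxAtom.four_rule {U : Multiset G} (hU : MaxAtom U) (h7 : 6 < U.card)
    (hp : ∀ k ∈ symLen U, k = 2 ∨ k = 4 ∨ k = U.card) {n : ℕ} (hn : n = 6 ∨ n = 8 ∨ n = 9 ∨ n = 10)
    (hnG : ∀ y : G, n • y = 0) (hcard : U.card < Nat.card G) : ∃ t : G, t + t = 0 ∧ ∀ x : G,
    x + x = 0 ∨ x + x = t := by
  classical
  have h0 := hU.zero_notMem (by omega)
  have hrel : NoRel U [4, U.card - 4] := by
    refine noRel_of_symLen (p := [2, 4, U.card]) hU.1 (by simpa using hp) ?_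
    intro f hf
    simp only [List.mem_cons, List.not_mem_nil, or_false] at hf
    refine ⟨by omega, by omega, fun a ha h2 hm => ?_⟩
    have := List.mem_range.1 ha
    simp only [List.mem_cons, List.not_mem_nil, or_false] at hm
    omega
  have hother : ∀ g ∈ U, ∃ g₂ ∈ U, g₂ ≠ g := by
    intro g hg
    by_contra! hall
    have := hU.card_le_of_forall_eq (by omega) hall
    omega
  have hle2 : ∀ {g x : G}, U.count g = 2 → 3 • g + x = 0 → ∃ y, y ≠ g ∧ 3 • g + y = 0 ∧ 2 ≤ U.count y := by
    intro g _ hc _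
    have hg : g ∈ U := Multiset.count_pos.1 (by omega)
    obtain ⟨g₂, hg₂, hne⟩ := hother g hg
    obtain h | h | ⟨-, y, hyg, hy, hle⟩ | h := hU.four_cases h7 hp hg hg₂ hne
    · omega
    · omega
    · have hyU : y ∈ U := Multiset.mem_of_le hle (by simp)
      obtain h | h | ⟨-, z, hzg, hz, hle⟩ | h := hU.four_cases h7 hp hg hyU hyg
      · omega
      · omega
      · obtain rfl : z = y := by rw [← hz] at hy; exact (add_left_cancel hy).symm
        have := Multiset.count_le_of_le z hle
        refine ⟨z, hzg, hz, ?_⟩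
        simpa using this
      · omega
    · omega
  have htwo : ∀ g ∈ U, U.count g = 2 → ∃ y, y ≠ g ∧ 3 • g + y = 0 ∧ 2 ≤ U.count y := by
    intro g hg hc
    obtain ⟨g₂, hg₂, hne⟩ := hother g hg
    obtain h | h | ⟨-, y, hyg, hy, hle⟩ | h := hU.four_cases h7 hp hg hg₂ hne
    · omega
    · omega
    · exact hle2 hc hy
    · omega
  have hno2 : ∀ g ∈ U, U.count g ≠ 2 := by
    intro g hg hc
    obtain ⟨y, hyg, hy, hcy⟩ := htwo g hg hc
    have hyU : y ∈ U := Multiset.count_pos.1 (by omega)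
    have hn' := hnG g
    have hy3 : U.count y = 2 ∨ 4 • y = 0 := by
      obtain ⟨g₂, hg₂, hne⟩ := hother y hyU
      obtain h | h | h | h := hU.four_cases h7 hp hyU hg₂ hne
      · omega
      · omega
      · exact Or.inl h.1
      · exact Or.inr h.2
    rcases hn with rfl | rfl | rfl | rfl
    · exact hU.no_double (by omega) hcy (by linear_combination (norm := module) (2 : ℕ) • hy - hn')
    · have := hrel.pair_eq (by simp) (Multiset.le_count_iff_replicate_le.1 hc.ge)
        (Multiset.le_count_iff_replicate_le.1 hcy)
        (by linear_combination (norm := module) hn' - (2 : ℕ) • hy)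
      have hmem : y ∈ ({g, g} : Multiset G) := by rw [this]; simp
      exact hyg (by simpa using hmem)
    · rcases hy3 with h | h
      · obtain ⟨z, -, hz, hcz⟩ := htwo y hyU h
        refine h0 (?_ : (0 : G) ∈ U)
        have : z = 0 := by linear_combination (norm := module) hz - (3 : ℕ) • hy + hn'
        rw [← this]
        exact Multiset.count_pos.1 (by omega)
      · refine h0 (?_ : (0 : G) ∈ U)
        have : y = 0 := by linear_combination (norm := module) h - (3 : ℕ) • hy + hn'
        rwa [← this]
    · have hgg := hU.no_double (by omega) hc.ge
      rcases hy3 with h | h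
      · obtain ⟨z, -, hz, hcz⟩ := htwo y hyU h
        have : z = -g := by linear_combination (norm := module) hz - (3 : ℕ) • hy + hn'
        refine hU.no_neg (by omega) hg (this ▸ Multiset.count_pos.1 (by omega)) fun h => hgg ?_
        nth_rewrite 1 [← h]
        exact neg_add_cancel g
      · exact hgg (by linear_combination (norm := module) (4 : ℕ) • hy - h - hn')
  have hcases : ∀ g ∈ U, U.count g = 1 ∨ U.count g = 3 ∧ 4 • g = 0 := by
    intro g hg
    obtain ⟨g₂, hg₂, hne⟩ := hother g hg
    obtain h | h | h | h := hU.four_cases h7 hp hg hg₂ hne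
    · exact Or.inl h.1
    · exact Or.inl h.1
    · exact absurd h.1 (hno2 g hg)
    · exact Or.inr h
  have huniq : ∀ g ∈ U, ∀ h ∈ U, 2 ≤ U.count g → 2 ≤ U.count h → g = h := by
    intro g hg h hh hcg hch
    by_contra hne
    have hg3 := hcases g hg
    have hh3 := hcases h hh
    have hg4 : 4 • g = 0 := by rcases hg3 with h | h <;> [omega; exact h.2]
    have hh4 : 4 • h = 0 := by rcases hh3 with h | h <;> [omega; exact h.2]
    have hle : Multiset.replicate 3 g + Multiset.replicate 3 h ≤ U := by
      rw [Multiset.add_eq_union_iff_disjoint.2]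
      · exact Multiset.union_le (Multiset.le_count_iff_replicate_le.1 (by omega))
          (Multiset.le_count_iff_replicate_le.1 (by omega))
      · rw [Multiset.disjoint_left]
        intro z hz hz'
        exact hne ((Multiset.eq_of_mem_replicate hz).symm.trans (Multiset.eq_of_mem_replicate hz'))
    obtain ⟨S, hS⟩ := Multiset.le_iff_exists_add.1 hle
    have hcard := congrArg Multiset.card hS
    have hsum := congrArg Multiset.sum hS
    have hcg' := congrArg (Multiset.count g) hS
    have hch' := congrArg (Multiset.count h) hS
    simp only [Multiset.card_add, Multiset.card_replicate] at hcard
    simp only [Multiset.sum_add, Multiset.sum_replicate, hU.1.2.1] at hsum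
    simp only [Multiset.count_add, Multiset.count_replicate, if_pos] at hcg' hch'
    rw [if_neg (Ne.symm hne)] at hcg'
    rw [if_neg hne] at hch'
    have hgS : g ∉ S := Multiset.count_eq_zero.1 (by omega)
    have hhS : h ∉ S := Multiset.count_eq_zero.1 (by omega)
    refine hrel {g, h} S ?_ ?_ ?_ ?_
    · rw [hS]
      refine add_le_add ?_ le_rfl
      exact add_le_add (Multiset.singleton_le.2 (by simp)) (Multiset.singleton_le.2 (by simp))
    · intro z hz
      simp only [Multiset.insert_eq_cons, Multiset.mem_cons, Multiset.mem_singleton] at hz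
      rcases hz with rfl | rfl
      · exact hgS
      · exact hhS
    · simp only [Multiset.insert_eq_cons, Multiset.sum_cons, Multiset.sum_singleton]
      linear_combination (norm := module) hg4 + hh4 + hsum
    · have : S.card + 6 = U.card := by omega
      simp only [Multiset.insert_eq_cons, Multiset.card_cons, Multiset.card_singleton, List.mem_cons]
      exact Or.inr (Or.inl (by omega))
  have hone : ∀ g ∈ U, g + g = 0 ∨ ∃ h ∈ U, 2 ≤ U.count h ∧ g + g = h + h := by
    intro g hg
    obtain ⟨g₂, hg₂, hne⟩ := hother g hg
    obtain h | ⟨hc, x, y, hxg, hyg, hs, hle⟩ | h | h := hU.four_cases h7 hp hg hg₂ hne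
    · exact Or.inl h.2
    · have hxy : ({x, y} : Multiset G) ≤ U := (Multiset.le_cons_self _ _).trans hle
      have hx : x ∈ U := Multiset.mem_of_le hxy (by simp)
      have hy : y ∈ U := Multiset.mem_of_le hxy (by simp)
      have hcount : ∀ z ∈ U, z ≠ g → z ∈ ({x, y} : Multiset G) → 2 ≤ U.count z := by
        intro z hz hzg hzm
        obtain h | ⟨-, x', y', -, -, hs', hle'⟩ | h | h := hU.four_cases h7 hp hg hz hzg
        · have hxy0 : x + y = 0 := by linear_combination (norm := module) hs - h.2
          have := hU.1.2.2 _ hxy (by simp) (by simpa using hxy0)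
          have := congrArg Multiset.card this
          simp only [Multiset.insert_eq_cons, Multiset.card_cons, Multiset.card_singleton] at this
          omega
        · have := hrel.pair_eq (by simp) hxy ((Multiset.le_cons_self _ _).trans hle')
            (by linear_combination (norm := module) hs - hs')
          rw [← this] at hle'
          have h1 := Multiset.count_le_of_le z hle'
          rw [Multiset.count_cons_self] at h1
          have := Multiset.count_pos.2 hzm
          omega
        · omega
        · omega
      have e := huniq x hx y hy (hcount x hx hxg (by simp)) (hcount y hy hyg (by simp))
      subst e
      refine Or.inr ⟨x, hx, hcount x hx hxg (by simp), ?_⟩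
      rcases hcases x hx with h | h
      · have := hcount x hx hxg (by simp)
        omega
      · linear_combination (norm := module) hs - h.2
    · exact absurd h.1 (hno2 g hg)
    · exact Or.inr ⟨g, hg, by omega, rfl⟩
  obtain ⟨t, ht, hall⟩ : ∃ t : G, t + t = 0 ∧ ∀ g ∈ U, g + g = 0 ∨ g + g = t := by
    by_cases hex : ∃ h ∈ U, 2 ≤ U.count h
    · obtain ⟨h, hh, hc⟩ := hex
      refine ⟨h + h, ?_, fun g hg => ?_⟩
      · rcases hcases h hh with h' | h'
        · omega
        · linear_combination (norm := module) h'.2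
      · rcases hone g hg with h' | ⟨h', hh', hc', e⟩
        · exact Or.inl h'
        · rw [e, huniq h' hh' h hh hc' hc]
          exact Or.inr rfl
    · push Not at hex
      refine ⟨0, by simp, fun g hg => ?_⟩
      rcases hone g hg with h' | ⟨h', hh', hc', e⟩
      · exact Or.inl h'
      · exact absurd hc' (by have := hex h' hh'; omega)
  refine ⟨t, ht, fun x => ?_⟩
  have hx : x ∈ AddSubgroup.closure {g | g ∈ U} := by rw [hU.closure_eq_top]; trivial
  induction hx using AddSubgroup.closure_induction with
  | mem y hy => exact hall y hy
  | zero => simp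
  | add y z _ _ h1 h2 =>
    rw [add_add_add_comm]
    rcases h1 with h1 | h1 <;> rcases h2 with h2 | h2 <;> simp [h1, h2, ht]
  | neg y _ h =>
    rw [← neg_add]
    rcases h with h | h
    · simp [h]
    · rw [h]
      exact Or.inr (neg_eq_of_add_eq_zero_left ht)

end Rules
end SetsOfLengths

namespace SetsOfLengths

section Cover
variable {G : Type*} [AddCommGroup G]

theorem exists_relation_atoms {U Q R X : Multiset G} (hU : Atom U) (h3 : 2 < U.card) (hUe : U = Q + R + X)
    (hd : ∀ a ∈ Q, a ∉ R) (hs : Q.sum = R.sum) :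
    ∃ F : Multiset (Multiset G), (∀ W ∈ F, Atom W) ∧ F.sum = Q + R.map Neg.neg ∧
      ∀ W ∈ F, 3 ≤ W.card ∧ U.card + 2 - W.card ∈ symLen U := by
  classical
  have h0 := hU.zero_notMem (by omega)
  obtain ⟨F, hF, hFs⟩ := exists_factorization (Q + R.map Neg.neg)
    (by rw [Multiset.sum_add, sum_map_neg, hs, add_neg_cancel])
  refine ⟨F, hF, hFs, fun W hW => ?_⟩
  have hle : W ≤ Q + R.map Neg.neg := hFs ▸ Multiset.single_le_sum (fun _ _ => Multiset.zero_le _) W hW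
  obtain ⟨A, B', hA, hB', rfl⟩ : ∃ A B', A ≤ Q ∧ B' ≤ R.map Neg.neg ∧ A + B' = W :=
    ⟨W ⊓ Q, W - W ⊓ Q, inf_le_right, by
      rw [Multiset.le_iff_count] at hle ⊢
      intro a
      have h1 := hle a
      have h2 : Multiset.count a (W ⊓ Q) = min (Multiset.count a W) (Multiset.count a Q) := Multiset.count_inter a W Q
      rw [Multiset.count_add] at h1
      rw [Multiset.count_sub, h2]
      omega, add_tsub_cancel_of_le inf_le_left⟩
  obtain ⟨B, hB, rfl⟩ := le_map_iff.1 hB'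
  obtain ⟨A', rfl⟩ := Multiset.le_iff_exists_add.1 hA
  obtain ⟨B', rfl⟩ := Multiset.le_iff_exists_add.1 hB
  have hUe' : U = A + B + (A' + B' + X) := by rw [hUe]; abel
  have hcard := congrArg Multiset.card hUe'
  have hmem := relation_atom_mem hUe' h0 (hF _ hW)
  simp only [Multiset.card_add, Multiset.card_map] at hcard hmem ⊢
  have hAU : A ≤ U := hUe' ▸ (Multiset.le_add_right _ _).trans (Multiset.le_add_right _ _)
  have hBU : B ≤ U := hUe' ▸ (Multiset.le_add_left _ _).trans (Multiset.le_add_right _ _)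
  have hsum : A.sum = B.sum := by
    have := (hF _ hW).2.1
    rwa [Multiset.sum_add, sum_map_neg, add_neg_eq_zero] at this
  have hzero : ∀ C ≤ U, C.sum = 0 → C.card < U.card → C = 0 := by
    intro C hC hCs hCc
    by_contra hne
    exact absurd (congrArg Multiset.card (hU.2.2 C hC hne hCs)) (by omega)
  have hA0 : A = 0 → 3 ≤ B.card := by
    rintro rfl
    by_contra hlt
    have := hzero B hBU (by rw [← hsum, Multiset.sum_zero]) (by omega)
    subst this
    exact (hF _ hW).1 (by simp)
  have hB0 : B = 0 → 3 ≤ A.card := by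
    rintro rfl
    by_contra hlt
    have := hzero A hAU (by rw [hsum, Multiset.sum_zero]) (by omega)
    subst this
    exact (hF _ hW).1 (by simp)
  refine ⟨?_, by convert hmem using 1; omega⟩
  by_contra hlt
  rcases Nat.eq_zero_or_pos A.card with ha | ha
  · have := hA0 (Multiset.card_eq_zero.1 ha); omega
  rcases Nat.eq_zero_or_pos B.card with hb | hb
  · have := hB0 (Multiset.card_eq_zero.1 hb); omega
  obtain ⟨a, rfl⟩ := Multiset.card_eq_one.1 (show A.card = 1 by omega)
  obtain ⟨b, rfl⟩ := Multiset.card_eq_one.1 (show B.card = 1 by omega)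
  simp only [Multiset.sum_singleton] at hsum
  subst hsum
  exact hd a (by simp) (by simp)

theorem exists_cover {U Q R P S : Multiset G} (hU : Atom U) (h3 : 2 < U.card) (hUe : U = Q + R + (P + S))
    (hd : ∀ a ∈ Q, a ∉ R) (hd' : ∀ a ∈ P, a ∉ S) (hs : Q.sum = R.sum) (hs' : P.sum = S.sum)
    (hne : Q + R ≠ 0) (hne' : P + S ≠ 0) :
    ∃ ws : List ℕ, 2 ≤ ws.length ∧ ws.sum = U.card ∧ (∀ w ∈ ws, 3 ≤ w ∧ U.card + 2 - w ∈ symLen U) ∧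
      2 * ws.length ∈ symLen U := by
  obtain ⟨F, hF, hFs, hFw⟩ := exists_relation_atoms hU h3 hUe hd hs
  obtain ⟨F', hF', hFs', hFw'⟩ := exists_relation_atoms hU h3 (hUe.trans (add_comm _ _)) hd' hs'
  have h1 : F ≠ 0 := by
    rintro rfl
    have := congrArg Multiset.card hFs
    simp only [Multiset.sum_zero, Multiset.card_zero, Multiset.card_add, Multiset.card_map] at this
    exact hne (Multiset.card_eq_zero.1 (by rw [Multiset.card_add]; omega))
  have h1' : F' ≠ 0 := by
    rintro rfl
    have := congrArg Multiset.card hFs'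
    simp only [Multiset.sum_zero, Multiset.card_zero, Multiset.card_add, Multiset.card_map] at this
    exact hne' (Multiset.card_eq_zero.1 (by rw [Multiset.card_add]; omega))
  have h2 := Multiset.card_pos.2 h1
  have h2' := Multiset.card_pos.2 h1'
  have hlen : (((F + F').map Multiset.card).toList).length = F.card + F'.card := by simp
  refine ⟨((F + F').map Multiset.card).toList, by omega, ?_, ?_, ?_⟩
  · rw [Multiset.sum_toList, Multiset.map_add, Multiset.sum_add, ← card_sum', ← card_sum', hFs, hFs', hUe]
    simp only [Multiset.card_add, Multiset.card_map]
  · intro w hw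
    simp only [Multiset.mem_toList, Multiset.map_add, Multiset.mem_add, Multiset.mem_map] at hw
    rcases hw with ⟨W, hW, rfl⟩ | ⟨W, hW, rfl⟩
    · exact hFw W hW
    · exact hFw' W hW
  · refine mem_lengthSet.2 ⟨F + F' + (F + F').map (Multiset.map Neg.neg), ?_, ?_, ?_⟩
    · simp only [Multiset.card_add, Multiset.card_map, hlen]
      omega
    · intro W hW
      simp only [Multiset.mem_add, Multiset.mem_map] at hW
      rcases hW with (h | h) | ⟨V, h | h, rfl⟩
      · exact hF _ h
      · exact hF' _ h
      · exact (hF _ h).neg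
      · exact (hF' _ h).neg
    · rw [Multiset.sum_add, map_neg_sum, Multiset.sum_add, hFs, hFs', hUe]
      simp only [Multiset.map_add, map_neg_neg]
      abel

theorem exists_two_relations [Finite G] (h4 : ∀ x : G, 4 • x = 0) {ι : Type*} [Fintype ι]
    [DecidableEq ι] (s : ι → G)
    (hs : ∑ i, s i = 0) (hcard : 2 * Nat.card G < 2 ^ Fintype.card ι) :
    ∃ A A' : Finset ι, A ≠ A' ∧ A' ≠ Aᶜ ∧ ∑ i ∈ A \ A', s i = ∑ i ∈ A' \ A, s i ∧
      ∑ i ∈ A ∩ A', s i = ∑ i ∈ (A ∪ A')ᶜ, s i := by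
  classical
  have := Fintype.ofFinite G
  let σ : Finset ι → G := fun A => ∑ i ∈ A, s i
  let K : Finset (Finset ι) := Finset.univ.filter fun A => 2 • σ A = 0
  have hpart : ∀ A B : Finset ι, σ A = σ (A \ B) + σ (A ∩ B) := by
    intro A B
    rw [add_comm]
    exact (Finset.sum_inter_add_sum_sdiff A B s).symm
  have hsymm : ∀ A B : Finset ι, 2 • σ (symmDiff A B) = 2 • σ A + 2 • σ B := by
    intro A B
    have h1 : σ (symmDiff A B) = σ (A \ B) + σ (B \ A) := by
      have : symmDiff A B = A \ B ∪ B \ A := rfl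
      rw [this]
      exact Finset.sum_union (Finset.disjoint_left.2 fun x hx hx' => by simp at hx hx'; exact hx'.2 hx.1)
    rw [h1, hpart A B, hpart B A, Finset.inter_comm B A]
    have := h4 (σ (A ∩ B))
    linear_combination (norm := module) -this
  have hker : 2 ^ Fintype.card ι ≤ K.card * (Finset.univ.image fun x : G => 2 • x).card := by
    have h := Finset.card_le_mul_card_image_of_maps_to (s := (Finset.univ : Finset (Finset ι)))
        (f := fun A => 2 • σ A)
      (t := Finset.univ.image fun x : G => 2 • x) (fun A _ => Finset.mem_image_of_mem _
          (Finset.mem_univ _)) K.card ?_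
    · simpa using h
    · intro c _
      rcases Finset.eq_empty_or_nonempty (Finset.univ.filter fun A => 2 • σ A = c) with he | ⟨B, hB⟩
      · rw [he]; simp
      · refine Finset.card_le_card_of_injOn (fun A => symmDiff A B) ?_ ?_
        · intro A hA
          simp only [Finset.coe_filter, Finset.mem_univ, true_and, Set.mem_ofPred_eq,
              Finset.mem_filter, K] at hA hB ⊢
          rw [hsymm, hA, hB, ← hB, ← add_smul]
          exact h4 _
        · intro A _ A' _ h
          exact symmDiff_left_injective B h
  have hG : (Finset.univ.image fun x : G => 2 • x).card *
      (Finset.univ.filter fun x : G => 2 • x = 0).card = Nat.card G := by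
    have h1 := (nsmulAddMonoidHom (α := G) 2).ker.card_mul_index
    rw [AddSubgroup.index_ker] at h1
    rw [← h1, mul_comm]
    congr 1
    · rw [Nat.card_eq_fintype_card]
      exact (Fintype.card_of_subtype _ fun x => by simp).symm
    · rw [Nat.card_eq_fintype_card]
      exact (Fintype.card_of_subtype _ fun x => by simp).symm
  by_contra! hno
  have hK : K.card ≤ 2 * (Finset.univ.filter fun x : G => 2 • x = 0).card := by
    refine Finset.card_le_mul_card_image_of_maps_to (f := σ) (fun A hA => ?_) 2 ?_
    · simpa [K] using hA
    · intro c hc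
      by_contra! hlt
      obtain ⟨A, B, C, hA, hB, hC, hAB, hAC, hBC⟩ := Finset.two_lt_card_iff.1 hlt
      simp only [Finset.mem_filter, Finset.mem_univ, true_and, K] at hA hB hC
      have key : ∀ A' : Finset ι, A ≠ A' → σ A' = c → A' = Aᶜ := by
        intro A' hne hA'
        by_contra hcompl
        have e1 : ∑ i ∈ A \ A', s i = ∑ i ∈ A' \ A, s i := by
          have h1 := hpart A A'
          have h2 := hpart A' A
          rw [Finset.inter_comm] at h2
          rw [hA.2] at h1
          rw [hA', h1] at h2
          exact add_right_cancel h2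
        refine hno A A' hne hcompl e1 ?_
        have h1 := hpart A A'
        have h2 : σ (A ∪ A')ᶜ + (σ A + σ (A' \ A)) = 0 := by
          have h3 : σ (A ∪ A') = σ A + σ (A' \ A) := by
            rw [← Finset.union_sdiff_self_eq_union]
            exact Finset.sum_union (Finset.disjoint_sdiff)
          rw [← h3, ← hs]
          exact Finset.sum_compl_add_sum _ _
        have h3 := hA.1
        change σ _ = σ _
        have e2 : σ (A \ A') = σ (A' \ A) := e1
        rw [← e2] at h2
        linear_combination (norm := module) h3 - h2 - h1
      exact hBC ((key B hAB hB.2).trans (key C hAC hC.2).symm)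
  have h1 : K.card * (Finset.univ.image fun x : G => 2 • x).card ≤ 2 * Nat.card G := by
    rw [← hG, mul_comm _ (Finset.card (Finset.filter _ _)), ← mul_assoc]
    exact Nat.mul_le_mul_right _ hK
  omega

end Cover
end SetsOfLengths

namespace SetsOfLengths

section ExpFour
variable {G : Type*} [AddCommGroup G]

theorem card_relation_ne {U A B : Multiset G} (hU : Atom U) (h3 : 2 < U.card) (hle : A + B ≤ U)
    (hd : ∀ a ∈ A, a ∉ B)
    (hs : A.sum = B.sum) : A.card + B.card = 0 ∨ 3 ≤ A.card + B.card := by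
  obtain ⟨X, hX⟩ := Multiset.le_iff_exists_add.1 hle
  obtain ⟨F, -, hFs, hFw⟩ := exists_relation_atoms hU h3 hX hd hs
  have hc : F.sum.card = A.card + B.card := by rw [hFs, Multiset.card_add, Multiset.card_map]
  rcases Multiset.empty_or_exists_mem F with rfl | ⟨W, hW⟩
  · left; simpa using hc.symm
  · right
    rw [← hc]
    exact (hFw W hW).1.trans
        (Multiset.card_le_card (Multiset.single_le_sum (fun _ _ => Multiset.zero_le _) W hW))

/-- No factorization of a sequence of length `D` into at least two relations is compatible with the
set of lengths `p`. -/
def coverFree (D : ℕ) (p : List ℕ) : Bool :=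
  let ok := fun w => decide (3 ≤ w) && p.contains (D + 2 - w)
  (!p.contains 4 || (List.range (D + 1)).all fun a => !(ok a && ok (D - a))) &&
  (!p.contains 6 || (List.range (D + 1)).all fun a => (List.range (D + 1)).all fun b =>
    !(ok a && ok b && ok (D - a - b)))

theorem false_of_coverFree {D : ℕ} (hD : D ≤ 11) {p : List ℕ} (h : coverFree D p = true)
    {ws : List ℕ} (h2 : 2 ≤ ws.length)
    (hs : ws.sum = D) (hw : ∀ w ∈ ws, 3 ≤ w ∧ D + 2 - w ∈ p) (hp : 2 * ws.length ∈ p) : False := by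
  simp only [coverFree, Bool.and_eq_true, Bool.or_eq_true, Bool.not_eq_true', List.contains_eq_mem,
      decide_eq_false_iff_not,
    List.all_eq_true, List.mem_range, Bool.and_eq_false_iff] at h
  match ws, h2 with
  | [a, b], _ =>
    simp only [List.sum_cons, List.sum_nil, List.mem_cons, List.not_mem_nil, or_false,
        forall_eq_or_imp, forall_eq] at hs hw
    rcases h.1 with h | h
    · exact h (by simpa using hp)
    · have := h a (by omega)
      rw [show D - a = b by omega] at this
      tauto
  | [a, b, c], _ =>
    simp only [List.sum_cons, List.sum_nil, List.mem_cons, List.not_mem_nil, or_false,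
        forall_eq_or_imp, forall_eq] at hs hw
    rcases h.2 with h | h
    · exact h (by simpa using hp)
    · have := h a (by omega) b (by omega)
      rw [show D - a - b = c by omega] at this
      tauto
  | a :: b :: c :: d :: l, _ =>
    simp only [List.sum_cons, List.mem_cons, forall_eq_or_imp] at hs hw
    omega

theorem MaxAtom.count_eq_of_coverFree [DecidableEq G] {U : Multiset G} (hU : MaxAtom U)
    (h3 : 2 < U.card) (h11 : U.card ≤ 11)
    (h4 : ∀ x : G, 4 • x = 0) (hG : U.card < Nat.card G) {p : List ℕ} (hp : ∀ k ∈ symLen U, k ∈ p)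
    (hcov : coverFree U.card p = true) {g : G} (hg : g ∈ U) : U.count g = 1 ∨ U.count g = 3 := by
  have hc := Multiset.count_pos.2 hg
  obtain ⟨g₂, hg₂, hne⟩ : ∃ g₂ ∈ U, g₂ ≠ g := by
    by_contra! hall
    have := hU.card_le_of_forall_eq (by omega) hall
    omega
  obtain ⟨T, R, hUe, hgR, hgT, -, hgs, hs, -, -⟩ := hU.exists_relation h3 hg hg₂ hne
  by_contra! hno
  rcases Nat.lt_or_ge (U.count g) 4 with hlt | hge
  · have h2 : U.count g = 2 := by omega
    rw [h2] at hs hUe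
    have hgR' : g = R.sum := by
      have := h4 g
      linear_combination (norm := module) this - hs
    obtain ⟨ws, h1, h2, h3, h4⟩ := exists_cover (Q := {g}) (R := R) (P := {g}) (S := g₂ ::ₘ T) hU.1 h3
      (by
        nth_rewrite 1 [hUe]
        rw [Multiset.replicate_succ, Multiset.replicate_one, ← Multiset.singleton_add g {g}]
        abel)
      (by simpa using hgR) (by simpa using ⟨Ne.symm hne,
          hgT⟩) (by simpa using hgR') (by simpa using hgs) (by simp) (by simp)
    exact false_of_coverFree h11 hcov h1 h2 (fun w hw => ⟨(h3 w hw).1, hp _ (h3 w hw).2⟩) (hp _ h4)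
  · have := hU.1.2.2 _ (Multiset.le_count_iff_replicate_le.1 hge) (by simp)
      (by rw [Multiset.sum_replicate, h4])
    rw [← this] at hg₂
    exact hne (Multiset.eq_of_mem_replicate hg₂)

theorem MaxAtom.mem_symLen_of_triples {U Y : Multiset G} (hU : MaxAtom U) (h3 : 2 < U.card)
    (h4 : ∀ x : G, 4 • x = 0) (hY : 3 • Y ≤ U) (hY0 : Y ≠ 0) : 2 * Y.card + 2 ∈ symLen U := by
  have h0 := hU.zero_notMem h3
  obtain ⟨B, hB⟩ := Multiset.le_iff_exists_add.1 hY
  have hUe : U = Y + B + 2 • Y := by rw [hB]; module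
  have hsum : ∀ Z : Multiset G, (3 • Z).sum = -Z.sum := by
    intro Z
    rw [Multiset.sum_nsmul, eq_neg_iff_add_eq_zero, ← succ_nsmul]
    exact h4 _
  have := relation_atom_mem hUe h0 ⟨by simp [hY0], ?_, ?_⟩
  · simpa [mul_comm] using this
  · have := hU.1.2.1
    rw [hB, Multiset.sum_add, hsum] at this
    rw [Multiset.sum_add, sum_map_neg]
    linear_combination (norm := module) -this
  · classical
    intro W hW hW0 hWs
    obtain ⟨Y₁, B', hY₁, hB', rfl⟩ : ∃ A B', A ≤ Y ∧ B' ≤ B.map Neg.neg ∧ A + B' = W :=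
      ⟨W ⊓ Y, W - W ⊓ Y, inf_le_right, by
        rw [Multiset.le_iff_count] at hW ⊢
        intro a
        have h1 := hW a
        have h2 : Multiset.count a (W ⊓ Y) = min (Multiset.count a W) (Multiset.count a Y) := Multiset.count_inter a W Y
        rw [Multiset.count_add] at h1
        rw [Multiset.count_sub, h2]
        omega, add_tsub_cancel_of_le inf_le_left⟩
    obtain ⟨B₁, hB₁, rfl⟩ := le_map_iff.1 hB'
    have hle : 3 • Y₁ + B₁ ≤ U := hB ▸ add_le_add (nsmul_le_nsmul_right hY₁ 3) hB₁
    have hz : (3 • Y₁ + B₁).sum = 0 := by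
      rw [Multiset.sum_add, sum_map_neg] at hWs
      rw [Multiset.sum_add, hsum]
      linear_combination (norm := module) -hWs
    have hne : 3 • Y₁ + B₁ ≠ 0 := by
      intro h
      have := congrArg Multiset.card h
      simp only [Multiset.card_add, Multiset.card_nsmul, Multiset.card_zero] at this
      exact hW0 (Multiset.card_eq_zero.1 (by rw [Multiset.card_add, Multiset.card_map]; omega))
    have he := congrArg Multiset.card (hU.1.2.2 _ hle hne hz)
    rw [hB] at he
    simp only [Multiset.card_add, Multiset.card_nsmul] at he
    have h1 := Multiset.card_le_card hY₁
    have h2 := Multiset.card_le_card hB₁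
    rw [Multiset.eq_of_le_of_card_le hY₁ (by omega), Multiset.eq_of_le_of_card_le hB₁ (by omega)]

theorem sum_disjoint {α ι : Type*} [DecidableEq ι] [Fintype ι] (M : ι → Multiset α) (A A' : Finset ι) :
    ∑ i, M i = ∑ i ∈ A \ A', M i + ∑ i ∈ A' \ A, M i + (∑ i ∈ A ∩ A', M i + ∑ i ∈ (A ∪ A')ᶜ, M i) := by
  rw [← Finset.sum_compl_add_sum (A ∪ A'), ← Finset.union_sdiff_self_eq_union,
      Finset.sum_union Finset.disjoint_sdiff,
    ← Finset.sum_inter_add_sum_sdiff A A']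
  abel

theorem four_empty {ι : Type*} [DecidableEq ι] {A A' : Finset ι} (h1 : A ≠ A') :
    (A \ A').Nonempty ∨ (A' \ A).Nonempty := by
  by_contra! h
  simp only [Finset.sdiff_eq_empty_iff_subset] at h
  exact h1 (Finset.Subset.antisymm h.1 h.2)

theorem four_empty' {ι : Type*} [DecidableEq ι] [Fintype ι] {A A' : Finset ι} (h2 : A' ≠ Aᶜ) :
    (A ∩ A').Nonempty ∨ (A ∪ A')ᶜ.Nonempty := by
  by_contra! h
  apply h2
  ext x
  have e1 : x ∉ A ∩ A' := by rw [h.1]; simp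
  have e2 : x ∉ (A ∪ A')ᶜ := by rw [h.2]; simp
  simp only [Finset.mem_inter, Finset.mem_compl, Finset.mem_union] at *
  tauto

theorem map_sum_blocks {ι : Type*} (M : ι → Multiset G) (A : Finset ι) :
    (∑ i ∈ A, M i).sum = ∑ i ∈ A, (M i).sum :=
  map_sum Multiset.sumAddMonoidHom M A

theorem MaxAtom.two_pow_le_coarse [DecidableEq G] [Finite G] {U : Multiset G} (hU : MaxAtom U)
    (h3 : 2 < U.card)
    (h11 : U.card ≤ 11) (h4 : ∀ x : G, 4 • x = 0) {p : List ℕ} (hp : ∀ k ∈ symLen U, k ∈ p)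
    (hcov : coverFree U.card p = true) : 2 ^ U.toFinset.card ≤ 2 * Nat.card G := by
  by_contra! hlt
  let M : U.toFinset → Multiset G := fun g => Multiset.replicate (U.count g.1) g.1
  have hM : ∑ i, M i = U := by
    conv_rhs => rw [← Multiset.toFinset_sum_count_nsmul_eq U]
    rw [← Finset.sum_coe_sort U.toFinset]
    exact Finset.sum_congr rfl fun i _ => by rw [Multiset.nsmul_singleton]
  have hmem : ∀ (A : Finset U.toFinset) (a : G), a ∈ ∑ i ∈ A, M i → ∃ i ∈ A, i.1 = a := by
    intro A a ha
    obtain ⟨i, hi, h⟩ := Multiset.mem_sum.1 ha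
    exact ⟨i, hi, (Multiset.eq_of_mem_replicate h).symm⟩
  have hdis : ∀ A B : Finset U.toFinset, (∀ i ∈ A, i ∉ B) → ∀ a ∈ ∑ i ∈ A, M i, a ∉ ∑ i ∈ B, M i := by
    intro A B h a ha hb
    obtain ⟨i, hi, rfl⟩ := hmem A a ha
    obtain ⟨j, hj, hij⟩ := hmem B _ hb
    exact h i hi (Subtype.ext hij ▸ hj)
  have hne : ∀ A : Finset U.toFinset, A.Nonempty → ∑ i ∈ A, M i ≠ 0 := by
    rintro A ⟨i, hi⟩ h0
    have : i.1 ∈ ∑ i ∈ A, M i := Multiset.mem_sum.2 ⟨i, hi, Multiset.mem_replicate.2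
      ⟨(Multiset.count_pos.2 (Multiset.mem_toFinset.1 i.2)).ne', rfl⟩⟩
    rw [h0] at this
    exact Multiset.notMem_zero _ this
  obtain ⟨A, A', h1, h2, h3', h4'⟩ := exists_two_relations h4 (fun i => (M i).sum)
    (by rw [← map_sum_blocks, hM, hU.1.2.1]) (by rwa [Fintype.card_coe])
  obtain ⟨ws, e1, e2, e3, e4⟩ := exists_cover hU.1 h3 (hM.symm.trans (sum_disjoint M A A'))
    (hdis _ _ (by simp +contextual)) (hdis _ _ (by simp +contextual)) (by simpa only [map_sum_blocks] using h3')
    (by simpa only [map_sum_blocks] using h4')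
    (fun h => by
      rw [add_eq_zero] at h
      rcases four_empty h1 with h' | h'
      · exact hne _ h' h.1
      · exact hne _ h' h.2)
    (fun h => by
      rw [add_eq_zero] at h
      rcases four_empty' h2 with h' | h'
      · exact hne _ h' h.1
      · exact hne _ h' h.2)
  exact false_of_coverFree h11 hcov e1 e2 (fun w hw => ⟨(e3 w hw).1, hp _ (e3 w hw).2⟩) (hp _ e4)

theorem MaxAtom.two_pow_le_fine [DecidableEq G] [Finite G] {U : Multiset G} (hU : MaxAtom U) (h3 : 2 < U.card)
    (h4 : ∀ x : G, 4 • x = 0) {fb : List ℕ} (hrel : NoRel U fb) (hfb : ∀ w, 3 ≤ w → 2 * w ≤ U.card → w ∈ fb)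
    (hc : ∀ g ∈ U, U.count g = 1 ∨ U.count g = 3) :
    2 ^ (U.toFinset.card + (U.toFinset.filter fun g => U.count g = 3).card) ≤ 2 * Nat.card G := by
  by_contra! hlt
  let X : Finset G := U.toFinset.filter fun g => U.count g = 3
  let M : U.toFinset ⊕ X → Multiset G := Sum.elim (fun g => {g.1}) (fun g => {g.1, g.1})
  have hM : ∑ i, M i = U := by
    rw [Fintype.sum_sum_type]
    simp only [M, Sum.elim_inl, Sum.elim_inr]
    rw [Finset.sum_coe_sort U.toFinset fun g => ({g} : Multiset G),
        Finset.sum_coe_sort X fun g => ({g, g} : Multiset G),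
      Finset.sum_filter, ← Finset.sum_add_distrib]
    conv_rhs => rw [← Multiset.toFinset_sum_count_nsmul_eq U]
    refine Finset.sum_congr rfl fun g hg => ?_
    rcases hc g (Multiset.mem_toFinset.1 hg) with h | h
    · simp [h]
    · rw [if_pos h, h, Multiset.nsmul_singleton]
      rfl
  have hcount : ∀ (A : Finset (U.toFinset ⊕ X)) (g : G), Multiset.count g (∑ i ∈ A,
      M i) = ∑ i ∈ A, Multiset.count g (M i) :=
    fun A g => Multiset.count_sum'
  have hnot : ∀ A B : Finset (U.toFinset ⊕ X), (∀ i ∈ A, i ∉ B) → ∑ i ∈ A, M i = ∑ i ∈ B, M i → A = ∅ := by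
    intro A B hd he
    have hinl : ∀ A B : Finset (U.toFinset ⊕ X), (∀ i ∈ A,
        i ∉ B) → ∑ i ∈ A, M i = ∑ i ∈ B, M i → ∀ g, Sum.inl g ∉ A := by
      intro A B hd he g hg
      have h1 := congrArg (Multiset.count g.1) he
      rw [hcount, hcount, ← Finset.add_sum_erase _ _ hg] at h1
      have hev : ∀ i, i ≠ Sum.inl g → 2 ∣ Multiset.count g.1 (M i) := by
        rintro (i | i) hi
        · have : g.1 ≠ i.1 := fun h => hi (by rw [Subtype.ext h])
          simp [M, this]
        · by_cases h : g.1 = i.1 <;> simp [M, h]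
      have d1 := Finset.dvd_sum (s := A.erase (Sum.inl g)) (f := fun i => Multiset.count g.1 (M i)) (a := 2)
        fun i hi => hev i (Finset.ne_of_mem_erase hi)
      have d2 := Finset.dvd_sum (s := B) (f := fun i => Multiset.count g.1 (M i)) (a := 2)
        fun i hi => hev i fun h => hd _ hg (h ▸ hi)
      have h2 : Multiset.count g.1 (M (Sum.inl g)) = 1 := by simp [M]
      omega
    refine Finset.eq_empty_of_forall_notMem ?_
    rintro (g | g) hg
    · exact hinl A B hd he g hg
    · have hmem : g.1 ∈ ∑ i ∈ B, M i := he ▸ Multiset.mem_sum.2 ⟨_, hg, by simp [M]⟩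
      obtain ⟨i, hi, hgi⟩ := Multiset.mem_sum.1 hmem
      rcases i with i | i
      · exact hinl B A (fun i hi hi' => hd i hi' hi) he.symm i hi
      · have : g = i := Subtype.ext (by simpa [M] using hgi)
        subst this
        exact hd _ hg hi
  have hbig : ∀ A B : Finset (U.toFinset ⊕ X), (∀ i ∈ A, i ∉ B) → A.Nonempty ∨ B.Nonempty →
      ∑ i ∈ A, M i + ∑ i ∈ B, M i ≤ U → (∑ i ∈ A, M i).sum = (∑ i ∈ B, M i).sum →
      U.card < 2 * (∑ i ∈ A, M i + ∑ i ∈ B, M i).card := by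
    intro A B hd hne hle hs
    generalize hA : ∑ i ∈ A, M i = a at *
    generalize hB : ∑ i ∈ B, M i = b at *
    have hsub : (a - b) + (b - a) ≤ U := le_trans (add_le_add tsub_le_self tsub_le_self) hle
    have hdis : ∀ x ∈ a - b, x ∉ b - a := by
      intro x h1 h2
      rw [← Multiset.count_pos, Multiset.count_sub] at h1 h2
      omega
    have hsum : (a - b).sum = (b - a).sum := by
      have e1 : a - b + a ⊓ b = a := Multiset.sub_add_inter a b
      have e2 : b - a + b ⊓ a = b := Multiset.sub_add_inter b a
      rw [inf_comm] at e2
      have e1' := congrArg Multiset.sum e1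
      have e2' := congrArg Multiset.sum e2
      rw [Multiset.sum_add] at e1' e2'
      rw [← e2', ← e1'] at hs
      exact add_right_cancel hs
    have hle2 : (a - b).card + (b - a).card ≤ (a + b).card := by
      rw [Multiset.card_add]
      exact Nat.add_le_add (Multiset.card_le_card tsub_le_self) (Multiset.card_le_card tsub_le_self)
    rcases card_relation_ne hU.1 h3 hsub hdis hsum with h | h
    · have h1 : a ≤ b := tsub_eq_zero_iff_le.1 (Multiset.card_eq_zero.1 (by omega))
      have h2 : b ≤ a := tsub_eq_zero_iff_le.1 (Multiset.card_eq_zero.1 (by omega))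
      have he := le_antisymm h1 h2
      rw [← hA, ← hB] at he
      rcases hne with h' | h'
      · rw [hnot A B hd he] at h'
        exact absurd h' (by simp)
      · rw [hnot B A (fun i hi hi' => hd i hi' hi) he.symm] at h'
        exact absurd h' (by simp)
    · by_contra! hlt
      exact hrel _ _ hsub hdis hsum (hfb _ h (by omega))
  obtain ⟨A, A', h1, h2, h3', h4'⟩ := exists_two_relations h4 (fun i => (M i).sum)
    (by rw [← map_sum_blocks, hM, hU.1.2.1]) (by
      rw [Fintype.card_sum, Fintype.card_coe, Fintype.card_coe]
      exact hlt)
  have hUe := hM.symm.trans (sum_disjoint M A A')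
  have c1 := hbig (A \ A') (A' \ A) (by simp +contextual) (four_empty h1)
      ((Multiset.le_add_right _ _).trans hUe.symm.le)
    (by simpa only [map_sum_blocks] using h3')
  have c2 := hbig (A ∩ A') (A ∪ A')ᶜ (by simp +contextual) (four_empty' h2)
      ((Multiset.le_add_left _ _).trans hUe.symm.le)
    (by simpa only [map_sum_blocks] using h4')
  have := congrArg Multiset.card hUe
  rw [Multiset.card_add] at this
  omega

/-- Obstruction for a group of exponent at most four and order `N`. -/
def expFourKill (D : ℕ) (p : List ℕ) (N : ℕ) : Bool :=
  coverFree D p && (List.range (D + 1)).all fun b =>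
    (List.range (b + 1)).any (fun j => decide (1 ≤ j) && !p.contains (2 * j + 2)) ||
    decide (2 * N < 2 ^ (D - 2 * b)) ||
    (decide (2 * N < 2 ^ (D - b)) &&
      (List.range (D + 1)).all fun f => (List.range (f + 1)).all fun a =>
        decide (D < 2 * f) || decide (a ≤ 2) || !p.contains (D + 2 - a) || decide (3 ≤ f - a))

theorem MaxAtom.false_of_expFourKill [Finite G] {U : Multiset G} (hU : MaxAtom U) (h3 : 2 < U.card)
    (h11 : U.card ≤ 11)
    (h4 : ∀ x : G, 4 • x = 0) (hG : U.card < Nat.card G) {p : List ℕ} (hp : ∀ k ∈ symLen U, k ∈ p)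
    (hk : expFourKill U.card p (Nat.card G) = true) : False := by
  classical
  simp only [expFourKill, Bool.and_eq_true, List.all_eq_true, List.mem_range, Bool.or_eq_true,
      List.any_eq_true,
    decide_eq_true_eq, Bool.not_eq_true', List.contains_eq_mem, decide_eq_false_iff_not] at hk
  obtain ⟨hcov, hk⟩ := hk
  have hc : ∀ g ∈ U, U.count g = 1 ∨ U.count g = 3 := fun g hg => hU.count_eq_of_coverFree h3 h11 h4 hG hp hcov hg
  have hcard : U.card = U.toFinset.card + 2 * (U.toFinset.filter fun g => U.count g = 3).card := by
    rw [← Multiset.toFinset_sum_count_eq, Finset.card_filter, Finset.card_eq_sum_ones,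
        Finset.mul_sum, ← Finset.sum_add_distrib]
    refine Finset.sum_congr rfl fun g hg => ?_
    rcases hc g (Multiset.mem_toFinset.1 hg) with h | h <;> simp [h]
  set X := U.toFinset.filter fun g => U.count g = 3 with hX
  rcases hk X.card (by omega) with (⟨j, hj, hj1, hjp⟩ | h) | ⟨h, hfb⟩
  · obtain ⟨Y, hY, rfl⟩ := Finset.exists_subset_card_eq (show j ≤ X.card by omega)
    refine hjp (hp _ (hU.mem_symLen_of_triples (Y := Y.val) h3 h4 ?_ ?_))
    · rw [Multiset.le_iff_count]
      intro a
      rw [Multiset.count_nsmul]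
      by_cases ha : a ∈ Y
      · have h1 : U.count a = 3 := (Finset.mem_filter.1 (hY ha)).2
        have h2 := Multiset.nodup_iff_count_le_one.1 Y.nodup a
        omega
      · rw [Multiset.count_eq_zero.2 ha]
        simp
    · intro h
      have := congrArg Multiset.card h
      simp only [Finset.card_val, Multiset.card_zero] at this
      omega
  · have := hU.two_pow_le_coarse h3 h11 h4 hp hcov
    rw [show U.card - 2 * X.card = U.toFinset.card by omega] at h
    omega
  · have hrel : NoRel U ((List.range (U.card + 1)).filter fun w => decide (3 ≤ w ∧ 2 * w ≤ U.card)) := by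
      refine noRel_of_symLen hU.1 hp fun f hf => ?_
      simp only [List.mem_filter, List.mem_range, decide_eq_true_eq] at hf ⊢
      refine ⟨by omega, by omega, fun a ha ha2 hap => ?_⟩
      have := hfb f hf.1 a ha
      rcases this with ((h | h) | h) | h
      · omega
      · omega
      · exact absurd hap h
      · omega
    have := hU.two_pow_le_fine h3 h4 hrel (fun w h1 h2 => by simp; omega) hc
    rw [← hX] at this
    rw [show U.card - X.card = U.toFinset.card + X.card by omega] at h
    omega

end ExpFour
end SetsOfLengths

namespace SetsOfLengths
open Multiset

section Cyclic
variable {G : Type*} [AddCommGroup G]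

theorem Atom.sum_take_injective {l : List G} (h : Atom (l : Multiset G)) :
    Function.Injective fun i : Fin l.length => (l.take (i + 1)).sum := by
  have key : ∀ i j : ℕ, 0 < i → 0 < j → i + j ≤ l.length → (l.take i).sum ≠ (l.take (i + j)).sum := by
    intro i j hi hj hij he
    rw [List.take_add, List.sum_append, left_eq_add] at he
    have hle : ((List.take j (List.drop i l) : List G) : Multiset G) ≤ l :=
      Multiset.coe_le.2 ((List.take_sublist _ _).trans (List.drop_sublist _ _)).subperm
    have hc : (List.take j (List.drop i l)).length = j := by
      rw [List.length_take, List.length_drop]; omega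
    have := h.2.2 _ hle (by rw [← Multiset.card_pos, Multiset.coe_card, hc]; exact hj)
      (by rw [Multiset.sum_coe]; exact he)
    have := congrArg Multiset.card this
    rw [Multiset.coe_card, Multiset.coe_card, hc] at this
    omega
  intro i j hij
  by_contra hne
  have hi := i.2
  have hj := j.2
  rcases lt_or_gt_of_ne hne with hlt | hlt
  · refine key (i + 1) (j - i) (by omega) (by omega) (by omega) ?_
    rw [show i.val + 1 + (j.val - i.val) = j.val + 1 by omega]
    exact hij
  · refine key (j + 1) (i - j) (by omega) (by omega) (by omega) ?_
    rw [show j.val + 1 + (i.val - j.val) = i.val + 1 by omega]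
    exact hij.symm

/-- An atom whose length is the order of the group is constant. -/
theorem Atom.eq_replicate [Finite G] {U : Multiset G} (h : Atom U) (hc : U.card = Nat.card G) :
    ∃ g, U = replicate U.card g := by
  have : Fintype G := Fintype.ofFinite G
  by_contra! hne
  obtain ⟨g, hg⟩ := Multiset.exists_mem_of_ne_zero h.1
  obtain ⟨S, rfl⟩ := Multiset.exists_cons_of_mem hg
  obtain ⟨x, hx, hxg⟩ : ∃ x ∈ S, x ≠ g := by
    by_contra! hall
    apply hne g
    rw [Multiset.card_cons, Multiset.replicate_succ, Multiset.cons_inj_right]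
    exact Multiset.eq_replicate.2 ⟨rfl, hall⟩
  obtain ⟨S, rfl⟩ := Multiset.exists_cons_of_mem hx
  obtain ⟨s, rfl⟩ := Quot.exists_rep S
  have h' : Atom ((g :: x :: s : List G) : Multiset G) := h
  have hsurj : Function.Surjective fun i : Fin (g :: x :: s).length => ((g :: x :: s).take (i + 1)).sum := by
    refine ((Fintype.bijective_iff_injective_and_card _).2 ⟨h'.sum_take_injective, ?_⟩).2
    rw [Fintype.card_fin, ← Nat.card_eq_fintype_card, ← hc]
    simp
  obtain ⟨⟨i, hi⟩, hie⟩ := hsurj x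
  rcases i with _ | i
  · exact hxg (by simpa using hie.symm)
  · simp only [List.take_succ_cons, List.sum_cons] at hie
    have h0 : g + (s.take i).sum = 0 := by
      have : g + (x + (s.take i).sum) = x + (g + (s.take i).sum) := by abel
      rw [this] at hie
      simpa using hie
    have hle : ((g :: s.take i : List G) : Multiset G) ≤ ((g :: x :: s : List G) : Multiset G) :=
      Multiset.coe_le.2 (((List.take_sublist i s).trans (List.sublist_cons_self x s)).cons_cons g).subperm
    have := congrArg Multiset.card
        (h'.2.2 _ hle (by simp) (by rw [Multiset.sum_coe, List.sum_cons]; exact h0))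
    simp only [Multiset.coe_card, List.length_cons, List.length_take] at this
    omega

theorem sum_card_add_count [DecidableEq G] {n : ℕ} (hn : 1 ≤ n) {F : Multiset (Multiset G)}
    (hF : ∀ A ∈ F, Atom A)
    (hmax : ∀ A ∈ F, A.card ≤ n) :
    2 * F.card ≤ F.sum.card + F.sum.count 0 ∧ F.sum.card + (n - 1) * F.sum.count 0 ≤ n * F.card := by
  induction F using Multiset.induction with
  | empty => simp
  | cons A F ih =>
    obtain ⟨h1, h2⟩ := ih (fun B hB => hF B (by simp [hB])) (fun B hB => hmax B (by simp [hB]))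
    have hA := hF A (by simp)
    have hAn := hmax A (by simp)
    have h3 : 2 ≤ A.card + A.count 0 ∧ A.card + (n - 1) * A.count 0 ≤ n := by
      by_cases h0 : (0 : G) ∈ A
      · rw [hA.eq_singleton_zero h0]
        simp
        omega
      · have := hA.two_le_card h0
        rw [Multiset.count_eq_zero.2 h0]
        simp
        omega
    rw [Multiset.sum_cons, Multiset.card_add, Multiset.count_add, Multiset.card_cons]
    simp only [mul_add, mul_one]
    omega

theorem exists_pairs_of_card_le {F : Multiset (Multiset G)} (hF : ∀ A ∈ F, Atom A) (h2 : ∀ A ∈ F, 2 ≤ A.card)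
    (hs : F.sum.card ≤ 2 * F.card + 1) :
    ∃ C T : Multiset G, F.sum = C + C.map Neg.neg + T ∧ T.card ≤ 3 ∧ (F.sum.card ≤ 2 * F.card → T = 0) := by
  by_cases hle : F.sum.card ≤ 2 * F.card
  · obtain ⟨C, hC⟩ := pairs_of_card_two hF (two_of_sum_le h2 hle)
    exact ⟨C, 0, by rw [hC, add_zero], by simp, fun _ => rfl⟩
  · obtain ⟨A, hA, hA3⟩ : ∃ A ∈ F, 2 < A.card := by
      by_contra! hall
      apply hle
      rw [card_sum', mul_comm, ← smul_eq_mul, ← Multiset.card_map Multiset.card F]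
      refine Multiset.sum_le_card_nsmul _ _ fun c hc => ?_
      obtain ⟨A, hA, rfl⟩ := Multiset.mem_map.1 hc
      exact hall A hA
    obtain ⟨F, rfl⟩ := Multiset.exists_cons_of_mem hA
    rw [Multiset.sum_cons, Multiset.card_add, Multiset.card_cons] at hs hle
    have h2' : ∀ B ∈ F, 2 ≤ B.card := fun B hB => h2 B (by simp [hB])
    obtain ⟨C, hC⟩ := pairs_of_card_two (fun B hB => hF B (by simp [hB])) (two_of_sum_le h2' (by omega))
    refine ⟨C, A, by rw [Multiset.sum_cons, hC, add_comm], ?_, fun h => absurd h ?_⟩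
    · have : 2 * F.card ≤ F.sum.card := by
        rw [card_sum', mul_comm, ← smul_eq_mul, ← Multiset.card_map Multiset.card F]
        refine Multiset.card_nsmul_le_sum fun c hc => ?_
        obtain ⟨B, hB, rfl⟩ := Multiset.mem_map.1 hc
        exact h2' B hB
      omega
    · rw [Multiset.sum_cons, Multiset.card_add, Multiset.card_cons]
      exact hle

theorem count_pairs [DecidableEq G] (C T : Multiset G) (x : G) :
    (C + C.map Neg.neg + T).count x + T.count (-x) = (C + C.map Neg.neg + T).count (-x) + T.count x := by
  simp only [Multiset.count_add, count_neg, neg_neg]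
  omega

theorem Atom.neg_notMem [DecidableEq G] {A : Multiset G} (hA : Atom A) (h3 : 2 < A.card) {x : G}
    (hx : x ∈ A) (hne : -x ≠ x) :
    -x ∉ A := fun h =>
  hA.no_pair h3 x (pair_le hne (Multiset.count_pos.2 hx) (Multiset.count_pos.2 h))

theorem Atom.neg_ne_of_replicate {n : ℕ} (hn : 3 ≤ n) {g : G} (hA : Atom (replicate n g)) : -g ≠ g := by
  classical
  intro h
  exact hA.no_pair (by simp; omega) g (double_le h (by simp; omega))

theorem cyclic_three_atoms [Finite G] {n : ℕ} (hn : 4 ≤ n) (hG : Nat.card G = n) {U V A C T : Multiset G}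
    (hU : Atom U) (hV : Atom V) (hA : Atom A) (hcU : U.card = n) (hcV : V.card = n) (hcA : A.card ≤ n)
    (h : U + V + A = C + C.map Neg.neg + T) (hT : T.card ≤ 3) (hA' : A.card + 1 = n → n % 2 = 1)
    (hA1 : n ≤ A.card + 1) (hT0 : n % 2 = 0 → T = 0) : False := by
  classical
  obtain ⟨g, hg⟩ := hU.eq_replicate (by rw [hcU, hG])
  obtain ⟨k, hk⟩ := hV.eq_replicate (by rw [hcV, hG])
  rw [hcU] at hg
  rw [hcV] at hk
  subst hg hk
  have hgg := hU.neg_ne_of_replicate (by omega)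
  have hkk := hV.neg_ne_of_replicate (by omega)
  have hcount := count_pairs C T
  rw [← h] at hcount
  have c1 := fun x => (Multiset.count_le_card x T)
  have c2 := fun x => (Multiset.count_le_card x A)
  have hpair : ∀ (x y : G), x ≠ y → ∀ W : Multiset G, W.count x + W.count y ≤ W.card := by
    intro x y hxy W
    have : replicate (W.count x) x + replicate (W.count y) y ≤ W := by
      refine Multiset.le_iff_count.2 fun z => ?_
      rw [Multiset.count_add, Multiset.count_replicate, Multiset.count_replicate]
      split_ifs with h1 h2 h2
      · exact absurd (h1.trans h2.symm) hxy
      · subst h1; omega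
      · subst h2; omega
      · omega
    simpa using Multiset.card_le_card this
  by_cases h1 : k = g
  · subst h1
    have := hcount k
    simp only [Multiset.count_add, Multiset.count_replicate, if_true, if_neg hgg.symm] at this
    have := c1 k
    have := c2 (-k)
    omega
  by_cases h2 : k = -g
  · subst h2
    have hc : ∀ x, A.count x + T.count (-x) = A.count (-x) + T.count x := by
      intro x
      have := hcount x
      simp only [Multiset.count_add, Multiset.count_replicate, neg_inj] at this
      have e : (g = -x) = (-g = x) := by rw [neg_eq_iff_eq_neg]
      simp only [e] at this
      omega
    by_cases hpar : n % 2 = 0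
    · have hT := hT0 hpar
      subst hT
      obtain ⟨a, ha⟩ := hA.eq_replicate (by rw [hG]; omega)
      have hcA' : A.card = n := by omega
      rw [hcA'] at ha
      subst ha
      have h3 := hA.neg_ne_of_replicate (by omega)
      have := hc a
      simp only [Multiset.count_replicate, if_true, if_neg h3.symm, Multiset.count_zero] at this
      omega
    · have hle : A ≤ T := by
        refine Multiset.le_iff_count.2 fun x => ?_
        by_cases hx : x ∈ A
        · have hxx : -x ≠ x := by
            intro he
            have e2 : 2 • x = 0 := by rw [two_nsmul]; nth_rewrite 1 [← he]; exact neg_add_cancel x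
            have e1 : n • x = 0 := by rw [← hG]; exact card_nsmul_eq_zero'
            have : x = 0 := by
              rw [show n = (n / 2) * 2 + 1 by omega, add_nsmul, mul_nsmul', e2, smul_zero, zero_add,
                  one_nsmul] at e1
              exact e1
            exact hA.zero_notMem (by omega) (this ▸ hx)
          have h0 := Multiset.count_eq_zero.2 (hA.neg_notMem (by omega) hx hxx)
          have := hc x
          omega
        · rw [Multiset.count_eq_zero.2 hx]; omega
      have := Multiset.card_le_card hle
      omega
  · have e1 := hcount g
    have e2 := hcount k
    have n1 : ¬ k = -g := h2
    have n2 : ¬ g = -k := fun h => h2 (by rw [h, neg_neg])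
    simp only [Multiset.count_add, Multiset.count_replicate, if_true, if_neg hgg.symm,
        if_neg hkk.symm, if_neg n1,
      if_neg n2, if_neg h1, if_neg (Ne.symm h1)] at e1 e2
    have e3 := hpair (-g) (-k) (fun h => h1 (neg_inj.1 h).symm) A
    have e4 := hpair g k (Ne.symm h1) T
    omega

theorem false_of_card_eq [Finite G] {n : ℕ} (hn : 4 ≤ n) (hG : Nat.card G = n)
    (hmax : ∀ A : Multiset G, Atom A → A.card ≤ n) {L : Set ℕ} (hL : L ∈ SystemSets G) (h3 : 3 ∈ L)
    (hk : 3 * n / 2 ∈ L) : False := by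
  classical
  obtain ⟨B, hB, rfl⟩ := hL
  obtain ⟨F, hF3, hF, rfl⟩ := mem_lengthSet.1 h3
  obtain ⟨E, hEk, hE, hs⟩ := mem_lengthSet.1 hk
  have b1 := (sum_card_add_count (n := n) (by omega) hF fun A hA => hmax A (hF A hA)).2
  have b2 := (sum_card_add_count (n := n) (by omega) hE fun A hA => hmax A (hE A hA)).1
  rw [hs] at b2
  rw [hF3] at b1
  have h0 : F.sum.count 0 = 0 := by
    by_contra h
    obtain ⟨z, hz⟩ : ∃ z, F.sum.count 0 = z + 1 := ⟨_, (Nat.succ_pred_eq_of_ne_zero h).symm⟩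
    obtain ⟨m, rfl⟩ : ∃ m, n = m + 4 := ⟨n - 4, by omega⟩
    rw [hz] at b1 b2
    have : (m + 4 - 1) * (z + 1) = m * z + 3 * z + m + 3 := by
      rw [show m + 4 - 1 = m + 3 by omega]; ring
    rw [this] at b1
    have := Nat.zero_le (m * z)
    omega
  rw [h0] at b1 b2
  rw [mul_zero] at b1
  have h0' : (0 : G) ∉ E.sum := by rw [hs]; exact Multiset.count_eq_zero.1 h0
  obtain ⟨C, T, hC, hT3, hT⟩ := exists_pairs_of_card_le hE
    (fun A hA => (hE A hA).two_le_card fun h => h0' (mem_sum_iff.2 ⟨A, hA, h⟩)) (by rw [hs, hEk]; omega)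
  rw [hs, hEk] at hT
  rw [hs] at hC
  obtain ⟨U, V, A, rfl⟩ := Multiset.card_eq_three.1 hF3
  have hU := hF U (by simp)
  have hV := hF V (by simp)
  have hA := hF A (by simp)
  have mU := hmax _ hU
  have mV := hmax _ hV
  have mA := hmax _ hA
  have hsum : ({U, V, A} : Multiset (Multiset G)).sum = U + V + A := by simp [add_assoc]
  rw [hsum] at hC b1 b2 hT
  simp only [Multiset.card_add] at b1 b2 hT
  have hT0 : n % 2 = 0 → T = 0 := fun h => hT (by omega)
  by_cases c1 : U.card = n
  · by_cases c2 : V.card = n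
    · exact cyclic_three_atoms hn hG hU hV hA c1 c2 mA hC hT3 (by omega) (by omega) hT0
    · rw [show U + V + A = U + A + V by abel] at hC
      exact cyclic_three_atoms hn hG hU hA hV c1 (by omega) mV hC hT3 (by omega) (by omega) hT0
  · rw [show U + V + A = V + A + U by abel] at hC
    exact cyclic_three_atoms hn hG hV hA hU (by omega) (by omega) mU hC hT3 (by omega) (by omega) hT0

end Cyclic

end SetsOfLengths

namespace SetsOfLengths
open Multiset

/-- The list of codes is a minimal zero-sum sequence. -/
def isAtomCode (l : List ℕ) : List ℕ → Bool
  | [] => false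
  | c :: cs => (c :: cs).all (· < l.foldr (· * ·) 1) && (cs.foldr (codeAdd l) c == 0 && zeroFree l cs 0)

theorem atom_of_isAtomCode {l : List ℕ} (hl : PosMod l) {cs : List ℕ} (h : isAtomCode l cs = true) :
    Atom ((cs.map (dec l) : List (GT l)) : Multiset (GT l)) := by
  rcases cs with _ | ⟨c, cs⟩
  · simp [isAtomCode] at h
  · rw [isAtomCode, Bool.and_eq_true, Bool.and_eq_true, List.all_eq_true, beq_iff_eq] at h
    exact atom_of_zeroFree hl c cs (fun x hx => by simpa using h.1 x hx) h.2.1 h.2.2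

/-- Three atoms over an elementary `2`-group using each element of a sequence twice. -/
def elemAtoms (n : ℕ) : List (List ℕ) :=
  let m := n / 2
  let a := (List.range m).map (2 ^ ·)
  let b := (List.range (m - 1)).map (fun i => 2 ^ (m + i)) ++ [2 ^ (2 * m - 1) - 1]
  let c := (List.range (m - 1)).map (fun i => 2 ^ i + 2 ^ (m + i)) ++
    if n % 2 = 1 then [2 ^ (m - 1) + (2 ^ (2 * m - 1) - 2 ^ m) + 2 ^ (2 * m - 1), 2 ^ (2 * m - 1)]
    else [2 ^ (m - 1) + (2 ^ (2 * m - 1) - 2 ^ m)]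
  [a, b, c]

theorem exists_three_mem {l : List ℕ} (hl : PosMod l) (h2 : ∀ x : GT l, 2 • x = 0) {a b c : List ℕ}
    (h1 : isAtomCode l (a ++ b) = true) (h2' : isAtomCode l (a ++ c) = true)
    (h3 : isAtomCode l (b ++ c) = true)
    (h0 : 1 < (a ++ b).length ∧ 1 < (a ++ c).length) :
    ∃ L ∈ SystemSets (GT l), 3 ∈ L ∧ a.length + b.length + c.length ∈ L := by
  have A1 := atom_of_isAtomCode hl h1
  have A2 := atom_of_isAtomCode hl h2'
  have A3 := atom_of_isAtomCode hl h3
  obtain ⟨E, hE⟩ : ∃ E : Multiset (GT l), E = ((a ++ b ++ c).map (dec l) : List (GT l)) := ⟨_, rfl⟩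
  have hneg : E.map Neg.neg = E := by
    conv_rhs => rw [← Multiset.map_id E]
    refine Multiset.map_congr rfl fun x _ => ?_
    have := h2 x
    rw [two_nsmul] at this
    exact neg_eq_of_add_eq_zero_left this
  have hE0 : (0 : GT l) ∉ E := by
    intro h
    have z1 := A1.zero_notMem (by simpa using h0.1)
    have z2 := A2.zero_notMem (by simpa using h0.2)
    rw [Multiset.mem_coe, List.map_append, List.mem_append] at z1 z2
    rw [hE, Multiset.mem_coe, List.map_append, List.mem_append, List.map_append, List.mem_append] at h
    tauto
  obtain ⟨X, hX⟩ : ∃ X : Multiset (GT l), X = ((a ++ b).map (dec l) : List (GT l)) := ⟨_, rfl⟩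
  obtain ⟨Y, hY⟩ : ∃ Y : Multiset (GT l), Y = ((a ++ c).map (dec l) : List (GT l)) := ⟨_, rfl⟩
  obtain ⟨Z, hZ⟩ : ∃ Z : Multiset (GT l), Z = ((b ++ c).map (dec l) : List (GT l)) := ⟨_, rfl⟩
  rw [← hX] at A1
  rw [← hY] at A2
  rw [← hZ] at A3
  have hsum : ({X, Y, Z} : Multiset (Multiset (GT l))).sum = E + E.map Neg.neg := by
    rw [hneg, hE, hX, hY, hZ]
    simp only [List.map_append, ← Multiset.coe_add, Multiset.insert_eq_cons, Multiset.sum_cons,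
        Multiset.sum_singleton]
    abel
  refine ⟨_, ⟨E + E.map Neg.neg, ?_, rfl⟩, mem_lengthSet.2 ⟨_, ?_, ?_, hsum⟩, mem_lengthSet.2 ?_⟩
  · rw [Multiset.sum_add, sum_map_neg, add_neg_cancel]
  · simp
  · intro A hA
    simp only [Multiset.insert_eq_cons, Multiset.mem_cons, Multiset.mem_singleton] at hA
    rcases hA with rfl | rfl | rfl
    · exact A1
    · exact A2
    · exact A3
  · obtain ⟨F, hF, h⟩ := pairs_mem E hE0
    refine ⟨F, ?_, h⟩
    rw [hF, hE]
    simp [add_assoc]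

theorem exists_three_mem_elementary {n : ℕ} (h4 : 4 ≤ n) (h11 : n ≤ 11) :
    ∃ L ∈ SystemSets (GT (List.replicate (n - 1) 2)), 3 ∈ L ∧ 3 * n / 2 ∈ L := by
  have key : ∀ n ∈ [4, 5, 6, 7, 8, 9, 10, 11], ∃ a b c, elemAtoms n = [a, b, c] ∧
      isAtomCode (List.replicate (n - 1) 2) (a ++ b) = true ∧ isAtomCode (List.replicate (n - 1) 2) (a ++ c) = true ∧
      isAtomCode (List.replicate (n - 1) 2) (b ++ c) = true ∧ (1 < (a ++ b).length ∧ 1 < (a ++ c).length) ∧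
      a.length + b.length + c.length = 3 * n / 2 := by
    intro n hn
    have h : (match elemAtoms n with
      | [a, b, c] => isAtomCode (List.replicate (n - 1) 2) (a ++ b) &&
          (isAtomCode (List.replicate (n - 1) 2) (a ++ c) &&
        (isAtomCode (List.replicate (n - 1) 2) (b ++ c) && (decide (1 < (a ++ b).length ∧ 1 < (a ++ c).length) &&
        decide (a.length + b.length + c.length = 3 * n / 2))))
      | _ => false) = true := by
      revert n
      decide +kernel
    split at h
    · rename_i a b c he
      simp only [Bool.and_eq_true, decide_eq_true_eq] at h
      exact ⟨a, b, c, he, h⟩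
    · simp at h
  obtain ⟨a, b, c, -, h1, h2, h3, h5, h6⟩ := key n (by simp; omega)
  have := exists_three_mem (fun m hm => by rw [List.eq_of_mem_replicate hm]; norm_num)
    (GT.smul_eq_zero fun m hm => by rw [List.eq_of_mem_replicate hm]) h1 h2 h3 h5
  rwa [h6] at this

end SetsOfLengths

namespace SetsOfLengths
open Multiset

/-- Vectors of eight multiplicities. -/
abbrev Mult8 := ℕ × ℕ × ℕ × ℕ × ℕ × ℕ × ℕ × ℕ

namespace Mult8

def le : Mult8 → Mult8 → Bool
  | (a, b, c, d, e, f, g, h), (a', b', c', d', e', f', g', h') =>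
    a.ble a' && (b.ble b' && (c.ble c' && (d.ble d' && (e.ble e' && (f.ble f' && (g.ble g' && h.ble h'))))))

def sub : Mult8 → Mult8 → Mult8
  | (a, b, c, d, e, f, g, h), (a', b', c', d', e', f', g', h') => (a - a', b - b', c - c', d - d',
    e - e', f - f', g - g', h - h')

/-- Every way to write `v` as a sum of `n` elements of `as` has `k + n ∈ p`. -/
def lengthsIn (p : List ℕ) : ℕ → List Mult8 → Mult8 → ℕ → Bool
  | 0, _, _, _ => false
  | _ + 1, [], v, k => v != 0 || p.contains k
  | t + 1, a :: as, v, k => lengthsIn p t as v k && (!le a v || lengthsIn p t (a :: as) (sub v a) (k + 1))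

theorem le_add (a b : Mult8) : le a (a + b) = true := by
  obtain ⟨a1, a2, a3, a4, a5, a6, a7, a8⟩ := a
  obtain ⟨b1, b2, b3, b4, b5, b6, b7, b8⟩ := b
  simp [le]

theorem sub_add (a b : Mult8) : sub (a + b) a = b := by
  obtain ⟨a1, a2, a3, a4, a5, a6, a7, a8⟩ := a
  obtain ⟨b1, b2, b3, b4, b5, b6, b7, b8⟩ := b
  simp [sub]

theorem mem_of_lengthsIn {p : List ℕ} : ∀ {t : ℕ} {as : List Mult8} {v : Mult8} {k : ℕ},
    lengthsIn p t as v k = true →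
    ∀ F : Multiset Mult8, (∀ x ∈ F, x ∈ as) → F.sum = v → k + F.card ∈ p := by
  intro t
  induction t with
  | zero => intro as v k h; simp [lengthsIn] at h
  | succ t ih =>
    intro as
    rcases as with _ | ⟨a, as⟩
    · intro v k h F hF hs
      have : F = 0 := Multiset.eq_zero_of_forall_notMem fun x hx => by simpa using hF x hx
      subst this
      rw [Multiset.sum_zero] at hs
      subst hs
      simpa [lengthsIn] using h
    · intro v k h F hF hs
      rw [lengthsIn, Bool.and_eq_true, Bool.or_eq_true] at h
      by_cases ha : a ∈ F
      · obtain ⟨F, rfl⟩ := Multiset.exists_cons_of_mem ha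
        rw [Multiset.sum_cons] at hs
        subst hs
        rcases h.2 with h | h
        · rw [le_add] at h
          simp at h
        · rw [sub_add] at h
          have := ih h F (fun x hx => hF x (by simp [hx])) rfl
          rw [Multiset.card_cons, show k + (F.card + 1) = k + 1 + F.card by omega]
          exact this
      · refine ih h.1 F (fun x hx => ?_) hs
        rcases List.mem_cons.1 (hF x hx) with rfl | h
        · exact absurd hx ha
        · exact h

section Realise
variable {α : Type*}

/-- The multiset over `x` with given multiplicities. -/
def realise (x : Fin 8 → α) : Mult8 → Multiset α
  | (a, b, c, d, e, f, g, h) => replicate a (x 0) + replicate b (x 1) + replicate c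
    (x 2) + replicate d (x 3) +
    replicate e (x 4) + replicate f (x 5) + replicate g (x 6) + replicate h (x 7)

/-- The vector of multiplicities. -/
def counts [DecidableEq α] (x : Fin 8 → α) (A : Multiset α) : Mult8 :=
  (A.count (x 0), A.count (x 1), A.count (x 2), A.count (x 3), A.count (x 4), A.count (x 5),
    A.count (x 6), A.count (x 7))

theorem realise_mono {x : Fin 8 → α} {u v : Mult8} (h : le u v = true) : realise x u ≤ realise x v := by
  obtain ⟨a, b, c, d, e, f, g, h'⟩ := u
  obtain ⟨a', b', c', d', e', f', g', h''⟩ := v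
  simp only [le, Bool.and_eq_true, Nat.ble_eq] at h
  obtain ⟨h0, h1, h2, h3, h4, h5, h6, h7⟩ := h
  have r : ∀ {m n : ℕ} (y : α), m ≤ n → replicate m y ≤ replicate n y := fun y h => (Multiset.replicate_le_replicate y).2 h
  exact add_le_add (add_le_add
      (add_le_add (add_le_add (add_le_add (add_le_add (add_le_add (r _ h0) (r _ h1)) (r _ h2)) (r _ h3))
    (r _ h4)) (r _ h5)) (r _ h6)) (r _ h7)

variable [DecidableEq α] {x : Fin 8 → α}

theorem counts_add (A B : Multiset α) : counts x (A + B) = counts x A + counts x B := by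
  simp [counts]

theorem counts_sum (F : Multiset (Multiset α)) : counts x F.sum = (F.map (counts x)).sum := by
  induction F using Multiset.induction with
  | empty => simp [counts]
  | cons A F ih => rw [Multiset.sum_cons, Multiset.map_cons, Multiset.sum_cons, counts_add, ih]

theorem counts_realise (hx : Function.Injective x) (v : Mult8) : counts x (realise x v) = v := by
  obtain ⟨a, b, c, d, e, f, g, h⟩ := v
  simp [counts, realise, Multiset.count_replicate, hx.eq_iff]

theorem count_realise (v : Mult8) (y : α) (hy : ∀ i, x i ≠ y) : (realise x v).count y = 0 := by
  obtain ⟨a, b, c, d, e, f, g, h⟩ := v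
  simp [realise, Multiset.count_replicate, hy]

theorem realise_counts (hx : Function.Injective x) {A : Multiset α} {v : Mult8} (h : A ≤ realise x v) :
    realise x (counts x A) = A := by
  refine Multiset.ext.2 fun y => ?_
  by_cases hy : ∃ i, x i = y
  · obtain ⟨i, rfl⟩ := hy
    have := counts_realise hx (counts x A)
    simp only [counts, Prod.mk.injEq] at this
    obtain ⟨h0, h1, h2, h3, h4, h5, h6, h7⟩ := this
    fin_cases i
    exacts [h0, h1, h2, h3, h4, h5, h6, h7]
  · push Not at hy
    rw [count_realise _ _ hy]
    have := (Multiset.le_iff_count.1 h) y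
    rw [count_realise _ _ hy] at this
    omega

end Realise

/-- The code of the sum of the multiset with given multiplicities of the elements with codes `c`. -/
def codeSum (l : List ℕ) (c : Fin 8 → ℕ) : Mult8 → ℕ
  | (m0, m1, m2, m3, m4, m5, m6, m7) =>
    let s (m i) := (codeAdd l (c i))^[m]
    s m0 0 (s m1 1 (s m2 2 (s m3 3 (s m4 4 (s m5 5 (s m6 6 (s m7 7 0)))))))

theorem iterate_codeAdd {l : List ℕ} (hl : PosMod l) (x y : GT l) (m : ℕ) :
    (codeAdd l (enc l x))^[m] (enc l y) = enc l ((replicate m x).sum + y) := by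
  induction m with
  | zero => simp
  | succ m ih => rw [Function.iterate_succ_apply', ih, codeAdd_enc hl, Multiset.replicate_succ,
      Multiset.sum_cons, add_assoc]

theorem codeSum_eq {l : List ℕ} (hl : PosMod l) (x : Fin 8 → GT l) (v : Mult8) :
    codeSum l (fun i => enc l (x i)) v = enc l (realise x v).sum := by
  obtain ⟨m0, m1, m2, m3, m4, m5, m6, m7⟩ := v
  rw [codeSum, ← enc_zero l]
  simp only [iterate_codeAdd hl, realise, Multiset.sum_add, add_zero, add_assoc]

/-- Each zero-sum vector below `v` is zero or above a member of `as`. -/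
def atomsIn (l : List ℕ) (c : Fin 8 → ℕ) (as : List Mult8) : Mult8 → Bool
  | (m0, m1, m2, m3, m4, m5, m6, m7) =>
    (List.range (m0 + 1)).all fun n0 => (List.range (m1 + 1)).all fun n1 => (List.range
        (m2 + 1)).all fun n2 =>
    (List.range (m3 + 1)).all fun n3 => (List.range (m4 + 1)).all fun n4 => (List.range
        (m5 + 1)).all fun n5 =>
    (List.range (m6 + 1)).all fun n6 => (List.range (m7 + 1)).all fun n7 =>
      codeSum l c (n0, n1, n2, n3, n4, n5, n6, n7) != 0 ||
        ((n0, n1, n2, n3, n4, n5, n6, n7) == (0 : Mult8) || as.any fun a => le a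
            (n0, n1, n2, n3, n4, n5, n6, n7))

theorem le_counts {α : Type*} [DecidableEq α] {x : Fin 8 → α} {A B : Multiset α} (h : A ≤ B) :
    le (counts x A) (counts x B) = true := by
  simp only [le, counts, Bool.and_eq_true, Nat.ble_eq]
  exact ⟨Multiset.count_le_of_le _ h, Multiset.count_le_of_le _ h, Multiset.count_le_of_le _ h,
    Multiset.count_le_of_le _ h, Multiset.count_le_of_le _ h, Multiset.count_le_of_le _ h,
    Multiset.count_le_of_le _ h, Multiset.count_le_of_le _ h⟩

theorem counts_mem {l : List ℕ} (hl : PosMod l) {x : Fin 8 → GT l} (hx : Function.Injective x)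
    {as : List Mult8}
    {v : Mult8} (h : atomsIn l (fun i => enc l (x i)) as v = true)
    (has : ∀ a ∈ as, a ≠ 0 ∧ codeSum l (fun i => enc l (x i)) a = 0) {A : Multiset (GT l)} (hA : Atom A)
    (hle : A ≤ realise x v) : counts x A ∈ as := by
  have hr := realise_counts hx hle
  have hb := le_counts (x := x) hle
  rw [counts_realise hx] at hb
  have hc := codeSum_eq hl x (counts x A)
  rw [hr, hA.2.1, enc_zero] at hc
  rcases hn : counts x A with ⟨n0, n1, n2, n3, n4, n5, n6, n7⟩
  rw [hn] at hr hb hc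
  obtain ⟨m0, m1, m2, m3, m4, m5, m6, m7⟩ := v
  simp only [le, Bool.and_eq_true, Nat.ble_eq] at hb
  obtain ⟨h0, h1, h2, h3, h4, h5, h6, h7⟩ := hb
  simp only [atomsIn, List.all_eq_true, List.mem_range] at h
  have := h n0 (by omega) n1 (by omega) n2 (by omega) n3 (by omega) n4 (by omega) n5 (by omega)
    n6 (by omega) n7 (by omega)
  rw [Bool.or_eq_true, Bool.or_eq_true, bne_iff_ne, beq_iff_eq, List.any_eq_true] at this
  rcases this with h | h | ⟨a, ha, hle⟩
  · exact absurd hc h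
  · rw [h] at hr
    exact absurd hr.symm hA.1
  · obtain ⟨h1, h2⟩ := has a ha
    have hm := realise_mono (x := x) hle
    rw [hr] at hm
    have h3 := counts_realise hx a
    have := hA.2.2 _ hm (fun h => h1 (by rw [← h3, h]; rfl))
      (enc_injective hl (by rw [← codeSum_eq hl, h2, enc_zero]))
    rw [← hn, ← this, h3]
    exact ha

/-- A maximal atom supported on `x₀, x₂, x₄, x₆` whose set of lengths is controlled by a list `as` of vectors that
contains all atoms over `±x`. -/
theorem squeezed {l : List ℕ} (hl : PosMod l) {D : ℕ} (hmax : ∀ A : Multiset (GT l), Atom A →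
    A.card ≤ D) {c : Fin 8 → ℕ}
    (hlt : ∀ i, c i < l.foldr (· * ·) 1) (hcinj : Function.Injective c) (hcneg : ∀ i : Fin 4,
      codeNeg l (c ⟨2 * i, by omega⟩) = c ⟨2 * i + 1, by omega⟩) {m₀ m₂ m₄ m₆ : ℕ}
    (hm : m₀ + m₂ + m₄ + m₆ = D)
    (hat : isAtomCode l (List.replicate m₀ (c 0) ++ List.replicate m₂ (c 2) ++ List.replicate m₄ (c 4) ++
      List.replicate m₆ (c 6)) = true) {as : List Mult8}
    (has : atomsIn l c as (m₀, m₀, m₂, m₂, m₄, m₄, m₆, m₆) = true)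
    (has0 : (as.all fun a => a != 0 && codeSum l c a == 0) = true) {p : List ℕ} {t : ℕ}
    (hlen : lengthsIn p t as (m₀, m₀, m₂, m₂, m₄, m₄, m₆, m₆) 0 = true) : Squeezed (GT l) D p := by
  have hA : Atom (realise (fun i => dec l (c i)) (m₀, 0, m₂, 0, m₄, 0, m₆, 0)) := by
    convert atom_of_isAtomCode hl hat using 1
    simp [realise, ← Multiset.coe_add, ← Multiset.coe_replicate, add_assoc]
  simp only [List.all_eq_true, Bool.and_eq_true, bne_iff_ne, beq_iff_eq] at has0
  obtain ⟨x, hx⟩ : ∃ x, x = fun i => dec l (c i) := ⟨_, rfl⟩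
  have hcode : (fun i => enc l (x i)) = c := by
    funext i
    rw [hx]
    exact enc_dec hl (hlt i)
  have hinj : Function.Injective x := by
    have : Function.Injective fun i => enc l (x i) := by rwa [hcode]
    exact fun i j h => this (congrArg _ h)
  have hneg : ∀ i j, codeNeg l (c i) = c j → -x i = x j := by
    intro i j h
    rw [← hcode] at h
    exact enc_injective hl (by rw [← codeNeg_enc hl]; exact h)
  rw [← hx] at hA
  have hcard : (realise x (m₀, 0, m₂, 0, m₄, 0, m₆, 0)).card = D := by
    rw [← hm]
    simp [realise]
  refine ⟨_, ⟨hA, fun A h => (hmax A h).trans hcard.ge⟩, hcard, fun k hk => ?_⟩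
  have hsum : realise x (m₀, 0, m₂, 0, m₄, 0, m₆, 0) + (realise x (m₀, 0, m₂, 0, m₄, 0, m₆, 0)).map Neg.neg =
      realise x (m₀, m₀, m₂, m₂, m₄, m₄, m₆, m₆) := by
    simp only [realise, Multiset.map_add, Multiset.map_replicate, hneg 0 1 (hcneg 0), hneg 2 3 (hcneg 1),
      hneg 4 5 (hcneg 2), hneg 6 7 (hcneg 3), Multiset.replicate_zero]
    abel
  obtain ⟨F, rfl, hF, hs⟩ := mem_lengthSet.1 hk
  rw [hsum] at hs
  have has' := fun A hA => counts_mem hl hinj (by rw [hcode]; exact has) (by rw [hcode]; exact has0) (hF A hA)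
    (by rw [← hs]; exact Multiset.single_le_sum (fun _ _ => Multiset.zero_le _) A hA)
  have hcs := congrArg (counts x) hs
  rw [counts_sum, counts_realise hinj] at hcs
  rw [← Multiset.card_map (counts x), ← zero_add (F.map (counts x)).card]
  exact mem_of_lengthsIn hlen _ (Multiset.forall_mem_map_iff.2 has') hcs

theorem squeezed_nine_three (hmax : ∀ A : Multiset (GT [9, 3]), Atom A → A.card ≤ 11) :
    Squeezed (GT [9, 3]) 11 [2, 4, 9, 11] :=
  squeezed (by decide) hmax (c := ![1, 8, 10, 26, 17, 19, 2, 7]) (m₀ := 8) (m₂ := 2) (m₄ := 1)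
      (m₆ := 0) (t := 100)
    (as := [(0, 0, 0, 0, 1, 1, 0, 0), (0, 0, 1, 1, 0, 0, 0, 0), (0, 1, 2, 0, 1, 0, 0, 0),
        (0, 2, 1, 0, 0, 1, 0, 0),
      (0, 7, 0, 1, 1, 0, 0, 0), (0, 8, 0, 2, 0, 1, 0, 0), (1, 0, 0, 2, 0, 1, 0, 0), (1, 1, 0, 0, 0, 0, 0, 0),
      (2, 0, 0, 1, 1, 0, 0, 0), (7, 0, 1, 0, 0, 1, 0, 0), (8, 0, 2, 0, 1, 0, 0, 0)])
    (by decide) (by decide) (by decide) rfl (by decide +kernel) (by decide +kernel) (by decide +kernel) (by decide +kernel)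

theorem squeezed_six_three_three (hmax : ∀ A : Multiset (GT [6, 3, 3]), Atom A → A.card ≤ 10) :
    Squeezed (GT [6, 3, 3]) 10 [2, 3, 4, 5, 6, 7, 10] :=
  squeezed (by decide) hmax (c := ![25, 53, 26, 52, 23, 37, 47, 31]) (m₀ := 2) (m₂ := 2) (m₄ := 1)
      (m₆ := 5) (t := 100)
    (as := [(0, 2, 0, 2, 0, 1, 0, 5), (2, 0, 2, 0, 1, 0, 5, 0), (0, 2, 1, 0, 0, 1, 0, 5),
        (2, 0, 0, 1, 1, 0, 5, 0),
      (1, 0, 0, 2, 0, 1, 4, 0), (0, 1, 2, 0, 1, 0, 0, 4), (1, 0, 1, 0, 0, 1, 4, 0), (0, 1, 0, 1, 1, 0, 0, 4),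
      (1, 0, 0, 2, 0, 1, 0, 2), (0, 2, 0, 2, 0, 1, 1, 0), (2, 0, 2, 0, 1, 0, 0, 1), (0, 1, 2, 0, 1, 0, 2, 0),
      (1, 0, 1, 0, 0, 1, 0, 2), (0, 2, 1, 0, 0, 1, 1, 0), (2, 0, 0, 1, 1, 0, 0, 1), (0, 1, 0, 1, 1, 0, 2, 0),
      (0, 0, 0, 0, 1, 1, 0, 0), (0, 0, 1, 1, 0, 0, 0, 0), (1, 1, 0, 0, 0, 0, 0, 0), (0, 0, 0, 0, 0, 0, 1, 1)])
    (by decide) (by decide) (by decide) rfl (by decide +kernel) (by decide +kernel) (by decide +kernel) (by decide +kernel)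

end Mult8

end SetsOfLengths

namespace SetsOfLengths

theorem symLen_map {G H : Type*} [AddCommGroup G] [AddCommGroup H] (e : G ≃+ H) (U : Multiset G) :
    symLen (U.map e) = symLen U := by
  have h := lengthSet_map e (U + U.map Neg.neg)
  rw [symLen, symLen, ← h, Multiset.map_add, Multiset.map_map, Multiset.map_map]
  congr 3
  funext x
  simp

theorem MaxAtom.map {G H : Type*} [AddCommGroup G] [AddCommGroup H] (e : G ≃+ H) {U : Multiset G}
    (hU : MaxAtom U) :
    MaxAtom (U.map e) := by
  refine ⟨Atom.map (f := e.toAddMonoidHom) e.injective hU.1, fun A hA => ?_⟩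
  have := hU.2 _ (Atom.map (f := e.symm.toAddMonoidHom) e.symm.injective hA)
  simpa using this

theorem Squeezed.congr {G H : Type*} [AddCommGroup G] [AddCommGroup H] {D : ℕ} {p : List ℕ}
    (h : Squeezed G D p)
    (e : Nonempty (G ≃+ H)) : Squeezed H D p := by
  obtain ⟨e⟩ := e
  obtain ⟨U, hU, hD, hp⟩ := h
  exact ⟨U.map e, hU.map e, by simpa using hD, by rwa [symLen_map]⟩

/-- Sets of lengths are transferred. -/
theorem Squeezed.transfer {G H : Type*} [AddCommGroup G] [AddCommGroup H] {D : ℕ} {p : List ℕ}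
    (h : Squeezed G D p)
    (hD : 3 ≤ D) (hL : SystemSets G = SystemSets H) (hmax : ∀ A : Multiset H, Atom A → A.card ≤ D) :
    Squeezed H D p := by
  obtain ⟨U, hU, hc, hp⟩ := h
  have h0 : (0 : G) ∉ U := hU.1.zero_notMem (by omega)
  have hmem : symLen U ∈ SystemSets H := by
    rw [← hL]
    exact ⟨_, by rw [Multiset.sum_add, sum_map_neg, add_neg_cancel], rfl⟩
  obtain ⟨V, hV, hVc, hVL⟩ := exists_maxAtom_of_two_mem hD hmax hmem (two_mem_symLen hU.1)
      (hc ▸ card_mem_symLen h0)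
  exact ⟨V, hV, hVc, by rwa [← hVL]⟩

variable {D : ℕ} {p fb ds : List ℕ}

/-- The relation lengths `fb` are excluded by the lengths in `p`. -/
def forbids (D : ℕ) (p fb : List ℕ) : Bool :=
  decide (∀ f ∈ fb, 2 < f ∧ f ≤ D ∧ ∀ a ∈ List.range (f + 1),
      2 < a → D + 2 - a ∈ p → f - a ∈ fb ∨ f - a = 1 ∨ f - a = 2)

theorem not_squeezed_replicate {q r : ℕ} (s k : ℕ) (hs : s.Prime) (hq : q = s ^ (k + 1))
    (hex : exclude (List.replicate r q) D 1 fb ((List.range r).map (q ^ ·)) ds false = true) (hD1 : 1 < D)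
    (hfb : forbids D p fb = true) : ¬ Squeezed (GT (List.replicate r q)) D p := by
  rintro ⟨U, hU, hD, hp⟩
  exact false_of_exclude_homocyclic hs hq hex hD1 (of_decide_eq_true hfb) hU hD hp

theorem not_squeezed_replicate_two {q r : ℕ} (hq : q.Prime) (hq2 : q % 2 = 1)
    (hex : ∀ n ≤ r, exclude (List.replicate r q ++ [2]) D 1 fb (coprimePre q r n 1 0) ds false = true)
    (hD1 : 1 < D) (hfb : forbids D p fb = true) : ¬ Squeezed (GT (List.replicate r q ++ [2])) D p := by
  rintro ⟨U, hU, hD, hp⟩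
  obtain ⟨n, hn, e, he⟩ := exists_coprimePre_two hq hq2 hU.closure_eq_top
  exact false_of_exclude (hex n hn) hD1 le_rfl (of_decide_eq_true hfb) hU.1 hD hp e he (by simp)

theorem not_squeezed_six_two
    (hex : ∀ n ≤ 5, 5 ≤ 2 * n → exclude (List.replicate 5 2 ++ [3]) 11 1 fb
    (coprimePre 2 5 n 1 2) ds true = true)
    (hfb : forbids 11 p fb = true) : ¬ Squeezed (GT (List.replicate 5 2 ++ [3])) 11 p := by
  rintro ⟨U, hU, hD, hp⟩
  have hinv := add_self_ne_zero card_le_two_two_two_two_six hU.1 (by omega)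
  obtain ⟨n, hn, hn2, e, he⟩ := exists_coprimePre_three hU.closure_eq_top hinv
  exact false_of_exclude (hex n hn hn2) (by norm_num) le_rfl
      (of_decide_eq_true hfb) hU.1 hD hp e he fun _ => hinv

theorem not_squeezed_pair {a b : ℕ} (q : ℕ) (ha : 0 < a) (hb : b = q * a) (hq : 1 < q)
    (hunit : ∀ y : ZMod b, a • y ≠ 0 → IsUnit y) (hex : exclude [a, b] D 1 fb [a] ds false = true)
    (hD1 : 1 < D) (hfb : forbids D p fb = true) : ¬ Squeezed (GT [a, b]) D p := by
  rintro ⟨U, hU, hD, hp⟩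
  obtain ⟨e, he⟩ := exists_prefix_unit ha hb hq hU.closure_eq_top hunit
  exact false_of_exclude hex hD1 le_rfl (of_decide_eq_true hfb) hU.1 hD hp e he (by simp)

theorem not_squeezed_six_six (hex : exclude [6, 6] D 1 fb [6] ds false = true)
    (hD1 : 1 < D) (hfb : forbids D p fb = true) : ¬ Squeezed (GT [6, 6]) D p := by
  rintro ⟨U, hU, hD, hp⟩
  obtain ⟨e, he⟩ := exists_prefix_six hU.1 hU.closure_eq_top
  exact false_of_exclude hex hD1 le_rfl (of_decide_eq_true hfb) hU.1 hD hp e he (by simp)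

end SetsOfLengths

namespace SetsOfLengths

theorem not_squeezed_three_three_three : ¬ Squeezed (GT [3, 3, 3]) 7 [2, 4, 6, 7] :=
  not_squeezed_replicate (q := 3) (r := 3) (fb := [4]) (ds := [3]) 3 0 Nat.prime_three rfl (by decide +kernel)
    (by norm_num) (by decide)

theorem not_squeezed_six_three : ¬ Squeezed (GT (List.replicate 2 3 ++ [2])) 8 [2, 6, 8] :=
  not_squeezed_replicate_two (fb := [3, 5, 6, 7]) (ds := [6, 3, 2]) Nat.prime_three rfl (by decide +kernel)
    (by norm_num) (by decide)

theorem not_squeezed_three_three_three_three : ¬ Squeezed (GT [3, 3, 3, 3]) 9 [2, 4, 6, 9] :=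
  not_squeezed_replicate (q := 3) (r := 4) (fb := [3, 4, 6, 8]) (ds := [3]) 3 0 Nat.prime_three rfl
      (by decide +kernel)
    (by norm_num) (by decide)

theorem not_squeezed_five_five : ¬ Squeezed (GT [5, 5]) 9 [2, 3, 4, 5, 6, 9] :=
  not_squeezed_replicate (q := 5) (r := 2) (fb := [3, 4]) (ds := [5]) 5 0 Nat.prime_five rfl
      (by decide +kernel)
    (by norm_num) (by decide)

end SetsOfLengths

namespace SetsOfLengths

theorem not_squeezed_six_three_three : ¬ Squeezed (GT (List.replicate 3 3 ++ [2])) 10 [2, 4, 6, 10] :=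
  not_squeezed_replicate_two (fb := [3, 4, 5, 7, 9]) (ds := [6, 3, 2]) Nat.prime_three rfl (by decide +kernel)
    (by norm_num) (by decide)

theorem not_squeezed_six_three_three' : ¬ Squeezed (GT (List.replicate 3 3 ++ [2])) 10 [2, 8, 10] :=
  not_squeezed_replicate_two (fb := [3, 5, 6, 7, 9]) (ds := [6, 3, 2]) Nat.prime_three rfl (by decide +kernel)
    (by norm_num) (by decide)

theorem not_squeezed_four_four_four : ¬ Squeezed (GT [4, 4, 4]) 10 [2, 3, 4, 5, 6, 7, 10] :=
  not_squeezed_replicate (q := 4) (r := 3) (fb := [3, 4]) (ds := [4, 2]) 2 1 Nat.prime_two rfl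
      (by decide +kernel)
    (by norm_num) (by decide)

end SetsOfLengths

namespace SetsOfLengths

theorem not_squeezed_two_two_two_two_six : ¬ Squeezed (GT (List.replicate 5 2 ++ [3])) 11
    [2, 3, 4, 5, 6, 7, 8, 10, 11] :=
  not_squeezed_six_two (fb := [4]) (ds := [6, 3]) (by decide +kernel) (by decide)

theorem not_squeezed_two_two_two_two_six' : ¬ Squeezed (GT (List.replicate 5 2 ++ [3])) 11 [2, 4, 9, 11] :=
  not_squeezed_six_two (fb := [3, 5, 6, 7, 10]) (ds := [6, 3]) (by decide +kernel) (by decide)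

theorem not_squeezed_three_pow_five : ¬ Squeezed (GT [3, 3, 3, 3, 3]) 11 [2, 4, 6, 8, 11] :=
  not_squeezed_replicate (q := 3) (r := 5) (fb := [3, 4, 6, 8]) (ds := [3]) 3 0 Nat.prime_three rfl
      (by decide +kernel)
    (by norm_num) (by decide)

end SetsOfLengths

namespace SetsOfLengths

theorem not_squeezed_three_nine {p fb : List ℕ} (hex : exclude [3, 9] 11 1 fb [3] [9, 3] false = true)
    (hfb : forbids 11 p fb = true) : ¬ Squeezed (GT [3, 9]) 11 p :=
  not_squeezed_pair 3 (by norm_num) rfl (by norm_num) (by decide) hex (by norm_num) hfb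

theorem not_squeezed_four_eight {p fb : List ℕ} (hex : exclude [4, 8] 11 1 fb [4] [8, 4, 2] false = true)
    (hfb : forbids 11 p fb = true) : ¬ Squeezed (GT [4, 8]) 11 p :=
  not_squeezed_pair 2 (by norm_num) rfl (by norm_num) (by decide) hex (by norm_num) hfb

theorem exclude_three_nine : ∀ fb ∈ ([[3, 4], [4, 5, 8], [4, 7]] : List (List ℕ)),
    exclude [3, 9] 11 1 fb [3] [9, 3] false = true := by
  decide +kernel

theorem exclude_four_eight : ∀ fb ∈ ([[3, 4, 5], [3, 4, 6, 7, 8, 9], [4, 5, 8]] : List (List ℕ)),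
    exclude [4, 8] 11 1 fb [4] [8, 4, 2] false = true := by
  decide +kernel

theorem exclude_six_six : exclude [6, 6] 11 1 [3, 4] [6] [6, 3, 2] false = true := by
  decide +kernel

end SetsOfLengths

namespace SetsOfLengths

/-- Some element of `GT l` is not annihilated by `2`. -/
def nonElementary (l : List ℕ) : Bool :=
  (List.range (l.foldr (· * ·) 1)).any fun c => codeAdd l c c != 0

/-- `2 • GT l` has more than two elements. -/
def manyDoubles (l : List ℕ) : Bool :=
  match ((List.range (l.foldr (· * ·) 1)).map fun c => codeAdd l c c).filter (· != 0) with
  | [] => false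
  | d :: ds => ds.any (· != d)

theorem exists_add_self_ne_zero {l : List ℕ} (hl : PosMod l) (h : nonElementary l = true) : ∃ x :
    GT l, x + x ≠ 0 := by
  simp only [nonElementary, List.any_eq_true, List.mem_range, bne_iff_ne] at h
  obtain ⟨c, hc, h⟩ := h
  refine ⟨dec l c, fun hx => h ?_⟩
  rw [← enc_dec hl hc, codeAdd_enc hl, hx, enc_zero]

theorem exists_add_self_ne {l : List ℕ} (hl : PosMod l) (h : manyDoubles l = true) (t : GT l) :
    ∃ x : GT l, x + x ≠ 0 ∧ x + x ≠ t := by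
  have key : ∀ d ∈ ((List.range (l.foldr (· * ·) 1)).map fun c => codeAdd l c c).filter (· != 0),
      ∃ x : GT l, x + x ≠ 0 ∧ enc l (x + x) = d := by
    intro d hd
    simp only [List.mem_filter, List.mem_map, List.mem_range, bne_iff_ne] at hd
    obtain ⟨⟨c, hc, rfl⟩, h0⟩ := hd
    have h1 : enc l (dec l c + dec l c) = codeAdd l c c := by rw [← codeAdd_enc hl, enc_dec hl hc]
    exact ⟨dec l c, fun h => h0 (by rw [← h1, h, enc_zero]), h1⟩
  unfold manyDoubles at h
  split at h
  · cases h
  · rename_i d ds hds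
    rw [hds] at key
    rw [List.any_eq_true] at h
    obtain ⟨d', hd', hne⟩ := h
    obtain ⟨x, hx, h1⟩ := key d (by simp)
    obtain ⟨y, hy, h2⟩ := key d' (by simp [hd'])
    by_cases hxt : x + x = t
    · refine ⟨y, hy, ?_⟩
      rintro rfl
      rw [hxt] at h1
      exact bne_iff_ne.1 hne (h2.symm.trans h1)
    · exact ⟨x, hx, hxt⟩

/-- The lists `(l, D, p)` for which `GT l` is shown by search not to have a long atom with lengths in `p`. -/
def searchTable : List (List ℕ × ℕ × List ℕ) :=
  [([3, 3, 3], 7, [2, 4, 6, 7]), ([6, 3], 8, [2, 6, 8]), ([3, 3, 3, 3], 9, [2, 4, 6, 9]),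
      ([5, 5], 9, [2, 3, 4, 5, 6, 9]),
    ([6, 3, 3], 10, [2, 4, 6, 10]), ([6, 3, 3], 10, [2, 8, 10]), ([4, 4, 4], 10, [2, 3, 4, 5, 6, 7, 10]),
    ([6, 2, 2, 2, 2], 11, [2, 3, 4, 5, 6, 7, 8, 10, 11]), ([6, 2, 2, 2, 2], 11, [2, 4, 9, 11]),
    ([3, 3, 3, 3, 3], 11, [2, 4, 6, 8, 11]),
    ([9, 3], 11, [2, 3, 4, 5, 6, 7, 8, 11]), ([9, 3], 11, [2, 6, 10, 11]), ([9, 3], 11, [2, 4, 8, 10, 11]),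
    ([8, 4], 11, [2, 3, 4, 5, 6, 7, 11]), ([8, 4], 11, [2, 8, 11]), ([8, 4], 11, [2, 6, 10, 11]),
    ([6, 6], 11, [2, 3, 4, 5, 6, 7, 8, 11])]

theorem not_squeezed_congr {l l' : List ℕ} {D : ℕ} {p : List ℕ} (e : Nonempty (GT l ≃+ GT l'))
    (h : ¬ Squeezed (GT l') D p) : ¬ Squeezed (GT l) D p := fun hs => h (hs.congr e)

theorem not_squeezed_of_mem_searchTable : ∀ t ∈ searchTable, ¬ Squeezed (GT t.1) t.2.1 t.2.2 := by
  have h93 : Nonempty (GT [9, 3] ≃+ GT [3, 9]) := GT.nonempty_of_perm (by decide)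
  have h84 : Nonempty (GT [8, 4] ≃+ GT [4, 8]) := GT.nonempty_of_perm (by decide)
  simp only [searchTable, List.forall_mem_cons, List.not_mem_nil, IsEmpty.forall_iff, implies_true, and_true]
  exact ⟨not_squeezed_three_three_three, not_squeezed_congr (GT.nonempty_six_three 1) not_squeezed_six_three,
    not_squeezed_three_three_three_three, not_squeezed_five_five,
    not_squeezed_congr (GT.nonempty_six_three 2) not_squeezed_six_three_three,
    not_squeezed_congr (GT.nonempty_six_three 2) not_squeezed_six_three_three', not_squeezed_four_four_four,
    not_squeezed_congr (GT.nonempty_six 4) not_squeezed_two_two_two_two_six,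
    not_squeezed_congr (GT.nonempty_six 4) not_squeezed_two_two_two_two_six',
    not_squeezed_three_pow_five,
    not_squeezed_congr h93 (not_squeezed_three_nine (exclude_three_nine [3, 4] (by decide)) (by decide)),
    not_squeezed_congr h93 (not_squeezed_three_nine (exclude_three_nine [4, 5, 8] (by decide)) (by decide)),
    not_squeezed_congr h93 (not_squeezed_three_nine (exclude_three_nine [4, 7] (by decide)) (by decide)),
    not_squeezed_congr h84 (not_squeezed_four_eight (exclude_four_eight [3, 4, 5] (by decide)) (by decide)),
    not_squeezed_congr h84 (not_squeezed_four_eight (exclude_four_eight [3, 4, 6, 7, 8,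
        9] (by decide)) (by decide)),
    not_squeezed_congr h84 (not_squeezed_four_eight (exclude_four_eight [4, 5, 8] (by decide)) (by decide)),
    not_squeezed_six_six exclude_six_six (by norm_num) (by decide)⟩

/-- A sufficient condition for the absence of a longest atom `U` of length `D` with `symLen U ⊆ p`. -/
def killed (D : ℕ) (l p : List ℕ) : Bool :=
  decide (∃ t ∈ searchTable, t.1 = l ∧ t.2.1 = D ∧ p ⊆ t.2.2) ||
  decide (D < l.foldr (· * ·) 1) &&
    (decide (p ⊆ [2, D]) && nonElementary l ||
      decide (p ⊆ [2, D - 1, D] ∧ ∃ n ∈ List.range 20,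
          0 < n ∧ (∀ m ∈ l, m ∣ n) ∧ 2 * n < l.foldr (· * ·) 1) &&
        nonElementary l ||
      decide (6 < D ∧ p ⊆ [2, 4, D] ∧ ∃ n ∈ ([6, 8, 9, 10] : List ℕ), ∀ m ∈ l, m ∣ n) && manyDoubles l ||
      decide (∀ m ∈ l, m ∣ 4) && expFourKill D p (l.foldr (· * ·) 1))

theorem not_squeezed_of_killed {D : ℕ} {l p : List ℕ} (hl : PosMod l) (h4 : 4 ≤ D) (h11 : D ≤ 11)
    (hk : killed D l p = true) : ¬ Squeezed (GT l) D p := by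
  rintro ⟨U, hU, rfl, hp⟩
  simp only [killed, Bool.or_eq_true, Bool.and_eq_true, decide_eq_true_eq] at hk
  rcases hk with ⟨t, ht, rfl, h1, h2⟩ | ⟨hG,
      ((⟨h1, h2⟩ | ⟨⟨h1, n, -, hn, hn1, hn2⟩, h2⟩) | ⟨⟨h7, h1, n, hn, hn1⟩, h2⟩) |
    ⟨h1, h2⟩⟩
  · exact not_squeezed_of_mem_searchTable t ht ⟨U, hU, h1.symm, fun k hk => h2 (hp k hk)⟩
  · obtain ⟨x, hx⟩ := exists_add_self_ne_zero hl h2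
    have := hU.two_rule (by omega) (fun k hk => by simpa using h1 (hp k hk)) hx
    rw [GT.card_eq hl] at this
    omega
  · obtain ⟨x, hx⟩ := exists_add_self_ne_zero hl h2
    have := hU.three_rule (by omega) (fun k hk => by simpa using h1 (hp k hk)) hx hn (GT.smul_eq_zero hn1)
    rw [GT.card_eq hl] at this
    omega
  · obtain ⟨t, -, ht⟩ := hU.four_rule h7 (fun k hk => by simpa using h1 (hp k hk)) (by simpa using hn)
      (GT.smul_eq_zero hn1) (by rwa [GT.card_eq hl])
    obtain ⟨x, hx, hxt⟩ := exists_add_self_ne hl h2 t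
    exact (ht x).elim hx hxt
  · have := GT.finite hl
    exact hU.false_of_expFourKill (by omega) h11 (GT.smul_eq_zero h1) (by rwa [GT.card_eq hl]) hp
      (by rwa [GT.card_eq hl])

/-- Lists of lengths realised by a longest atom over `GT l`. -/
def sources (D : ℕ) (l : List ℕ) : List (List ℕ) :=
  (if dStar l = D then [D :: (subSums l).map (2 + ·)] else []) ++
    ((if l = [9, 3] ∧ D = 11 then [[2, 4, 9, 11]] else []) ++
      if l = [6, 3, 3] ∧ D = 10 then [[2, 3, 4, 5, 6, 7, 10]] else [])

theorem squeezed_of_mem_sources {D : ℕ} {l : List ℕ} (hl : ∀ m ∈ l, 2 ≤ m)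
    (hmax : ∀ A : Multiset (GT l), Atom A → A.card ≤ D) : ∀ p ∈ sources D l, Squeezed (GT l) D p := by
  intro p hp
  simp only [sources, List.mem_append] at hp
  rcases hp with hp | hp | hp <;> split at hp <;> rename_i h <;>
    first | (cases hp; done) | (rw [List.mem_singleton] at hp; subst hp)
  · exact squeezed_std hl h hmax
  · obtain ⟨rfl, rfl⟩ := h
    exact Mult8.squeezed_nine_three hmax
  · obtain ⟨rfl, rfl⟩ := h
    exact Mult8.squeezed_six_three_three hmax

/-- Longest atoms separate the systems of sets of lengths over `GT l` and `GT l'`. -/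
def separates (D : ℕ) (l l' : List ℕ) : Bool := (sources D l).any (killed D l')

theorem systemSets_ne_of_separates {D : ℕ} {l l' : List ℕ} (hl : ∀ m ∈ l, 2 ≤ m) (hl' : ∀ m ∈ l', 2 ≤ m)
    (h4 : 4 ≤ D) (h11 : D ≤ 11) (hs : separates D l l' = true)
    (hmax : ∀ A : Multiset (GT l), Atom A → A.card ≤ D) (hmax' : ∀ A : Multiset (GT l'), Atom A →
    A.card ≤ D) :
    SystemSets (GT l) ≠ SystemSets (GT l') := by
  intro h
  obtain ⟨p, hp, hk⟩ := List.any_eq_true.1 hs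
  exact not_squeezed_of_killed (fun m hm => (by norm_num : 0 < 2).trans_le (hl' m hm)) h4 h11 hk
    ((squeezed_of_mem_sources hl hmax p hp).transfer (by omega) h hmax')

theorem systemSets_ne_of_cyclic {D : ℕ} (h4 : 4 ≤ D) (h11 : D ≤ 11)
    (hmax : ∀ A : Multiset (GT [D]), Atom A → A.card ≤ D) :
    SystemSets (GT [D]) ≠ SystemSets (GT (List.replicate (D - 1) 2)) := by
  intro h
  have hl : PosMod [D] := fun m hm => by
    rw [List.mem_singleton] at hm
    omega
  obtain ⟨L, hL, h3, hk⟩ := exists_three_mem_elementary h4 h11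
  have := GT.finite hl
  exact false_of_card_eq h4 (by simpa using GT.card_eq hl) hmax (h ▸ hL) h3 hk

theorem two_le_of_mem_groups : ∀ D ≤ 11, ∀ l ∈ groups D, ∀ m ∈ l, 2 ≤ m := by decide +kernel

theorem groups_separated : ∀ D ≤ 11, 4 ≤ D → ∀ l ∈ groups D, ∀ l' ∈ groups D, l = l' ∨
    (l = [D] ∧ l' = List.replicate (D - 1) 2) ∨ (l' = [D] ∧ l = List.replicate (D - 1) 2) ∨
    separates D l l' = true ∨ separates D l' l = true := by
  decide +kernel

theorem eq_of_systemSets_eq {D : ℕ} (h4 : 4 ≤ D) (h11 : D ≤ 11) {l l' : List ℕ} (hl : l ∈ groups D)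
    (hl' : l' ∈ groups D)
    (hmax : ∀ A : Multiset (GT l), Atom A → A.card ≤ D) (hmax' : ∀ A : Multiset (GT l'), Atom A → A.card ≤ D)
    (h : SystemSets (GT l) = SystemSets (GT l')) : l = l' := by
  have h2 := two_le_of_mem_groups D h11 l hl
  have h2' := two_le_of_mem_groups D h11 l' hl'
  rcases groups_separated D h11 h4 l hl l' hl' with e | ⟨rfl, rfl⟩ | ⟨rfl, rfl⟩ | hs | hs
  · exact e
  · exact absurd h (systemSets_ne_of_cyclic h4 h11 hmax)
  · exact absurd h.symm (systemSets_ne_of_cyclic h4 h11 hmax')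
  · exact absurd h (systemSets_ne_of_separates h2 h2' h4 h11 hs hmax hmax')
  · exact absurd h.symm (systemSets_ne_of_separates h2' h2 h4 h11 hs hmax' hmax)

end SetsOfLengths

open SetsOfLengths in
theorem stmt_19 {G G' : Type*} [AddCommGroup G] [Fintype G] [AddCommGroup G'] [Fintype G']
    (hD : DavenportC G = DavenportC G') (h4 : 4 ≤ DavenportC G) (h11 : DavenportC G ≤ 11)
    (hL : SystemSets G = SystemSets G') : Nonempty (G ≃+ G') := by
  obtain ⟨U, hU, hUD⟩ := exists_atom_card_eq_davenportC (G := G)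
  obtain ⟨V, hV, hVD⟩ := exists_atom_card_eq_davenportC (G := G')
  have hU' : MaxAtom U := ⟨hU, fun A hA => hUD ▸ hA.card_le_davenportC⟩
  have hV' : MaxAtom V := ⟨hV, fun A hA => hVD ▸ hA.card_le_davenportC⟩
  obtain ⟨l, hl, e⟩ := exists_group hU' (hUD ▸ h11)
  obtain ⟨l', hl', e'⟩ := exists_group hV' (hVD ▸ hD ▸ h11)
  have hUV : V.card = U.card := by rw [hUD, hVD, hD]
  rw [hUV] at hl'
  have hLe : SystemSets (GT l) = SystemSets (GT l') := by
    rw [← systemSets_congr e.some, hL, systemSets_congr e'.some]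
  have := eq_of_systemSets_eq (hUD ▸ h4) (hUD ▸ h11) hl hl' (card_le_congr hU'.2 (e.map AddEquiv.symm))
    (card_le_congr (hUV ▸ hV'.2) (e'.map AddEquiv.symm)) hLe
  subst this
  exact ⟨e.some.trans e'.some.symm⟩
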